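/- Let q be an odd prime power with q ≡ 2 (mod 3). A matroid M is representable over both 𝔽₃ and 𝔽_q if and only if M is representable over every field of characteristic different from 2. -/

import Mathlib

universe u v w

open Matroid Set

namespace Paper

/-- The deletion of the set `D` from the matroid `M`. -/
def delete {α : Type u} (M : Matroid α) (D : Set α) : Matroid α := M ↾ (M.E \ D)

/-- The contraction of the set `C` in the matroid `M`. -/
def contract {α : Type u} (M : Matroid α) (C : Set α) : Matroid α := (delete M✶ C)✶

/-- `N` is a minor of `M`: it is obtained from `M` by a sequence of deletions and
contractions, equivalently by a single contraction followed by a single deletion. -/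
def IsMinor {α : Type u} (N M : Matroid α) : Prop :=
  ∃ C D : Set α, N = delete (contract M C) D

/-- `M` is a copy of the uniform matroid `U(r,n)`: its ground set has `n` elements and its
independent sets are exactly the subsets of the ground set with at most `r` elements. -/
def IsUniform {α : Type u} (M : Matroid α) (r n : ℕ) : Prop :=
  M.E.Finite ∧ M.E.ncard = n ∧ ∀ I ⊆ M.E, (M.Indep I ↔ I.ncard ≤ r)

/-- `M` has a minor isomorphic to the uniform matroid `U(r,n)`. -/
def HasUniformMinor {α : Type u} (M : Matroid α) (r n : ℕ) : Prop :=
  ∃ N : Matroid α, IsMinor N M ∧ IsUniform N r n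

/-- `M` is without large uniform minors: no minor of `M` is isomorphic to `U(2,5)` or
`U(3,5)`. -/
def NoLargeUniformMinors {α : Type u} (M : Matroid α) : Prop :=
  ¬ HasUniformMinor M 2 5 ∧ ¬ HasUniformMinor M 3 5

/-- `M` is isomorphic to the Fano matroid `F₇`, the matroid on the seven nonzero vectors of
`(𝔽₂)³` whose independent sets are the `𝔽₂`-linearly independent subsets. -/
def IsFano {α : Type u} (M : Matroid α) : Prop :=
  ∃ f : α → (Fin 3 → ZMod 2),
    Set.BijOn f M.E {x | x ≠ 0} ∧
    ∀ I ⊆ M.E, (M.Indep I ↔ Set.InjOn f I ∧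
      LinearIndependent (ZMod 2) (fun x : (f '' I) => (x : Fin 3 → ZMod 2)))

/-- `M` has a minor isomorphic to the Fano matroid `F₇`. -/
def HasFanoMinor {α : Type u} (M : Matroid α) : Prop :=
  ∃ N : Matroid α, IsMinor N M ∧ IsFano N

/-- `M` has a minor isomorphic to the dual Fano matroid `F₇*`. -/
def HasFanoDualMinor {α : Type u} (M : Matroid α) : Prop :=
  ∃ N : Matroid α, IsMinor N M ∧ IsFano N✶

/-- `M` is representable over the field `K`: there are a `K`-vector space `V` and a map
`φ` from the ground type to `V` such that a set `I ⊆ M.E` is independent in `M` if and only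
if the family `φ` restricted to `I` is linearly independent over `K` (equivalently, `φ` is
injective on `I` and the image `φ '' I` is linearly independent). -/
def Representable {α : Type u} (M : Matroid α) (K : Type v) [Field K] : Prop :=
  ∃ (V : Type (max u v)) (_ : AddCommGroup V) (_ : Module K V) (φ : α → V),
    ∀ I ⊆ M.E, (M.Indep I ↔ LinearIndependent K (fun x : I => φ x))

end Paper

set_option linter.unusedSimpArgs false
set_option linter.unusedSectionVars false

namespace VecConfig

section Bracket

variable {F : Type*} [Field F] {ι : Type*} [Fintype ι] [DecidableEq ι] {E : Type*}

/-- The determinant of the vectors of the configuration `φ` listed by `t`. -/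
def D (φ : E → ι → F) (t : ι → E) : F := Matrix.detRowAlternating fun i => φ (t i)

/-- The `i`-th coordinate of the vector `φ e` in the basis listed by `t` (Cramer's rule). -/
def co (φ : E → ι → F) (t : ι → E) (e : E) (i : ι) : F :=
  D φ (Function.update t i e) / D φ t

lemma D_eq_det (φ : E → ι → F) (t : ι → E) :
    D φ t = (Matrix.of fun i => φ (t i)).det := rfl

lemma comp_update (φ : E → ι → F) (t : ι → E) (i : ι) (e : E) :
    (fun k => φ (Function.update t i e k)) = Function.update (fun k => φ (t k)) i (φ e) := by
  funext k
  by_cases h : k = i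
  · subst h; simp
  · simp [h]

lemma D_update (φ : E → ι → F) (t : ι → E) (i : ι) (e : E) :
    D φ (Function.update t i e)
      = Matrix.detRowAlternating (Function.update (fun k => φ (t k)) i (φ e)) := by
  rw [D, comp_update]

lemma D_eq_zero_of_eq (φ : E → ι → F) (t : ι → E) {i j : ι} (hij : i ≠ j) (h : t i = t j) :
    D φ t = 0 :=
  AlternatingMap.map_eq_zero_of_eq _ _ (by simp [h]) hij

lemma injective_of_D_ne_zero {φ : E → ι → F} {t : ι → E} (h : D φ t ≠ 0) :
    Function.Injective t := by
  intro i j hij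
  by_contra hne
  exact h (D_eq_zero_of_eq φ t hne hij)

lemma D_swap (φ : E → ι → F) (t : ι → E) {i j : ι} (hij : i ≠ j) :
    D φ (t ∘ Equiv.swap i j) = - D φ t :=
  Matrix.detRowAlternating.map_swap (fun k => φ (t k)) hij

lemma D_perm (φ : E → ι → F) (t : ι → E) (σ : Equiv.Perm ι) :
    D φ (t ∘ σ) = Equiv.Perm.sign σ • D φ t :=
  Matrix.detRowAlternating.map_perm (fun k => φ (t k)) σ

lemma D_update_eq (φ : E → ι → F) {t : ι → E} (ht : D φ t ≠ 0) (i : ι) (e : E) :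
    D φ (Function.update t i e) = co φ t e i * D φ t := by
  rw [co, div_mul_cancel₀ _ ht]

lemma co_self (φ : E → ι → F) {t : ι → E} (ht : D φ t ≠ 0) (j i : ι) :
    co φ t (t j) i = if i = j then 1 else 0 := by
  split_ifs with h
  · subst h; simp [co, ht]
  · rw [co, D_eq_zero_of_eq φ _ h (by simp [Ne.symm h]), zero_div]

lemma sum_co (φ : E → ι → F) {t : ι → E} (ht : D φ t ≠ 0) (e : E) :
    φ e = ∑ i, co φ t e i • φ (t i) := by
  have h := Matrix.mulVec_cramer (Matrix.of fun i => φ (t i)).transpose (φ e)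
  have h2 : (Matrix.of fun i => φ (t i)).transpose.cramer (φ e)
      = fun i => co φ t e i * D φ t := by
    funext i
    rw [Matrix.cramer_transpose_apply, ← D_update_eq φ ht, D_update]
    rfl
  rw [h2, Matrix.det_transpose, ← D_eq_det] at h
  funext k
  have hk := congrFun h k
  simp only [Matrix.mulVec, dotProduct, Matrix.transpose_apply, Matrix.of_apply, Pi.smul_apply,
    smul_eq_mul] at hk
  simp only [Finset.sum_apply, Pi.smul_apply, smul_eq_mul]
  apply mul_left_cancel₀ ht
  rw [← hk, Finset.mul_sum]
  exact Finset.sum_congr rfl fun i _ => by ring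

lemma linearIndependent_of_D_ne_zero {φ : E → ι → F} {t : ι → E} (ht : D φ t ≠ 0) :
    LinearIndependent F fun i => φ (t i) := by
  have : IsUnit (Matrix.of fun i => φ (t i)) := by
    rw [Matrix.isUnit_iff_isUnit_det]; exact isUnit_iff_ne_zero.mpr ht
  exact Matrix.linearIndependent_rows_iff_isUnit.mpr this

lemma D_ne_zero_iff {φ : E → ι → F} {t : ι → E} :
    D φ t ≠ 0 ↔ LinearIndependent F fun i => φ (t i) := by
  refine ⟨linearIndependent_of_D_ne_zero, fun h => ?_⟩
  have : IsUnit (Matrix.of fun i => φ (t i)) := Matrix.linearIndependent_rows_iff_isUnit.mp h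
  rw [Matrix.isUnit_iff_isUnit_det] at this
  exact this.ne_zero

lemma co_unique (φ : E → ι → F) {t : ι → E} (ht : D φ t ≠ 0) (e : E) (c : ι → F)
    (h : φ e = ∑ i, c i • φ (t i)) : c = co φ t e := by
  have hl := linearIndependent_of_D_ne_zero ht
  have h0 : ∑ i, (c i - co φ t e i) • φ (t i) = 0 := by
    simp only [sub_smul, Finset.sum_sub_distrib]
    rw [← h, ← sum_co φ ht, sub_self]
  funext i
  exact sub_eq_zero.mp (Fintype.linearIndependent_iff.mp hl _ h0 i)

lemma D_update_sum (φ : E → ι → F) {t : ι → E} (ht : D φ t ≠ 0) (s : ι → E) (i : ι) (e : E) :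
    D φ (Function.update s i e) = ∑ l, co φ t e l * D φ (Function.update s i (t l)) := by
  simp only [D_update]
  conv_lhs => rw [sum_co φ ht e]
  rw [AlternatingMap.map_update_sum]
  simp only [AlternatingMap.map_update_smul, smul_eq_mul]

lemma update_update_swap (t : ι → E) {i j : ι} (hij : i ≠ j) (q : E) :
    Function.update (Function.update t i (t j)) j q
      = Function.update t i q ∘ Equiv.swap i j := by
  funext k
  by_cases hk : k = j
  · subst hk; simp
  · by_cases hk' : k = i
    · subst hk'; simp [hij, hij.symm]
    · simp [hk, hk', Equiv.swap_apply_of_ne_of_ne hk' hk]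

lemma D_update_two (φ : E → ι → F) {t : ι → E} (ht : D φ t ≠ 0) {i j : ι} (hij : i ≠ j) (p q : E) :
    D φ (Function.update (Function.update t i p) j q)
      = D φ t * (co φ t p i * co φ t q j - co φ t p j * co φ t q i) := by
  rw [Function.update_comm hij, D_update_sum φ ht, Finset.sum_eq_add i j hij]
  · rw [Function.update_comm hij.symm, Function.update_eq_self,
      Function.update_comm hij.symm, update_update_swap t hij, D_swap φ _ hij,
      D_update_eq φ ht, D_update_eq φ ht]
    ring
  · rintro l - ⟨h1, h2⟩
    rw [D_eq_zero_of_eq φ _ h1.symm (by simp [h1, h2]), mul_zero]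
  · simp
  · simp

lemma D_update_three (φ : E → ι → F) {t : ι → E} (ht : D φ t ≠ 0) {i j k : ι} (hij : i ≠ j)
    (hik : i ≠ k) (hjk : j ≠ k) (p q s : E) :
    D φ (Function.update (Function.update (Function.update t i p) j q) k s)
      = D φ t * (co φ t s k * (co φ t p i * co φ t q j - co φ t p j * co φ t q i)
        - co φ t s i * (co φ t p k * co φ t q j - co φ t p j * co φ t q k)
        - co φ t s j * (co φ t p i * co φ t q k - co φ t p k * co φ t q i)) := by
  have e0 : ∀ x y z : E, Function.update (Function.update (Function.update t i x) j y) k z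
      = Function.update (Function.update (Function.update t i x) k z) j y := fun x y z => by
    rw [Function.update_comm hjk]
  have e1 : ∀ x y z : E, Function.update (Function.update (Function.update t i x) j y) k z
      = Function.update (Function.update (Function.update t j y) k z) i x := fun x y z => by
    rw [Function.update_comm hij, Function.update_comm hik]
  have hk : Function.update (Function.update (Function.update t i p) j q) k (t k)
      = Function.update (Function.update t i p) j q := by
    have : t k = Function.update (Function.update t i p) j q k := by simp [hik.symm, hjk.symm]
    rw [this, Function.update_eq_self]
  have key : ∀ l ∈ (Finset.univ : Finset ι), l ∉ ({i, j, k} : Finset ι) →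
      co φ t s l * D φ (Function.update (Function.update (Function.update t i p) j q) k (t l))
        = 0 := by
    intro l _ hl
    simp only [Finset.mem_insert, Finset.mem_singleton, not_or] at hl
    rw [D_eq_zero_of_eq φ _ (Ne.symm hl.2.2) (by simp [hl.1, hl.2.1, hl.2.2]), mul_zero]
  rw [D_update_sum φ ht, ← Finset.sum_subset (Finset.subset_univ {i, j, k}) key,
    Finset.sum_insert (by simp [hij, hik]), Finset.sum_insert (by simp [hjk]),
    Finset.sum_singleton, hk, D_update_two φ ht hij]
  have hi : D φ (Function.update (Function.update (Function.update t i p) j q) k (t i))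
      = - (D φ t * (co φ t p k * co φ t q j - co φ t p j * co φ t q k)) := by
    rw [e1]
    have : Function.update (Function.update (Function.update t j q) k (t i)) i p
        = Function.update (Function.update t j q) k p ∘ Equiv.swap k i := by
      rw [← update_update_swap _ hik.symm]; simp [hij]
    rw [this, D_swap φ _ hik.symm, Function.update_comm hjk, D_update_two φ ht hjk.symm]
  have hj : D φ (Function.update (Function.update (Function.update t i p) j q) k (t j))
      = - (D φ t * (co φ t p i * co φ t q k - co φ t p k * co φ t q i)) := by
    rw [e0]
    have : Function.update (Function.update (Function.update t i p) k (t j)) j q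
        = Function.update (Function.update t i p) k q ∘ Equiv.swap k j := by
      rw [← update_update_swap _ hjk.symm]; simp [hij.symm]
    rw [this, D_swap φ _ hjk.symm, D_update_two φ ht hik]
  rw [hi, hj]
  ring

lemma D_pivot_ne_zero {φ : E → ι → F} {t : ι → E} (ht : D φ t ≠ 0) {i : ι} {x : E}
    (hx : co φ t x i ≠ 0) : D φ (Function.update t i x) ≠ 0 := by
  rw [D_update_eq φ ht]; exact mul_ne_zero hx ht

lemma co_pivot_self (φ : E → ι → F) {t : ι → E} (ht : D φ t ≠ 0) {i : ι} {x : E}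
    (hx : co φ t x i ≠ 0) (e : E) :
    co φ (Function.update t i x) e i = co φ t e i / co φ t x i := by
  rw [co, Function.update_idem, D_update_eq φ ht, D_update_eq φ ht]
  field_simp

lemma co_pivot_of_ne (φ : E → ι → F) {t : ι → E} (ht : D φ t ≠ 0) {i j : ι} (hij : j ≠ i) {x : E}
    (hx : co φ t x i ≠ 0) (e : E) :
    co φ (Function.update t i x) e j
      = co φ t e j - co φ t x j * co φ t e i / co φ t x i := by
  rw [co, D_update_two φ ht hij.symm, D_update_eq φ ht]
  field_simp

end Bracket

section Forms

/-- A map between fields that is compatible with the symmetries of the cross-ratio. -/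
structure IsLift {F K : Type*} [Field F] [Field K] (f : F → K) : Prop where
  zero : f 0 = 0
  one : f 1 = 1
  inv : ∀ x, f x⁻¹ = (f x)⁻¹
  sub : ∀ x, f (1 - x) = 1 - f x
  eq_zero : ∀ x, f x = 0 → x = 0

/-- `W` is the bracket of a configuration of vectors of a plane. -/
def IsLine {F E : Type*} [Field F] (W : E → E → F) : Prop :=
  ∀ a b, W a b ≠ 0 → ∃ u v : E → F, u a = 1 ∧ v a = 0 ∧ u b = 0 ∧ v b = 1 ∧
    ∀ p q, W p q = W a b * (u p * v q - v p * u q)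

/-- `T` is the bracket of a configuration of vectors of a three-dimensional space. -/
def IsPlane {F E : Type*} [Field F] (T : E → E → E → F) : Prop :=
  ∀ a b c, T a b c ≠ 0 → ∃ u v w : E → F,
    (u a = 1 ∧ v a = 0 ∧ w a = 0) ∧ (u b = 0 ∧ v b = 1 ∧ w b = 0) ∧
    (u c = 0 ∧ v c = 0 ∧ w c = 1) ∧
    ∀ p q s, T p q s = T a b c * (w s * (u p * v q - v p * u q)
        - u s * (w p * v q - v p * w q) - v s * (u p * w q - w p * u q))

/-- The map `f` carries the cross-ratio of `a, b, c, d` for `W` to the one for `W'`. -/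
def Quad {F K E : Type*} [Field F] [Field K] (f : F → K) (W : E → E → F) (W' : E → E → K)
    (a b c d : E) : Prop :=
  W a b ≠ 0 → W c d ≠ 0 → W a c ≠ 0 → W a d ≠ 0 → W b c ≠ 0 → W b d ≠ 0 →
    f (W a c * W b d / (W a d * W b c)) = W' a c * W' b d / (W' a d * W' b c)

variable {F K E : Type*} [Field F] [Field K]

lemma IsLift.eq_one {f : F → K} (hf : IsLift f) {x : F} (h : f x = 1) : x = 1 := by
  have := hf.eq_zero (1 - x) (by rw [hf.sub, h, sub_self])
  exact (sub_eq_zero.mp this).symm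

lemma IsLift.eq_zero_iff {f : F → K} (hf : IsLift f) {x : F} : f x = 0 ↔ x = 0 :=
  ⟨hf.eq_zero x, fun h => by rw [h, hf.zero]⟩

lemma IsLift.eq_one_iff {f : F → K} (hf : IsLift f) {x : F} : f x = 1 ↔ x = 1 :=
  ⟨hf.eq_one, fun h => by rw [h, hf.one]⟩

lemma IsLine.antisymm {W : E → E → F} (hW : IsLine W) (a b : E) : W b a = - W a b := by
  by_cases h : ∃ p q, W p q ≠ 0
  · obtain ⟨p, q, hpq⟩ := h
    obtain ⟨u, v, -, -, -, -, h⟩ := hW p q hpq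
    rw [h b a, h a b]; ring
  · push Not at h
    simp [h]

lemma IsLine.self {W : E → E → F} (hW : IsLine W) (a : E) : W a a = 0 := by
  by_contra h
  obtain ⟨u, v, h1, h2, h3, h4, -⟩ := hW a a h
  exact one_ne_zero (h1.symm.trans h3)

lemma IsLine.plucker {W : E → E → F} (hW : IsLine W) (a b c d : E) :
    W a b * W c d - W a c * W b d + W a d * W b c = 0 := by
  by_cases h : ∃ p q, W p q ≠ 0
  · obtain ⟨p, q, hpq⟩ := h
    obtain ⟨u, v, -, -, -, -, h⟩ := hW p q hpq
    rw [h a b, h c d, h a c, h b d, h a d, h b c]; ring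
  · push Not at h
    simp [h]

lemma IsPlane.isLine {T : E → E → E → F} (hT : IsPlane T) (w : E) :
    IsLine fun p q => T p q w := by
  intro a b hab
  obtain ⟨u, v, w', ⟨h1, h2, h3⟩, ⟨h4, h5, h6⟩, ⟨h7, h8, h9⟩, h⟩ := hT a b w hab
  exact ⟨u, v, h1, h2, h4, h5, fun p q => by
    simp only [h p q w, h7, h8, h9]; ring⟩

lemma IsPlane.swap12 {T : E → E → E → F} (hT : IsPlane T) (a b c : E) :
    T b a c = - T a b c := (hT.isLine c).antisymm a b

lemma IsPlane.swap23 {T : E → E → E → F} (hT : IsPlane T) (a b c : E) :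
    T a c b = - T a b c := by
  by_cases h : ∃ p q s, T p q s ≠ 0
  · obtain ⟨p, q, s, hpq⟩ := h
    obtain ⟨u, v, w, -, -, -, h⟩ := hT p q s hpq
    rw [h a c b, h a b c]; ring
  · push Not at h
    simp [h]

lemma zmod_three_eq_neg : ∀ x y : ZMod 3, x ≠ 0 → y ≠ 0 → x ≠ y → x = - y := by decide

/-- Over the field with three elements a plane has no five pairwise independent vectors. -/
lemma IsLine.four_points {W : E → E → ZMod 3} (hW : IsLine W) {a b c d : E} (h1 : W a b ≠ 0)
    (h2 : W c d ≠ 0) (h3 : W a c ≠ 0) (h4 : W a d ≠ 0) (h5 : W b c ≠ 0) (h6 : W b d ≠ 0) :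
    W a c * W b d = - (W a d * W b c) := by
  apply zmod_three_eq_neg _ _ (mul_ne_zero h3 h6) (mul_ne_zero h4 h5)
  intro h
  have := hW.plucker a b c d
  rw [h, sub_add_cancel] at this
  exact mul_ne_zero h1 h2 this

lemma IsLine.no_five {W : E → E → ZMod 3} (hW : IsLine W) {a b c d e : E}
    (hab : W a b ≠ 0) (hac : W a c ≠ 0) (had : W a d ≠ 0) (hae : W a e ≠ 0) (hbc : W b c ≠ 0)
    (hbd : W b d ≠ 0) (hbe : W b e ≠ 0) (hcd : W c d ≠ 0) (hce : W c e ≠ 0) (hde : W d e ≠ 0) :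
    False := by
  have h1 := hW.four_points hab hcd hac had hbc hbd
  have h2 := hW.four_points hab hce hac hae hbc hbe
  have h3 := hW.plucker a b d e
  have h4 : (W a d * W b e - W a e * W b d) * (W a c * W b c) = 0 := by
    linear_combination W a d * W b c * h2 - W a e * W b c * h1
  have h5 : W a d * W b e - W a e * W b d = 0 :=
    (mul_eq_zero.mp h4).resolve_right (mul_ne_zero hac hbc)
  exact mul_ne_zero hab hde (by linear_combination h3 + h5)

/-- Over the field with three elements there are no five vectors of a three-dimensional space any
three of which are independent. -/
lemma IsPlane.no_five {T : E → E → E → ZMod 3} (hT : IsPlane T) {a b c d e : E}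
    (habc : T a b c ≠ 0) (habd : T a b d ≠ 0) (habe : T a b e ≠ 0) (hacd : T a c d ≠ 0)
    (hace : T a c e ≠ 0) (hade : T a d e ≠ 0) (hbcd : T b c d ≠ 0) (hbce : T b c e ≠ 0)
    (hbde : T b d e ≠ 0) (hcde : T c d e ≠ 0) : False := by
  obtain ⟨u, v, w, ⟨a1, a2, a3⟩, ⟨b1, b2, b3⟩, ⟨c1, c2, c3⟩, h⟩ := hT a b c habc
  have key : ∀ x : ZMod 3, x = - x → x = 0 := by decide
  rw [h] at habd habe hacd hace hade hbcd hbce hbde hcde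
  simp only [a1, a2, a3, b1, b2, b3, c1, c2, c3, one_mul, mul_one, zero_mul, mul_zero, sub_zero,
    zero_sub, sub_neg_eq_add, zero_add, mul_neg, neg_ne_zero]
    at habd habe hacd hace hade hbcd hbce hbde hcde
  have z1 := zmod_three_eq_neg (w d * v e) (w e * v d)
    (mul_ne_zero (right_ne_zero_of_mul habd) (right_ne_zero_of_mul hace))
    (mul_ne_zero (right_ne_zero_of_mul habe) (right_ne_zero_of_mul hacd))
    (fun hh => hade (by linear_combination (-T a b c) * hh))
  have z2 := zmod_three_eq_neg (w d * u e) (w e * u d)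
    (mul_ne_zero (right_ne_zero_of_mul habd) (right_ne_zero_of_mul hbce))
    (mul_ne_zero (right_ne_zero_of_mul habe) (right_ne_zero_of_mul hbcd))
    (fun hh => hbde (by linear_combination (T a b c) * hh))
  have z3 := zmod_three_eq_neg (v d * u e) (v e * u d)
    (mul_ne_zero (right_ne_zero_of_mul hacd) (right_ne_zero_of_mul hbce))
    (mul_ne_zero (right_ne_zero_of_mul hace) (right_ne_zero_of_mul hbcd))
    (fun hh => hcde (by linear_combination (-T a b c) * hh))
  have z4 : w d * (v e * u e) = 0 :=
    key _ (by linear_combination u e * z1 - w e * z3 + v e * z2)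
  exact mul_ne_zero (right_ne_zero_of_mul habd) (mul_ne_zero (right_ne_zero_of_mul hace)
    (right_ne_zero_of_mul hbce)) z4

end Forms

section QuadSymmetry

variable {F K E : Type*} [Field F] [Field K] {f : F → K} {W : E → E → F} {W' : E → E → K}

lemma Quad.swap12 (hf : IsLift f) (hW : IsLine W) {a b c d : E} (h : Quad f W W' a b c d) :
    Quad f W W' b a c d := by
  intro h1 h2 h3 h4 h5 h6
  have := h (by rw [hW.antisymm b a]; exact neg_ne_zero.mpr h1) h2 h5 h6 h3 h4
  rw [← inv_div, hf.inv, mul_comm (W b d), mul_comm (W b c), this, inv_div,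
    mul_comm (W' b d), mul_comm (W' b c)]

lemma Quad.swap34 (hf : IsLift f) (hW : IsLine W) {a b c d : E} (h : Quad f W W' a b c d) :
    Quad f W W' a b d c := by
  intro h1 h2 h3 h4 h5 h6
  have := h h1 (by rw [hW.antisymm d c]; exact neg_ne_zero.mpr h2) h4 h3 h6 h5
  rw [← inv_div, hf.inv, this, inv_div]

lemma Quad.swap23 (hf : IsLift f) (hW : IsLine W) (hW' : IsLine W')
    (h0 : ∀ p q, W p q = 0 ↔ W' p q = 0) {a b c d : E} (h : Quad f W W' a b c d) :
    Quad f W W' a c b d := by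
  intro h1 h2 h3 h4 h5 h6
  rw [hW.antisymm b c, neg_ne_zero] at h5
  have h4' : W' a d ≠ 0 := (h0 a d).not.mp h4
  have h5' : W' b c ≠ 0 := (h0 b c).not.mp h5
  have := h h3 h6 h1 h4 h5 h2
  have e1 : W a b * W c d / (W a d * W c b) = 1 - W a c * W b d / (W a d * W b c) := by
    rw [hW.antisymm b c]
    field_simp
    linear_combination (-1 : F) * hW.plucker a b c d
  have e2 : W' a b * W' c d / (W' a d * W' c b) = 1 - W' a c * W' b d / (W' a d * W' b c) := by
    rw [hW'.antisymm b c]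
    field_simp
    linear_combination (-1 : K) * hW'.plucker a b c d
  rw [e1, hf.sub, this, e2]

/-- The cross-ratio condition for all quadruples that involve `x` and `y` follows from those whose
last two entries are `x` and `y`. -/
lemma Quad.of_pair (hf : IsLift f) (hW : IsLine W) (hW' : IsLine W')
    (h0 : ∀ p q, W p q = 0 ↔ W' p q = 0) {x y : E} (hxy : x ≠ y)
    (h : ∀ a b, Quad f W W' a b x y) {a b c d : E} (hx : x = a ∨ x = b ∨ x = c ∨ x = d)
    (hy : y = a ∨ y = b ∨ y = c ∨ y = d) : Quad f W W' a b c d := by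
  have s12 : ∀ {a b c d}, Quad f W W' a b c d → Quad f W W' b a c d := fun q => q.swap12 hf hW
  have s34 : ∀ {a b c d}, Quad f W W' a b c d → Quad f W W' a b d c := fun q => q.swap34 hf hW
  have s23 : ∀ {a b c d}, Quad f W W' a b c d → Quad f W W' a c b d :=
    fun q => q.swap23 hf hW hW' h0
  have g : ∀ a b, Quad f W W' a b y x := fun a b => s34 (h a b)
  have i1 : ∀ a b, Quad f W W' a x b y := fun a b => s23 (h a b)
  have i2 : ∀ a b, Quad f W W' a y b x := fun a b => s23 (g a b)
  have i3 : ∀ a b, Quad f W W' a x y b := fun a b => s34 (i1 a b)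
  have i4 : ∀ a b, Quad f W W' a y x b := fun a b => s34 (i2 a b)
  rcases hx with rfl | rfl | rfl | rfl <;> rcases hy with rfl | rfl | rfl | rfl
  · exact absurd rfl hxy
  · exact s23 (s12 (i3 _ _))
  · exact s12 (i3 _ _)
  · exact s12 (i1 _ _)
  · exact s23 (s12 (i4 _ _))
  · exact absurd rfl hxy
  · exact i3 _ _
  · exact i1 _ _
  · exact s12 (i4 _ _)
  · exact i4 _ _
  · exact absurd rfl hxy
  · exact h _ _
  · exact s12 (i2 _ _)
  · exact i2 _ _
  · exact g _ _
  · exact absurd rfl hxy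

end QuadSymmetry

section Plane

variable {F K E : Type*} [Field F] [Field K] {f : F → K} {T : E → E → E → F}
  {T' : E → E → E → K} {T₃ : E → E → E → ZMod 3}

/-- A configuration `T'` in a plane over `K` that has the same zero pattern as `T` over `F` and
`T₃` over the field with three elements. -/
structure PlanePair (f : F → K) (T : E → E → E → F) (T' : E → E → E → K)
    (T₃ : E → E → E → ZMod 3) : Prop where
  lift : IsLift f
  left : IsPlane T
  right : IsPlane T'
  tern : IsPlane T₃
  zero : ∀ p q s, T p q s = 0 ↔ T' p q s = 0
  zero₃ : ∀ p q s, T p q s = 0 ↔ T₃ p q s = 0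

lemma PlanePair.skew_perm (h : PlanePair f T T' T₃) {a b c : E} (habc : T a b c ≠ 0) :
    T a c b ≠ 0 ∧ T b a c ≠ 0 ∧ T b c a ≠ 0 ∧ T c a b ≠ 0 ∧ T c b a ≠ 0 := by
  have h1 : T a c b ≠ 0 := by rw [h.left.swap23]; exact neg_ne_zero.mpr habc
  have h2 : T b a c ≠ 0 := by rw [h.left.swap12]; exact neg_ne_zero.mpr habc
  have h3 : T b c a ≠ 0 := by rw [h.left.swap23]; exact neg_ne_zero.mpr h2
  have h4 : T c a b ≠ 0 := by rw [h.left.swap12]; exact neg_ne_zero.mpr h1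
  have h5 : T c b a ≠ 0 := by rw [h.left.swap12]; exact neg_ne_zero.mpr h3
  exact ⟨h1, h2, h3, h4, h5⟩

/-- Among five vectors of a plane, two are parallel as seen from `w`. -/
lemma PlanePair.no_five_line (h : PlanePair f T T' T₃) (w : E) {a b c d e : E}
    (hab : T a b w ≠ 0) (hac : T a c w ≠ 0) (had : T a d w ≠ 0) (hbc : T b c w ≠ 0)
    (hbd : T b d w ≠ 0) (hcd : T c d w ≠ 0) (hde : T d e w ≠ 0) :
    T a e w = 0 ∨ T b e w = 0 ∨ T c e w = 0 := by
  by_contra hcon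
  push Not at hcon
  obtain ⟨hae, hbe, hce⟩ := hcon
  have z := fun p q => (h.zero₃ p q w).not
  exact (h.tern.isLine w).no_five ((z _ _).mp hab) ((z _ _).mp hac) ((z _ _).mp had)
    ((z _ _).mp hae) ((z _ _).mp hbc) ((z _ _).mp hbd) ((z _ _).mp hbe) ((z _ _).mp hcd)
    ((z _ _).mp hce) ((z _ _).mp hde)

variable {a b c d x y z : E}

lemma IsPlane.crossing (hT : IsPlane T) (habz : T a b z ≠ 0) (habc : T a b c = 0)
    (hxza : T x z a = 0) (hdzb : T d z b = 0) (h1 : T a b x ≠ 0) (h2 : T c d x ≠ 0)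
    (h3 : T a c x ≠ 0) (h4 : T a d x ≠ 0) (h5 : T b c x ≠ 0) (h6 : T b d x ≠ 0) :
    (T a b d ≠ 0 ∧ T c x d ≠ 0 ∧ T a c d ≠ 0 ∧ T a x d ≠ 0 ∧ T b c d ≠ 0 ∧ T b x d ≠ 0 ∧
      T a c d * T b x d / (T a x d * T b c d) = T a c x * T b d x / (T a d x * T b c x)) ∧
    (T a z c ≠ 0 ∧ T x d c ≠ 0 ∧ T a x c ≠ 0 ∧ T a d c ≠ 0 ∧ T z x c ≠ 0 ∧ T z d c ≠ 0 ∧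
      T a x c * T z d c / (T a d c * T z x c)
        = (T a c x * T b d x / (T a d x * T b c x))⁻¹) := by
  obtain ⟨u, v, w, ⟨a1, a2, a3⟩, ⟨b1, b2, b3⟩, ⟨c1, c2, c3⟩, h⟩ := hT a b z habz
  have wc : w c = 0 := by
    rw [h, a1, a2, a3, b1, b2, b3] at habc
    simpa [habz] using habc
  have vx : v x = 0 := by
    rw [h, a1, a2, a3, c1, c2, c3] at hxza
    simpa [habz] using hxza
  have ud : u d = 0 := by
    rw [h, b1, b2, b3, c1, c2, c3] at hdzb
    simpa [habz] using hdzb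
  simp only [h a b x, h c d x, h a c x, h a d x, h b c x, h b d x, h a b d, h c x d, h a c d,
    h a x d, h b c d, h b x d, h a z c, h x d c, h a x c, h a d c, h z x c, h z d c,
    a1, a2, a3, b1, b2, b3, c1, c2, c3, wc, vx, ud, one_mul, mul_one, zero_mul, mul_zero,
    sub_zero, zero_sub, mul_neg, ne_eq, neg_eq_zero, mul_eq_zero, not_or,
    sub_neg_eq_add, zero_add, add_zero] at h1 h2 h3 h4 h5 h6 ⊢
  obtain ⟨-, hwx⟩ := h1
  obtain ⟨-, h2⟩ := h2
  obtain ⟨-, -, hvc⟩ := h3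
  obtain ⟨-, -, hvd⟩ := h4
  obtain ⟨-, -, huc⟩ := h5
  obtain ⟨-, hux, hwd⟩ := h6
  refine ⟨⟨⟨habz, hwd⟩, ⟨habz, fun e => h2 (by linear_combination - e)⟩, ⟨habz, hwd, hvc⟩,
    ⟨habz, hvd, hwx⟩, ⟨habz, hwd, huc⟩, ⟨habz, hwd, hux⟩, ?_⟩, ⟨habz, hvc⟩,
    ⟨habz, fun e => h2 (by linear_combination - e)⟩, ⟨habz, hvc, hwx⟩, ⟨habz, hvc, hwd⟩,
    ⟨habz, hvc, hux⟩, ⟨habz, huc, hvd⟩, ?_⟩ <;> field_simp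

lemma IsPlane.cross_flat (hT : IsPlane T) (habz : T a b z ≠ 0) (habc : T a b c = 0)
    (habd : T a b d = 0) (h1 : T a b x ≠ 0) (h2 : T c d x ≠ 0)
    (h3 : T a c x ≠ 0) (h4 : T a d x ≠ 0) (h5 : T b c x ≠ 0) (h6 : T b d x ≠ 0) :
    T c d z ≠ 0 ∧ T a c z ≠ 0 ∧ T a d z ≠ 0 ∧ T b c z ≠ 0 ∧ T b d z ≠ 0 ∧
      T a c z * T b d z / (T a d z * T b c z) = T a c x * T b d x / (T a d x * T b c x) := by
  obtain ⟨u, v, w, ⟨a1, a2, a3⟩, ⟨b1, b2, b3⟩, ⟨c1, c2, c3⟩, h⟩ := hT a b z habz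
  have wc : w c = 0 := by
    rw [h, a1, a2, a3, b1, b2, b3] at habc
    simpa [habz] using habc
  have wd : w d = 0 := by
    rw [h, a1, a2, a3, b1, b2, b3] at habd
    simpa [habz] using habd
  simp only [h a b x, h c d x, h a c x, h a d x, h b c x, h b d x, h c d z, h a c z,
    h a d z, h b c z, h b d z, a1, a2, a3, b1, b2, b3, c1, c2, c3, wc, wd, one_mul, mul_one,
    zero_mul, mul_zero, sub_zero, zero_sub, mul_neg, ne_eq, neg_eq_zero, mul_eq_zero, not_or]
    at h1 h2 h3 h4 h5 h6 ⊢
  obtain ⟨-, hwx⟩ := h1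
  obtain ⟨-, -, h2⟩ := h2
  obtain ⟨-, -, hvc⟩ := h3
  obtain ⟨-, -, hvd⟩ := h4
  obtain ⟨-, -, huc⟩ := h5
  obtain ⟨-, -, hud⟩ := h6
  refine ⟨⟨habz, h2⟩, ⟨habz, hvc⟩, ⟨habz, hvd⟩, ⟨habz, huc⟩, ⟨habz, hud⟩, ?_⟩
  field_simp

lemma IsPlane.cross_parallel (hT : IsPlane T) (habz : T a b z ≠ 0) (habc : T a b c = 0)
    (hxbz : T x b z = 0) (hxdz : T x d z = 0) (h1 : T a b x ≠ 0) (h2 : T c d x ≠ 0)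
    (h3 : T a c x ≠ 0) (h4 : T a d x ≠ 0) (h5 : T b c x ≠ 0) (h6 : T b d x ≠ 0) :
    T c d z ≠ 0 ∧ T a c z ≠ 0 ∧ T a d z ≠ 0 ∧ T b c z ≠ 0 ∧ T b d z ≠ 0 ∧
      T a c z * T b d z / (T a d z * T b c z) = T a c x * T b d x / (T a d x * T b c x) := by
  obtain ⟨u, v, w, ⟨a1, a2, a3⟩, ⟨b1, b2, b3⟩, ⟨c1, c2, c3⟩, h⟩ := hT a b z habz
  have wc : w c = 0 := by
    rw [h, a1, a2, a3, b1, b2, b3] at habc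
    simpa [habz] using habc
  have ux : u x = 0 := by
    rw [h, b1, b2, b3, c1, c2, c3] at hxbz
    simpa [habz] using hxbz
  have vx : v x = 0 := by
    rw [h, c1, c2, c3, ux] at hxdz
    rcases (by simpa [habz] using hxdz : v x = 0 ∨ u d = 0) with hh | hh
    · exact hh
    · rw [h, b1, b2, b3, ux, hh] at h6
      simp at h6
  simp only [h a b x, h c d x, h a c x, h a d x, h b c x, h b d x, h c d z, h a c z,
    h a d z, h b c z, h b d z, a1, a2, a3, b1, b2, b3, c1, c2, c3, wc, ux, vx, one_mul, mul_one,
    zero_mul, mul_zero, neg_zero, sub_zero, zero_sub, mul_neg, ne_eq, neg_eq_zero, mul_eq_zero, not_or]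
    at h1 h2 h3 h4 h5 h6 ⊢
  obtain ⟨-, hwx⟩ := h1
  obtain ⟨-, -, h2⟩ := h2
  obtain ⟨-, -, hvc⟩ := h3
  obtain ⟨-, -, hvd⟩ := h4
  obtain ⟨-, -, huc⟩ := h5
  obtain ⟨-, -, hud⟩ := h6
  refine ⟨⟨habz, h2⟩, ⟨habz, hvc⟩, ⟨habz, hvd⟩, ⟨habz, huc⟩, ⟨habz, hud⟩, ?_⟩
  field_simp

lemma IsPlane.cross_collinear (hT : IsPlane T) (habz : T a b z ≠ 0) (habc : T a b c = 0)
    (hxbz : T x b z ≠ 0) (hxdz : T x d z = 0) (h1 : T a b x ≠ 0) (h2 : T c d x ≠ 0)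
    (h3 : T a c x ≠ 0) (h4 : T a d x ≠ 0) (h5 : T b c x ≠ 0) (h6 : T b d x ≠ 0) :
    T c x z ≠ 0 ∧ T a c z ≠ 0 ∧ T a x z ≠ 0 ∧ T b c z ≠ 0 ∧ T b x z ≠ 0 ∧
      T a c z * T b x z / (T a x z * T b c z) = T a c x * T b d x / (T a d x * T b c x) := by
  obtain ⟨u, v, w, ⟨a1, a2, a3⟩, ⟨b1, b2, b3⟩, ⟨c1, c2, c3⟩, h⟩ := hT a b z habz
  have wc : w c = 0 := by
    rw [h, a1, a2, a3, b1, b2, b3] at habc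
    simpa [habz] using habc
  have ux : u x ≠ 0 := by
    rw [h, b1, b2, b3, c1, c2, c3] at hxbz
    simpa [habz] using hxbz
  have hxd : u x * v d = v x * u d := by
    rw [h, c1, c2, c3] at hxdz
    simpa [habz, sub_eq_zero] using hxdz
  have vd : v d = v x * u d / u x := by field_simp; linear_combination hxd
  simp only [h a b x, h c d x, h a c x, h a d x, h b c x, h b d x, h c x z, h a c z,
    h a x z, h b c z, h b x z, a1, a2, a3, b1, b2, b3, c1, c2, c3, wc, one_mul, mul_one,
    zero_mul, mul_zero, neg_zero, sub_zero, zero_sub, mul_neg, ne_eq, neg_eq_zero, mul_eq_zero, not_or]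
    at h1 h2 h3 h4 h5 h6 ⊢
  obtain ⟨-, hwx⟩ := h1
  obtain ⟨-, -, hvc⟩ := h3
  obtain ⟨-, -, huc⟩ := h5
  have hvx : v x ≠ 0 := by
    intro e
    apply h4.2
    rw [vd, e]; ring
  have e4 : w x * v d - v x * w d = v x / u x * (u d * w x - u x * w d) := by
    rw [vd]; field_simp
  have e6 : -(w x * u d) - -(u x * w d) = - (u d * w x - u x * w d) := by ring
  have h6' : u d * w x - u x * w d ≠ 0 := by
    intro e
    apply h6.2
    rw [e6, e, neg_zero]
  have hcx : u c * v x - v c * u x ≠ 0 := by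
    intro e
    apply h2.2
    rw [vd]
    field_simp
    linear_combination (w x * u d - w d * u x) * e
  refine ⟨⟨habz, hcx⟩, ⟨habz, hvc⟩, ⟨habz, hvx⟩, ⟨habz, huc⟩, ⟨habz, ux⟩, ?_⟩
  rw [e4, e6]
  generalize u d * w x - u x * w d = r at h6'
  field_simp

lemma IsPlane.ne (hT : IsPlane T) (h : T a b c ≠ 0) : a ≠ b ∧ a ≠ c ∧ b ≠ c := by
  obtain ⟨u, v, w, ⟨a1, a2, a3⟩, ⟨b1, b2, b3⟩, ⟨c1, c2, c3⟩, -⟩ := hT a b c h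
  refine ⟨?_, ?_, ?_⟩ <;> rintro rfl <;> simp_all

lemma PlanePair.quad_crossing (h : PlanePair f T T' T₃)
    (hQ : ∀ w, w ≠ x → w ≠ y → ∀ a b c d,
      Quad f (fun p q => T p q w) (fun p q => T' p q w) a b c d)
    (habz : T a b z ≠ 0) (habc : T a b c = 0) (hxza : T x z a = 0) (hdzb : T d z b = 0) :
    Quad f (fun p q => T p q x) (fun p q => T' p q x) a b c d := by
  intro h1 h2 h3 h4 h5 h6
  have n := fun p q s => (h.zero p q s).not
  obtain ⟨⟨p1, p2, p3, p4, p5, p6, p7⟩, q1, q2, q3, q4, q5, q6, q7⟩ :=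
    h.left.crossing habz habc hxza hdzb h1 h2 h3 h4 h5 h6
  obtain ⟨⟨-, -, -, -, -, -, r7⟩, -, -, -, -, -, -, s7⟩ :=
    h.right.crossing ((n _ _ _).mp habz) ((h.zero _ _ _).mp habc) ((h.zero _ _ _).mp hxza)
      ((h.zero _ _ _).mp hdzb) ((n _ _ _).mp h1) ((n _ _ _).mp h2)
      ((n _ _ _).mp h3) ((n _ _ _).mp h4) ((n _ _ _).mp h5) ((n _ _ _).mp h6)
  by_cases hdy : d = y
  · have hcx : c ≠ x := (h.left.ne q2).2.1.symm
    have hcy : c ≠ y := hdy ▸ (h.left.ne q2).2.2.symm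
    have := hQ c hcx hcy a z x d q1 q2 q3 q4 q5 q6
    simp only at this
    rw [q7, s7, h.lift.inv] at this
    exact inv_injective this
  · have hdx : d ≠ x := (h.left.ne p4).2.2.symm
    have := hQ d hdx hdy a b c x p1 p2 p3 p4 p5 p6
    simp only at this
    rw [p7, r7] at this
    exact this

lemma IsPlane.zero_perm (hT : IsPlane T) (habc : T a b c = 0) :
    T a c b = 0 ∧ T b a c = 0 ∧ T b c a = 0 ∧ T c a b = 0 ∧ T c b a = 0 := by
  have h1 : T a c b = 0 := by rw [hT.swap23]; exact neg_eq_zero.mpr habc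
  have h2 : T b a c = 0 := by rw [hT.swap12]; exact neg_eq_zero.mpr habc
  have h3 : T b c a = 0 := by rw [hT.swap23]; exact neg_eq_zero.mpr h2
  have h4 : T c a b = 0 := by rw [hT.swap12]; exact neg_eq_zero.mpr h1
  have h5 : T c b a = 0 := by rw [hT.swap12]; exact neg_eq_zero.mpr h3
  exact ⟨h1, h2, h3, h4, h5⟩

lemma IsPlane.line_ne (hT : IsPlane T) (habc : T a b c = 0) (habx : T a b x ≠ 0)
    (hacx : T a c x ≠ 0) (habd : T a b d ≠ 0) : T a c d ≠ 0 := by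
  obtain ⟨u, v, w, ⟨a1, a2, a3⟩, ⟨b1, b2, b3⟩, ⟨c1, c2, c3⟩, h⟩ := hT a b x habx
  simp only [h a b c, h a c x, h a b d, h a c d, a1, a2, a3, b1, b2, b3, c1, c2, c3, ne_eq,
    mul_eq_zero, habx, false_or, one_mul, mul_one, zero_mul, mul_zero, sub_zero, zero_sub,
    neg_eq_zero] at *
  simp only [habc, mul_zero, sub_zero]
  exact mul_ne_zero habd hacx

lemma IsPlane.common_point (hT : IsPlane T) (habz : T a b z ≠ 0) (h1 : T a z x = 0)
    (h2 : T a z d = 0) : T x d z = 0 := by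
  obtain ⟨u, v, w, ⟨a1, a2, a3⟩, ⟨b1, b2, b3⟩, ⟨c1, c2, c3⟩, h⟩ := hT a b z habz
  simp only [h a z x, h a z d, a1, a2, a3, b1, b2, b3, c1, c2, c3, ne_eq,
    mul_eq_zero, habz, false_or, one_mul, mul_one, zero_mul, mul_zero, sub_zero, zero_sub,
    neg_eq_zero] at h1 h2
  rw [h, c1, c2, c3, h1, h2]; ring

/-- The cross-ratio condition as seen from `x` for a quadruple with three collinear points follows
from the one as seen from all other points except possibly `y`. -/
lemma PlanePair.quad_of_collinear (h : PlanePair f T T' T₃)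
    (hz : ∀ a b s, T a b s ≠ 0 → ∃ z, z ≠ x ∧ z ≠ y ∧ T a b z ≠ 0)
    (hQ : ∀ w, w ≠ x → w ≠ y → ∀ a b c d,
      Quad f (fun p q => T p q w) (fun p q => T' p q w) a b c d) (habc : T a b c = 0) :
    Quad f (fun p q => T p q x) (fun p q => T' p q x) a b c d := by
  intro h1 h2 h3 h4 h5 h6
  have n := fun p q s => (h.zero p q s).not
  have k1 := (n _ _ _).mp h1
  have k2 := (n _ _ _).mp h2
  have k3 := (n _ _ _).mp h3
  have k4 := (n _ _ _).mp h4
  have k5 := (n _ _ _).mp h5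
  have k6 := (n _ _ _).mp h6
  obtain ⟨z, hzx, hzy, habz⟩ := hz a b x h1
  have habz' := (n _ _ _).mp habz
  have habc' := (h.zero _ _ _).mp habc
  by_cases habd : T a b d = 0
  · obtain ⟨p1, p2, p3, p4, p5, p6⟩ := h.left.cross_flat habz habc habd h1 h2 h3 h4 h5 h6
    obtain ⟨-, -, -, -, -, q6⟩ :=
      h.right.cross_flat habz' habc' ((h.zero _ _ _).mp habd) k1 k2 k3 k4 k5 k6
    have := hQ z hzx hzy a b c d habz p1 p2 p3 p4 p5
    simp only at this
    rwa [p6, q6] at this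
  by_cases hxdz : T x d z = 0
  · have hxdz' := (h.zero _ _ _).mp hxdz
    by_cases hxbz : T x b z = 0
    · obtain ⟨p1, p2, p3, p4, p5, p6⟩ :=
        h.left.cross_parallel habz habc hxbz hxdz h1 h2 h3 h4 h5 h6
      obtain ⟨-, -, -, -, -, q6⟩ :=
        h.right.cross_parallel habz' habc' ((h.zero _ _ _).mp hxbz) hxdz' k1 k2 k3 k4 k5 k6
      have := hQ z hzx hzy a b c d habz p1 p2 p3 p4 p5
      simp only at this
      rwa [p6, q6] at this
    · obtain ⟨p1, p2, p3, p4, p5, p6⟩ :=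
        h.left.cross_collinear habz habc hxbz hxdz h1 h2 h3 h4 h5 h6
      obtain ⟨-, -, -, -, -, q6⟩ :=
        h.right.cross_collinear habz' habc' ((n _ _ _).mp hxbz) hxdz' k1 k2 k3 k4 k5 k6
      have := hQ z hzx hzy a b c x habz p1 p2 p3 p4 p5
      simp only at this
      rwa [p6, q6] at this
  have pz := fun {p q s : E} (hh : T p q s = 0) => h.left.zero_perm hh
  have ps := fun {p q s : E} (hh : T p q s ≠ 0) => h.skew_perm hh
  have hacb := (pz habc).1
  have hbac := (pz habc).2.1
  have hcab := (pz habc).2.2.2.1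
  have hbca := (pz habc).2.2.1
  have hcba := (pz habc).2.2.2.2
  have hba := (ps h1).2.1
  have acz : T a c z ≠ 0 := h.left.line_ne habc h1 h3 habz
  have bcz : T b c z ≠ 0 := h.left.line_ne hbac hba h5 (ps habz).2.1
  have acd : T a c d ≠ 0 := h.left.line_ne habc h1 h3 habd
  have bcd : T b c d ≠ 0 := h.left.line_ne hbac hba h5 (ps habd).2.1
  have e1 := h.no_five_line x h1 h3 h4 h5 h6 h2 (e := z) (ps hxdz).2.2.1
  have e2 := h.no_five_line d habd acd (ps h4).1 bcd (ps h6).1 (ps h2).1 (e := z)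
    (ps hxdz).1
  have s12 : ∀ {a b c d}, Quad f (fun p q => T p q x) (fun p q => T' p q x) a b c d →
      Quad f (fun p q => T p q x) (fun p q => T' p q x) b a c d :=
    fun q => q.swap12 h.lift (h.left.isLine x)
  have s23 : ∀ {a b c d}, Quad f (fun p q => T p q x) (fun p q => T' p q x) a b c d →
      Quad f (fun p q => T p q x) (fun p q => T' p q x) a c b d :=
    fun q => q.swap23 h.lift (h.left.isLine x) (h.right.isLine x) (fun p q => h.zero p q x)
  have fin : Quad f (fun p q => T p q x) (fun p q => T' p q x) a b c d := by
    rcases e1 with e1 | e1 | e1 <;> rcases e2 with e2 | e2 | e2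
    · exact absurd (h.left.common_point habz e1 e2) hxdz
    · exact h.quad_crossing hQ habz habc (pz e1).2.2.2.2 (pz e2).2.2.2.2
    · exact s23 (h.quad_crossing hQ acz hacb (pz e1).2.2.2.2 (pz e2).2.2.2.2)
    · exact s12 (h.quad_crossing hQ (ps habz).2.1 hbac (pz e1).2.2.2.2 (pz e2).2.2.2.2)
    · exact absurd (h.left.common_point (ps habz).2.1 e1 e2) hxdz
    · exact s12 (s23 (h.quad_crossing hQ bcz hbca (pz e1).2.2.2.2 (pz e2).2.2.2.2))
    · exact s23 (s12 (h.quad_crossing hQ (ps acz).2.1 hcab (pz e1).2.2.2.2 (pz e2).2.2.2.2))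
    · exact s12 (s23 (s12
        (h.quad_crossing hQ (ps bcz).2.1 hcba (pz e1).2.2.2.2 (pz e2).2.2.2.2)))
    · exact absurd (h.left.common_point (ps acz).2.1 e1 e2) hxdz
  exact fin h1 h2 h3 h4 h5 h6

/-- The cross-ratio condition as seen from `x` follows from the one as seen from all other points
except possibly `y`. -/
lemma PlanePair.quad_of_forall_ne (h : PlanePair f T T' T₃)
    (hz : ∀ a b s, T a b s ≠ 0 → ∃ z, z ≠ x ∧ z ≠ y ∧ T a b z ≠ 0)
    (hQ : ∀ w, w ≠ x → w ≠ y → ∀ a b c d,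
      Quad f (fun p q => T p q w) (fun p q => T' p q w) a b c d) (a b c d : E) :
    Quad f (fun p q => T p q x) (fun p q => T' p q x) a b c d := by
  intro h1 h2 h3 h4 h5 h6
  have n := fun p q s => (h.zero₃ p q s).not
  have s34 : ∀ {a b c d}, Quad f (fun p q => T p q x) (fun p q => T' p q x) a b c d →
      Quad f (fun p q => T p q x) (fun p q => T' p q x) a b d c :=
    fun q => q.swap34 h.lift (h.left.isLine x)
  have s12 : ∀ {a b c d}, Quad f (fun p q => T p q x) (fun p q => T' p q x) a b c d →
      Quad f (fun p q => T p q x) (fun p q => T' p q x) b a c d :=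
    fun q => q.swap12 h.lift (h.left.isLine x)
  have s23 : ∀ {a b c d}, Quad f (fun p q => T p q x) (fun p q => T' p q x) a b c d →
      Quad f (fun p q => T p q x) (fun p q => T' p q x) a c b d :=
    fun q => q.swap23 h.lift (h.left.isLine x) (h.right.isLine x) (fun p q => h.zero p q x)
  by_cases abc : T a b c = 0
  · exact h.quad_of_collinear hz hQ abc h1 h2 h3 h4 h5 h6
  by_cases abd : T a b d = 0
  · exact s34 (h.quad_of_collinear hz hQ abd) h1 h2 h3 h4 h5 h6
  by_cases acd : T a c d = 0
  · exact s23 (s34 (h.quad_of_collinear hz hQ acd)) h1 h2 h3 h4 h5 h6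
  by_cases bcd : T b c d = 0
  · exact s12 (s23 (s34 (h.quad_of_collinear hz hQ bcd))) h1 h2 h3 h4 h5 h6
  exact (h.tern.no_five ((n _ _ _).mp abc) ((n _ _ _).mp abd) ((n _ _ _).mp h1)
    ((n _ _ _).mp acd) ((n _ _ _).mp h3) ((n _ _ _).mp h4) ((n _ _ _).mp bcd)
    ((n _ _ _).mp h5) ((n _ _ _).mp h6) ((n _ _ _).mp h2)).elim

end Plane

section Good

variable {F K : Type*} [Field F] [Field K] {ι : Type*} [Fintype ι] [DecidableEq ι] {E : Type*}

/-- The bracket of two vectors, the vectors at the positions other than `i` and `j` being fixed. -/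
def lineBr (φ : E → ι → F) (t : ι → E) (i j : ι) (p q : E) : F :=
  D φ (Function.update (Function.update t i p) j q)

/-- The bracket of three vectors, the vectors at the other positions being fixed. -/
def planeBr (φ : E → ι → F) (t : ι → E) (i j k : ι) (p q s : E) : F :=
  D φ (Function.update (Function.update (Function.update t i p) j q) k s)

/-- The configurations `φ` and `φ'` have the same bases inside `X`. -/
def SameZero (φ : E → ι → F) (φ' : E → ι → K) (X : Set E) : Prop :=
  ∀ t : ι → E, (∀ i, t i ∈ X) → (D φ t = 0 ↔ D φ' t = 0)

/-- The map `f` carries the `2 × 2` block with rows `i, j` and columns `c, d` of the coordinate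
matrix of `φ` in the basis `t` to the one of `φ'`, up to scaling of rows and columns. -/
def Blk (f : F → K) (φ : E → ι → F) (φ' : E → ι → K) (t : ι → E) (i j : ι) (c d : E) : Prop :=
  co φ t c i ≠ 0 → co φ t c j ≠ 0 → co φ t d i ≠ 0 → co φ t d j ≠ 0 →
    f (co φ t c i * co φ t d j / (co φ t d i * co φ t c j))
      = co φ' t c i * co φ' t d j / (co φ' t d i * co φ' t c j)

/-- The configuration `φ'` is a lift of `φ` on `X`. -/
structure Good (f : F → K) (φ : E → ι → F) (φ' : E → ι → K) (X : Set E) : Prop where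
  zero : SameZero φ φ' X
  blk : ∀ t : ι → E, (∀ i, t i ∈ X) → D φ t ≠ 0 → ∀ i j, i ≠ j → ∀ c ∈ X, ∀ d ∈ X,
    Blk f φ φ' t i j c d

lemma update_two_idem (t : ι → E) (i j : ι) (a b p q : E) :
    Function.update (Function.update (Function.update (Function.update t i a) j b) i p) j q
      = Function.update (Function.update t i p) j q := by
  funext l
  by_cases h1 : l = j
  · subst h1; simp
  · by_cases h2 : l = i
    · subst h2; simp [h1]
    · simp [h1, h2]

lemma isLine_lineBr (φ : E → ι → F) (t : ι → E) {i j : ι} (hij : i ≠ j) :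
    IsLine (lineBr φ t i j) := by
  intro a b hab
  set t' := Function.update (Function.update t i a) j b with ht'
  have ha : t' i = a := by simp [ht', hij]
  have hb : t' j = b := by simp [ht']
  have hD : D φ t' ≠ 0 := hab
  refine ⟨fun e => co φ t' e i, fun e => co φ t' e j, ?_, ?_, ?_, ?_, fun p q => ?_⟩
  · simp only [← ha, co_self φ hD]; simp
  · simp only [← ha, co_self φ hD]; simp [hij.symm]
  · simp only [← hb, co_self φ hD]; simp [hij]
  · simp only [← hb, co_self φ hD]; simp
  · change _ = D φ t' * _
    rw [← D_update_two φ hD hij, lineBr, ht', update_two_idem]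

lemma isPlane_planeBr (φ : E → ι → F) (t : ι → E) {i j k : ι} (hij : i ≠ j) (hik : i ≠ k)
    (hjk : j ≠ k) : IsPlane (planeBr φ t i j k) := by
  intro a b c habc
  set t' := Function.update (Function.update (Function.update t i a) j b) k c with ht'
  have ha : t' i = a := by simp [ht', hij, hik]
  have hb : t' j = b := by simp [ht', hjk]
  have hc : t' k = c := by simp [ht']
  have hD : D φ t' ≠ 0 := habc
  refine ⟨fun e => co φ t' e i, fun e => co φ t' e j, fun e => co φ t' e k,
    ?_, ?_, ?_, fun p q s => ?_⟩
  · simp only [← ha, co_self φ hD]; simp [hij.symm, hik.symm]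
  · simp only [← hb, co_self φ hD]; simp [hij, hjk.symm]
  · simp only [← hc, co_self φ hD]; simp [hik, hjk]
  · change _ = D φ t' * _
    rw [← D_update_three φ hD hij hik hjk, planeBr]
    congr 1
    funext l
    by_cases h1 : l = k
    · subst h1; simp
    · by_cases h2 : l = j
      · subst h2; simp [h1]
      · by_cases h3 : l = i
        · subst h3; simp [h1, h2]
        · simp [ht', h1, h2, h3]

lemma lineBr_left (φ : E → ι → F) {t : ι → E} (ht : D φ t ≠ 0) {i j : ι} (c : E) :
    lineBr φ t i j (t i) c = co φ t c j * D φ t := by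
  rw [lineBr, Function.update_eq_self, D_update_eq φ ht]

lemma lineBr_right (φ : E → ι → F) {t : ι → E} (ht : D φ t ≠ 0) {i j : ι} (hij : i ≠ j) (c : E) :
    lineBr φ t i j c (t j) = co φ t c i * D φ t := by
  rw [lineBr, Function.update_comm hij, Function.update_eq_self, D_update_eq φ ht]

lemma lineBr_update (φ : E → ι → F) (t : ι → E) (i j : ι) (a b p q : E) :
    lineBr φ (Function.update (Function.update t i a) j b) i j p q = lineBr φ t i j p q := by
  rw [lineBr, lineBr, update_two_idem]

lemma SameZero.mono {φ : E → ι → F} {φ' : E → ι → K} {X Y : Set E} (h : SameZero φ φ' X)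
    (hY : Y ⊆ X) : SameZero φ φ' Y := fun t ht => h t fun i => hY (ht i)

lemma Good.mono {f : F → K} {φ : E → ι → F} {φ' : E → ι → K} {X Y : Set E} (h : Good f φ φ' X)
    (hY : Y ⊆ X) : Good f φ φ' Y :=
  ⟨h.zero.mono hY, fun t ht hD i j hij c hc d hd =>
    h.blk t (fun i => hY (ht i)) hD i j hij c (hY hc) d (hY hd)⟩

lemma SameZero.co {φ : E → ι → F} {φ' : E → ι → K} {X : Set E} (h : SameZero φ φ' X)
    {t : ι → E} (ht : ∀ i, t i ∈ X) (hD : D φ t ≠ 0) {e : E} (he : e ∈ X) (i : ι) :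
    co φ t e i = 0 ↔ VecConfig.co φ' t e i = 0 := by
  have hD' : D φ' t ≠ 0 := (h t ht).not.mp hD
  have := h (Function.update t i e) (fun k => by
    by_cases hk : k = i
    · subst hk; simpa using he
    · simpa [hk] using ht k)
  rw [D_update_eq φ hD, D_update_eq φ' hD'] at this
  simpa [hD, hD'] using this

lemma Blk.swap_cols {f : F → K} (hf : IsLift f) {φ : E → ι → F} {φ' : E → ι → K} {t : ι → E}
    {i j : ι} {c d : E} (h : Blk f φ φ' t i j c d) : Blk f φ φ' t i j d c := by
  intro h1 h2 h3 h4
  rw [← inv_div, hf.inv, h h3 h4 h1 h2, inv_div]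

lemma Blk.swap_rows {f : F → K} (hf : IsLift f) {φ : E → ι → F} {φ' : E → ι → K} {t : ι → E}
    {i j : ι} {c d : E} (h : Blk f φ φ' t i j c d) : Blk f φ φ' t j i c d := by
  intro h1 h2 h3 h4
  rw [← inv_div, hf.inv, mul_comm (co φ t d j), mul_comm (co φ t c j), h h2 h1 h4 h3, inv_div,
    mul_comm (co φ' t d i), mul_comm (co φ' t c i)]

lemma quad_left_right_iff_blk {f : F → K} (hf : IsLift f) {φ : E → ι → F} {φ' : E → ι → K}
    {t : ι → E} (hD : D φ t ≠ 0) (hD' : D φ' t ≠ 0) {i j : ι} (hij : i ≠ j) {c d : E}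
    (h0 : lineBr φ t i j c d = 0 → lineBr φ' t i j c d = 0)
    (hc : ∀ l, co φ t c l = 0 ↔ co φ' t c l = 0) (hd : ∀ l, co φ t d l = 0 ↔ co φ' t d l = 0) :
    Quad f (lineBr φ t i j) (lineBr φ' t i j) (t i) (t j) c d ↔ Blk f φ φ' t i j c d := by
  have lr : ∀ e, lineBr φ t i j (t j) e = - (co φ t e i * D φ t) := fun e => by
    rw [← lineBr_right φ hD hij, (isLine_lineBr φ t hij).antisymm]
  have lr' : ∀ e, lineBr φ' t i j (t j) e = - (co φ' t e i * D φ' t) := fun e => by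
    rw [← lineBr_right φ' hD' hij, (isLine_lineBr φ' t hij).antisymm]
  have l1 : lineBr φ t i j (t i) (t j) = D φ t := by
    rw [lineBr_left φ hD, co_self φ hD]; simp
  have e1 : lineBr φ t i j (t i) c * lineBr φ t i j (t j) d
      / (lineBr φ t i j (t i) d * lineBr φ t i j (t j) c)
      = (co φ t c i * co φ t d j / (co φ t d i * co φ t c j))⁻¹ := by
    simp only [lineBr_left φ hD, lr, inv_div, mul_neg, neg_div_neg_eq]
    rw [show co φ t c j * D φ t * (co φ t d i * D φ t)
        = (co φ t d i * co φ t c j) * (D φ t * D φ t) by ring,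
      show co φ t d j * D φ t * (co φ t c i * D φ t)
        = (co φ t c i * co φ t d j) * (D φ t * D φ t) by ring,
      mul_div_mul_right _ _ (mul_ne_zero hD hD)]
  have e2 : lineBr φ' t i j (t i) c * lineBr φ' t i j (t j) d
      / (lineBr φ' t i j (t i) d * lineBr φ' t i j (t j) c)
      = (co φ' t c i * co φ' t d j / (co φ' t d i * co φ' t c j))⁻¹ := by
    simp only [lineBr_left φ' hD', lr', inv_div, mul_neg, neg_div_neg_eq]
    rw [show co φ' t c j * D φ' t * (co φ' t d i * D φ' t)
        = (co φ' t d i * co φ' t c j) * (D φ' t * D φ' t) by ring,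
      show co φ' t d j * D φ' t * (co φ' t c i * D φ' t)
        = (co φ' t c i * co φ' t d j) * (D φ' t * D φ' t) by ring,
      mul_div_mul_right _ _ (mul_ne_zero hD' hD')]
  constructor
  · intro h h1 h2 h3 h4
    by_cases hcd : lineBr φ t i j c d = 0
    · have hcd' := h0 hcd
      rw [lineBr, D_update_two φ hD hij, mul_eq_zero, or_iff_right hD, sub_eq_zero] at hcd
      rw [lineBr, D_update_two φ' hD' hij, mul_eq_zero, or_iff_right hD', sub_eq_zero] at hcd'
      rw [hcd, hcd', mul_comm (co φ t d i), mul_comm (co φ' t d i),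
        div_self (mul_ne_zero h2 h3), hf.one, div_self]
      exact mul_ne_zero ((hc j).not.mp h2) ((hd i).not.mp h3)
    · have := h (by rw [l1]; exact hD) hcd (by rw [lineBr_left φ hD]; exact mul_ne_zero h2 hD)
        (by rw [lineBr_left φ hD]; exact mul_ne_zero h4 hD)
        (by rw [lr]; exact neg_ne_zero.mpr (mul_ne_zero h1 hD))
        (by rw [lr]; exact neg_ne_zero.mpr (mul_ne_zero h3 hD))
      rw [e1, e2, hf.inv] at this
      exact inv_injective this
  · intro h _ _ h3 h4 h5 h6
    rw [lineBr_left φ hD] at h3 h4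
    rw [lr, neg_ne_zero] at h5 h6
    rw [e1, e2, hf.inv, h (left_ne_zero_of_mul h5) (left_ne_zero_of_mul h3)
      (left_ne_zero_of_mul h6) (left_ne_zero_of_mul h4)]

lemma SameZero.lineBr {φ : E → ι → F} {φ' : E → ι → K} {X : Set E} (h : SameZero φ φ' X)
    {t : ι → E} {i j : ι} (ht : ∀ k, k ≠ i → k ≠ j → t k ∈ X) {p q : E} (hp : p ∈ X)
    (hq : q ∈ X) : lineBr φ t i j p q = 0 ↔ VecConfig.lineBr φ' t i j p q = 0 := by
  refine h _ fun k => ?_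
  by_cases hk : k = j
  · subst hk; simpa using hq
  · by_cases hk' : k = i
    · subst hk'; simpa [hk] using hp
    · simpa [hk, hk'] using ht k hk' hk

lemma quad_of_blk {f : F → K} (hf : IsLift f) {φ : E → ι → F} {φ' : E → ι → K} {X : Set E}
    (h0 : SameZero φ φ' X) {t : ι → E} {i j : ι} (hij : i ≠ j)
    (ht : ∀ k, k ≠ i → k ≠ j → t k ∈ X) {a b c d : E} (ha : a ∈ X) (hb : b ∈ X) (hc : c ∈ X)
    (hd : d ∈ X)
    (h : D φ (Function.update (Function.update t i a) j b) ≠ 0 →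
      Blk f φ φ' (Function.update (Function.update t i a) j b) i j c d) :
    Quad f (lineBr φ t i j) (VecConfig.lineBr φ' t i j) a b c d := by
  intro h1
  set t' := Function.update (Function.update t i a) j b with ht'
  have htX : ∀ k, t' k ∈ X := by
    intro k
    by_cases hk : k = j
    · subst hk; simpa [ht'] using hb
    · by_cases hk' : k = i
      · subst hk'; simpa [ht', hk] using ha
      · simpa [ht', hk, hk'] using ht k hk' hk
  have hD : D φ t' ≠ 0 := h1
  have hD' : D φ' t' ≠ 0 := (h0 t' htX).not.mp hD
  have key := (quad_left_right_iff_blk hf hD hD' hij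
    (h0.lineBr (fun k _ _ => htX k) hc hd).mp
    (fun l => h0.co htX hD hc l) (fun l => h0.co htX hD hd l)).mpr (h hD)
  have ta : t' i = a := by simp [ht', hij]
  have tb : t' j = b := by simp [ht']
  rw [ta, tb, show VecConfig.lineBr φ t' i j = VecConfig.lineBr φ t i j from
    funext₂ fun p q => lineBr_update φ t i j a b p q,
    show VecConfig.lineBr φ' t' i j = VecConfig.lineBr φ' t i j from
    funext₂ fun p q => lineBr_update φ' t i j a b p q] at key
  exact key h1

lemma Good.quad {f : F → K} (hf : IsLift f) {φ : E → ι → F} {φ' : E → ι → K} {X : Set E}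
    (h : Good f φ φ' X) {t : ι → E} {i j : ι} (hij : i ≠ j)
    (ht : ∀ k, k ≠ i → k ≠ j → t k ∈ X) {a b c d : E} (ha : a ∈ X) (hb : b ∈ X) (hc : c ∈ X)
    (hd : d ∈ X) : Quad f (lineBr φ t i j) (lineBr φ' t i j) a b c d := by
  refine quad_of_blk hf h.zero hij ht ha hb hc hd fun hD => h.blk _ (fun k => ?_) hD i j hij c hc d hd
  by_cases hk : k = j
  · subst hk; simpa using hb
  · by_cases hk' : k = i
    · subst hk'; simpa [hk] using ha
    · simpa [hk, hk'] using ht k hk' hk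

lemma good_of_quad {f : F → K} (hf : IsLift f) {φ : E → ι → F} {φ' : E → ι → K} {X : Set E}
    (h0 : SameZero φ φ' X) (h : ∀ t : ι → E, (∀ i, t i ∈ X) → ∀ i j, i ≠ j → ∀ c ∈ X, ∀ d ∈ X,
      Quad f (lineBr φ t i j) (lineBr φ' t i j) (t i) (t j) c d) : Good f φ φ' X :=
  ⟨h0, fun t ht hD i j hij c hc d hd =>
    (quad_left_right_iff_blk hf hD ((h0 t ht).not.mp hD) hij
      (h0.lineBr (fun k _ _ => ht k) hc hd).mp
      (fun l => h0.co ht hD hc l) (fun l => h0.co ht hD hd l)).mp (h t ht i j hij c hc d hd)⟩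

/-- An element at position `i` of a basis can be exchanged for an element of another basis. -/
lemma exists_exchange (φ : E → ι → F) {t₀ : ι → E} (ht₀ : D φ t₀ ≠ 0) {s : ι → E}
    (i : ι) (e : E) (hs : D φ (Function.update s i e) ≠ 0) :
    ∃ l, D φ (Function.update s i (t₀ l)) ≠ 0 := by
  by_contra hcon
  push Not at hcon
  rw [D_update_sum φ ht₀] at hs
  exact hs (Finset.sum_eq_zero fun l _ => by rw [hcon l, mul_zero])

end Good

section Gluing

variable {F K : Type*} [Field F] [Field K] {ι : Type*} [Fintype ι] [DecidableEq ι] {E : Type*}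
  {f : F → K} {φ : E → ι → F} {φ' : E → ι → K} {φ₃ : E → ι → ZMod 3} {x y : E} {t₀ : ι → E}

lemma exists_exchange_two {t₀ t : ι → E} (ht₀ : D φ t₀ ≠ 0) (ht : D φ t ≠ 0) {i j : ι}
    (hij : i ≠ j) : ∃ k l, D φ (Function.update (Function.update t i (t₀ k)) j (t₀ l)) ≠ 0 := by
  obtain ⟨k, hk⟩ := exists_exchange φ ht₀ (s := t) i (t i) (by simpa using ht)
  obtain ⟨l, hl⟩ := exists_exchange φ ht₀ (s := Function.update t i (t₀ k)) j (t j) (by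
    have : Function.update (Function.update t i (t₀ k)) j (t j) = Function.update t i (t₀ k) := by
      rw [← Function.update_of_ne hij.symm (t₀ k) t, Function.update_eq_self]
    rwa [this])
  exact ⟨k, l, hl⟩

/-- The data that is available when gluing lifts of the deletions of `x` and of `y`. -/
structure GlueData (f : F → K) (φ : E → ι → F) (φ' : E → ι → K) (φ₃ : E → ι → ZMod 3) (x y : E)
    (t₀ : ι → E) : Prop where
  lift : IsLift f
  tern : SameZero φ φ₃ univ
  ne : x ≠ y
  left : Good f φ φ' {x}ᶜ
  right : Good f φ φ' {y}ᶜ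
  base : D φ t₀ ≠ 0
  base_ne : ∀ i, t₀ i ≠ x ∧ t₀ i ≠ y
  blk : ∀ t : ι → E, (∀ i, t i ≠ x ∧ t i ≠ y) → D φ t ≠ 0 → ∀ i j, i ≠ j → Blk f φ φ' t i j x y

lemma GlueData.symm (h : GlueData f φ φ' φ₃ x y t₀) : GlueData f φ φ' φ₃ y x t₀ :=
  ⟨h.lift, h.tern, h.ne.symm, h.right, h.left, h.base, fun i => (h.base_ne i).symm,
    fun t ht hD i j hij => (h.blk t (fun i => (ht i).symm) hD i j hij).swap_cols h.lift⟩

lemma GlueData.D_iff (h : GlueData f φ φ' φ₃ x y t₀) {t : ι → E} {i j : ι} (hij : i ≠ j)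
    (hi : t i = x) (hj : t j = y) {a b : E} (ha : a ≠ x ∧ a ≠ y) (hb : b ≠ x ∧ b ≠ y)
    (ht : ∀ k, k ≠ i → k ≠ j → t k ≠ x ∧ t k ≠ y)
    (hs : D φ (Function.update (Function.update t i a) j b) ≠ 0) : D φ t = 0 ↔ D φ' t = 0 := by
  set s := Function.update (Function.update t i a) j b with hsdef
  have hsm : ∀ k, s k ≠ x ∧ s k ≠ y := by
    intro k
    by_cases hk : k = j
    · subst hk; simpa [hsdef] using hb
    · by_cases hk' : k = i
      · subst hk'; simpa [hsdef, hk] using ha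
      · simpa [hsdef, hk, hk'] using ht k hk' hk
  have hs' : D φ' s ≠ 0 := (h.left.zero s fun k => (hsm k).1).not.mp hs
  have htt : t = Function.update (Function.update s i x) j y := by
    rw [hsdef, update_two_idem, ← hi, ← hj]
    simp
  have zx : ∀ l, co φ s x l = 0 ↔ co φ' s x l = 0 := fun l =>
    h.right.zero.co (fun k => (hsm k).2) hs h.ne l
  have zy : ∀ l, co φ s y l = 0 ↔ co φ' s y l = 0 := fun l =>
    h.left.zero.co (fun k => (hsm k).1) hs h.ne.symm l
  rw [htt, D_update_two φ hs hij, D_update_two φ' hs' hij, mul_eq_zero, mul_eq_zero,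
    or_iff_right hs, or_iff_right hs', sub_eq_zero, sub_eq_zero]
  have blk := h.blk s hsm hs i j hij
  by_cases h1 : co φ s x i = 0
  · have h1' := (zx i).mp h1
    rw [h1, h1', zero_mul, zero_mul, zero_eq_mul, zero_eq_mul, zx, zy]
  by_cases h2 : co φ s y j = 0
  · have h2' := (zy j).mp h2
    rw [h2, h2', mul_zero, mul_zero, zero_eq_mul, zero_eq_mul, zx, zy]
  have h1' := (zx i).not.mp h1
  have h2' := (zy j).not.mp h2
  by_cases h3 : co φ s x j = 0
  · have h3' := (zx j).mp h3
    simp [h3, h3', h1, h1', h2, h2']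
  by_cases h4 : co φ s y i = 0
  · have h4' := (zy i).mp h4
    simp [h4, h4', h1, h1', h2, h2']
  have h3' := (zx j).not.mp h3
  have h4' := (zy i).not.mp h4
  have := blk h1 h3 h4 h2
  rw [mul_comm (co φ s x j), mul_comm (co φ' s x j), ← div_eq_one_iff_eq (mul_ne_zero h4 h3),
    ← div_eq_one_iff_eq (mul_ne_zero h4' h3'), ← this, h.lift.eq_one_iff]

lemma GlueData.sameZero (h : GlueData f φ φ' φ₃ x y t₀) : SameZero φ φ' univ := by
  intro t _
  by_cases hx : ∃ i, t i = x
  swap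
  · push Not at hx
    exact h.left.zero t hx
  by_cases hy : ∃ j, t j = y
  swap
  · push Not at hy
    exact h.right.zero t hy
  obtain ⟨i, hi⟩ := hx
  obtain ⟨j, hj⟩ := hy
  have hij : i ≠ j := fun e => h.ne (by rw [← hi, ← hj, e])
  by_cases hinj : Function.Injective t
  swap
  · have e1 : D φ t = 0 := by
      by_contra hD; exact hinj (injective_of_D_ne_zero hD)
    have e2 : D φ' t = 0 := by
      by_contra hD; exact hinj (injective_of_D_ne_zero hD)
    rw [e1, e2]; simp
  have ht : ∀ k, k ≠ i → k ≠ j → t k ≠ x ∧ t k ≠ y := fun k hki hkj =>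
    ⟨fun e => hki (hinj (e.trans hi.symm)), fun e => hkj (hinj (e.trans hj.symm))⟩
  have base' : D φ' t₀ ≠ 0 := (h.left.zero t₀ fun i => (h.base_ne i).1).not.mp h.base
  have key : ∀ k l, D φ (Function.update (Function.update t i (t₀ k)) j (t₀ l)) ≠ 0 →
      (D φ t = 0 ↔ D φ' t = 0) := fun k l hkl =>
    h.D_iff hij hi hj (h.base_ne k) (h.base_ne l) ht hkl
  by_cases hD : D φ t = 0
  · by_cases hD' : D φ' t = 0
    · simp [hD, hD']
    · obtain ⟨k, l, hkl⟩ := exists_exchange_two base' hD' hij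
      refine key k l ((h.left.zero _ fun m => ?_).not.mpr hkl)
      by_cases hm : m = j
      · subst hm; simpa using (h.base_ne l).1
      · by_cases hm' : m = i
        · subst hm'; simpa [hm] using (h.base_ne k).1
        · simpa [hm, hm'] using (ht m hm' hm).1
  · obtain ⟨k, l, hkl⟩ := exists_exchange_two h.base hD hij
    exact key k l hkl

/-- The cross-ratio condition when the fixed vectors avoid `x` and `y`. -/
lemma GlueData.quad_avoid (h : GlueData f φ φ' φ₃ x y t₀) {t : ι → E} {i j : ι} (hij : i ≠ j)
    (ht : ∀ k, k ≠ i → k ≠ j → t k ≠ x ∧ t k ≠ y) (a b c d : E) :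
    Quad f (lineBr φ t i j) (lineBr φ' t i j) a b c d := by
  by_cases hx : x = a ∨ x = b ∨ x = c ∨ x = d
  swap
  · push Not at hx
    exact h.left.quad h.lift hij (fun k h1 h2 => (ht k h1 h2).1) hx.1.symm hx.2.1.symm
      hx.2.2.1.symm hx.2.2.2.symm
  by_cases hy : y = a ∨ y = b ∨ y = c ∨ y = d
  swap
  · push Not at hy
    exact h.right.quad h.lift hij (fun k h1 h2 => (ht k h1 h2).2) hy.1.symm hy.2.1.symm
      hy.2.2.1.symm hy.2.2.2.symm
  have l1 := isLine_lineBr φ t hij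
  refine Quad.of_pair h.lift l1 (isLine_lineBr φ' t hij)
    (fun p q => h.sameZero.lineBr (fun _ _ _ => mem_univ _) (mem_univ p) (mem_univ q)) h.ne
    (fun a b => ?_) hx hy
  intro h1 h2 h3 h4 h5 h6
  refine quad_of_blk h.lift h.sameZero hij (fun _ _ _ => mem_univ _) (mem_univ a) (mem_univ b)
    (mem_univ x) (mem_univ y) (fun hD => h.blk _ (fun k => ?_) hD i j hij) h1 h2 h3 h4 h5 h6
  by_cases hk : k = j
  · subst hk
    simp only [Function.update_self]
    exact ⟨fun e => h5 (by rw [e, l1.self]), fun e => h6 (by rw [e, l1.self])⟩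
  · by_cases hk' : k = i
    · subst hk'
      simp only [Function.update_self, Function.update_of_ne hk]
      exact ⟨fun e => h3 (by rw [e, l1.self]), fun e => h4 (by rw [e, l1.self])⟩
    · simpa [hk, hk'] using ht k hk' hk

lemma GlueData.planePair (h : GlueData f φ φ' φ₃ x y t₀) (t : ι → E) {i j k : ι} (hij : i ≠ j)
    (hik : i ≠ k) (hjk : j ≠ k) :
    PlanePair f (planeBr φ t i j k) (planeBr φ' t i j k) (planeBr φ₃ t i j k) :=
  ⟨h.lift, isPlane_planeBr φ t hij hik hjk, isPlane_planeBr φ' t hij hik hjk,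
    isPlane_planeBr φ₃ t hij hik hjk, fun _ _ _ => h.sameZero _ fun _ => mem_univ _,
    fun _ _ _ => h.tern _ fun _ => mem_univ _⟩

lemma planeBr_eq_lineBr (φ : E → ι → F) (t : ι → E) {i j k : ι} (hik : i ≠ k) (hjk : j ≠ k)
    (w : E) : (fun p q => planeBr φ t i j k p q w) = lineBr φ (Function.update t k w) i j := by
  funext p q
  rw [planeBr, lineBr, Function.update_comm hjk, Function.update_comm hik]

lemma GlueData.quad_step (h : GlueData f φ φ' φ₃ x y t₀) {t : ι → E} {i j k : ι} (hij : i ≠ j)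
    (hik : i ≠ k) (hjk : j ≠ k) {x' y' : E} (hx : t k = x')
    (hb : ∀ l, t₀ l ≠ x' ∧ t₀ l ≠ y')
    (hQ : ∀ w, w ≠ x' → w ≠ y' → ∀ a b c d, Quad f (lineBr φ (Function.update t k w) i j)
      (lineBr φ' (Function.update t k w) i j) a b c d) (a b c d : E) :
    Quad f (lineBr φ t i j) (lineBr φ' t i j) a b c d := by
  have := (h.planePair t hij hik hjk).quad_of_forall_ne (x := x') (y := y') (fun a b s hs => by
    obtain ⟨l, hl⟩ := exists_exchange φ h.base k s hs
    exact ⟨t₀ l, (hb l).1, (hb l).2, hl⟩) (fun w hx hy a b c d => by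
      rw [planeBr_eq_lineBr φ t hik hjk, planeBr_eq_lineBr φ' t hik hjk]
      exact hQ w hx hy a b c d) a b c d
  rwa [planeBr_eq_lineBr φ t hik hjk, planeBr_eq_lineBr φ' t hik hjk, ← hx,
    Function.update_eq_self] at this

lemma quad_of_forall_D_eq_zero {t : ι → E} {i j : ι} (hz : ∀ p q, lineBr φ t i j p q = 0)
    (a b c d : E) : Quad f (lineBr φ t i j) (lineBr φ' t i j) a b c d :=
  fun h => absurd (hz a b) h

lemma lineBr_eq_zero_of_eq (φ : E → ι → F) {t : ι → E} {i j k l : ι} (hkl : k ≠ l) (hk : k ≠ i)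
    (hk' : k ≠ j) (hl : l ≠ i) (hl' : l ≠ j) (h : t k = t l) (p q : E) :
    lineBr φ t i j p q = 0 :=
  D_eq_zero_of_eq φ _ hkl (by simp [hk, hk', hl, hl', h])

lemma GlueData.quad_left (h : GlueData f φ φ' φ₃ x y t₀) {t : ι → E} {i j k : ι} (hij : i ≠ j)
    (hik : i ≠ k) (hjk : j ≠ k) (hx : t k = x) (hy : ∀ l, l ≠ i → l ≠ j → t l ≠ y) (a b c d : E) :
    Quad f (lineBr φ t i j) (lineBr φ' t i j) a b c d := by
  by_cases hdup : ∃ l, l ≠ i ∧ l ≠ j ∧ l ≠ k ∧ t l = x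
  · obtain ⟨l, h1, h2, h3, h4⟩ := hdup
    exact quad_of_forall_D_eq_zero (lineBr_eq_zero_of_eq φ h3 h1 h2 hik.symm hjk.symm
      (h4.trans hx.symm)) a b c d
  push Not at hdup
  refine h.quad_step hij hik hjk hx h.base_ne (fun w hwx hwy a b c d => ?_) a b c d
  refine h.quad_avoid hij (fun l h1 h2 => ?_) a b c d
  by_cases hl : l = k
  · subst hl; simpa using ⟨hwx, hwy⟩
  · simpa [hl] using ⟨hdup l h1 h2 hl, hy l h1 h2⟩

lemma GlueData.quad_right (h : GlueData f φ φ' φ₃ x y t₀) {t : ι → E} {i j : ι} (hij : i ≠ j)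
    (hx : ∀ l, l ≠ i → l ≠ j → t l ≠ x) (a b c d : E) :
    Quad f (lineBr φ t i j) (lineBr φ' t i j) a b c d := by
  by_cases hy : ∃ k, k ≠ i ∧ k ≠ j ∧ t k = y
  · obtain ⟨k, h1, h2, h3⟩ := hy
    exact h.symm.quad_left hij h1.symm h2.symm h3 hx a b c d
  · push Not at hy
    exact h.quad_avoid hij (fun k h1 h2 => ⟨hx k h1 h2, hy k h1 h2⟩) a b c d

lemma GlueData.quad (h : GlueData f φ φ' φ₃ x y t₀) {t : ι → E} {i j : ι} (hij : i ≠ j)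
    (a b c d : E) : Quad f (lineBr φ t i j) (lineBr φ' t i j) a b c d := by
  by_cases hx : ∃ k, k ≠ i ∧ k ≠ j ∧ t k = x
  swap
  · push Not at hx
    exact h.quad_right hij hx a b c d
  obtain ⟨k, h1, h2, hx⟩ := hx
  by_cases hdup : ∃ l, l ≠ i ∧ l ≠ j ∧ l ≠ k ∧ t l = x
  · obtain ⟨l, h1', h2', h3, h4⟩ := hdup
    exact quad_of_forall_D_eq_zero (lineBr_eq_zero_of_eq φ h3 h1' h2' h1 h2
      (h4.trans hx.symm)) a b c d
  push Not at hdup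
  refine h.quad_step hij h1.symm h2.symm hx h.base_ne (fun w hwx hwy a b c d => ?_) a b c d
  refine h.quad_right hij (fun l h1' h2' => ?_) a b c d
  by_cases hl : l = k
  · subst hl; simpa using hwx
  · simpa [hl] using hdup l h1' h2' hl

/-- Lifts of the deletions of `x` and of `y` glue to a lift of the whole configuration as soon as
the blocks with columns `x` and `y` are right. -/
theorem GlueData.good (h : GlueData f φ φ' φ₃ x y t₀) : Good f φ φ' univ :=
  good_of_quad h.lift h.sameZero fun _ _ _ _ hij _ _ _ _ => h.quad hij _ _ _ _

end Gluing

section Walks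

variable {F K : Type*} [Field F] [Field K] {ι : Type*} [Fintype ι] [DecidableEq ι] {E : Type*}

/-- There is a walk with `k` steps from row `i` to row `j` of the coordinate matrix of `φ` in the
basis `t`, a step leading from a row to another one through a column in `X` that has nonzero
entries in both rows. -/
def Walk (φ : E → ι → F) (t : ι → E) (X : Set E) : ℕ → ι → ι → Prop
  | 0, i, j => i = j
  | k + 1, i, j => ∃ c ∈ X, ∃ l, co φ t c i ≠ 0 ∧ co φ t c l ≠ 0 ∧ Walk φ t X k l j

variable {φ : E → ι → F} {t : ι → E} {X : Set E}

lemma Walk.trans {m n : ℕ} {i j l : ι} (h : Walk φ t X m i j) (h' : Walk φ t X n j l) :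
    Walk φ t X (m + n) i l := by
  induction m generalizing i with
  | zero =>
    obtain rfl : i = j := h
    simpa using h'
  | succ m ih =>
    obtain ⟨c, hc, i', h1, h2, h3⟩ := h
    rw [Nat.succ_add]
    exact ⟨c, hc, i', h1, h2, ih h3⟩

lemma Walk.single {c : E} (hc : c ∈ X) {i j : ι} (hi : co φ t c i ≠ 0) (hj : co φ t c j ≠ 0) :
    Walk φ t X 1 i j := ⟨c, hc, j, hi, hj, rfl⟩

lemma Walk.symm {m : ℕ} {i j : ι} (h : Walk φ t X m i j) : Walk φ t X m j i := by
  induction m generalizing i with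
  | zero =>
    obtain rfl : i = j := h
    rfl
  | succ m ih =>
    obtain ⟨c, hc, i', h1, h2, h3⟩ := h
    exact (ih h3).trans (Walk.single hc h2 h1)

lemma Walk.mono {Y : Set E} (hXY : X ⊆ Y) {m : ℕ} {i j : ι} (h : Walk φ t X m i j) :
    Walk φ t Y m i j := by
  induction m generalizing i with
  | zero => exact h
  | succ m ih =>
    obtain ⟨c, hc, i', h1, h2, h3⟩ := h
    exact ⟨c, hXY hc, i', h1, h2, ih h3⟩

lemma co_pivot_of_zero_left {ht : D φ t ≠ 0} {p : ι} {e : E} (he : co φ t e p ≠ 0) {c : E}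
    (hc : co φ t c p = 0) (l : ι) : co φ (Function.update t p e) c l = co φ t c l := by
  by_cases hl : l = p
  · subst hl; rw [co_pivot_self φ ht he, hc, zero_div]
  · rw [co_pivot_of_ne φ ht hl he, hc]; ring

lemma co_pivot_of_zero_right {ht : D φ t ≠ 0} {p : ι} {e : E} (he : co φ t e p ≠ 0) {l : ι}
    (hl : co φ t e l = 0) (c : E) : co φ (Function.update t p e) c l = co φ t c l := by
  rw [co_pivot_of_ne φ ht (fun h => by subst h; exact he hl) he, hl]; ring

/-- A walk survives a pivot, or a shorter walk starts at a neighbour of the entering element. -/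
lemma Walk.pivot (ht : D φ t ≠ 0) {p : ι} {e : E} (he : co φ t e p ≠ 0) {m : ℕ} {i j : ι}
    (h : Walk φ t X m i j) : (∃ n ≤ m, ∃ l, co φ t e l ≠ 0 ∧ Walk φ t X n l j) ∨
      Walk φ (Function.update t p e) X m i j := by
  induction m generalizing i with
  | zero => exact Or.inr h
  | succ m ih =>
    obtain ⟨c, hc, i', h1, h2, h3⟩ := h
    rcases ih h3 with ⟨n, hn, l, hl, hw⟩ | h4
    · exact Or.inl ⟨n, by omega, l, hl, hw⟩
    · by_cases hcp : co φ t c p = 0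
      · right
        refine ⟨c, hc, i', ?_, ?_, h4⟩ <;>
          rwa [co_pivot_of_zero_left (ht := ht) he hcp]
      · exact Or.inl ⟨m + 1, le_rfl, p, he, c, hc, i', hcp, h2, h3⟩

/-- If column `c` has nonzero entries in the rows `i` and `p` and there is a walk from `p` to `j`,
then there is a walk of the same length from `i` to `j`, after a pivot in row `p` if necessary. -/
lemma Walk.skip (ht : D φ t ≠ 0) {p i j : ι} {c : E} (hc : c ∈ X) (hci : co φ t c i ≠ 0)
    (hcp : co φ t c p ≠ 0) {k : ℕ} (h : Walk φ t X k p j) :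
    p = j ∨ (∃ m ≤ k, Walk φ t X m i j) ∨ Walk φ (Function.update t p c) X k i j := by
  cases k with
  | zero => exact Or.inl h
  | succ k =>
    right
    obtain ⟨c', hc', l, h1, h2, h3⟩ := h
    by_cases hip : i = p
    · subst hip
      exact Or.inl ⟨k + 1, le_rfl, c', hc', l, h1, h2, h3⟩
    by_cases hl : co φ t c l = 0
    swap
    · exact Or.inl ⟨k + 1, le_rfl, c, hc, l, hci, hl, h3⟩
    by_cases hi : co φ t c' i = 0
    swap
    · exact Or.inl ⟨k + 1, le_rfl, c', hc', l, hi, h2, h3⟩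
    rcases h3.pivot ht hcp with ⟨n, hn, l', hl', hw⟩ | h4
    · exact Or.inl ⟨n + 1, by omega, c, hc, l', hci, hl', hw⟩
    · refine Or.inr ⟨c', hc', l, ?_, ?_, h4⟩
      · rw [co_pivot_of_ne φ ht hip hcp, hi, zero_sub, neg_ne_zero]
        exact div_ne_zero (mul_ne_zero hci h1) hcp
      · rwa [co_pivot_of_zero_right (ht := ht) hcp hl]

end Walks

section Scaling

variable {F K : Type*} [Field F] [Field K] {ι : Type*} [Fintype ι] [DecidableEq ι] {E : Type*}
  {f : F → K} {φ : E → ι → F}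

lemma D_scale (φ : E → ι → K) (s : E → K) (M : Matrix ι ι K) (u : ι → E) :
    D (fun e => s e • Matrix.vecMul (φ e) M) u = (∏ i, s (u i)) * M.det * D φ u := by
  have : (Matrix.of fun i => s (u i) • Matrix.vecMul (φ (u i)) M)
      = Matrix.diagonal (fun i => s (u i)) * ((Matrix.of fun i => φ (u i)) * M) := by
    ext i j
    rw [Matrix.diagonal_mul]
    simp [Matrix.mul_apply, Matrix.vecMul, dotProduct]
  rw [D_eq_det, this, Matrix.det_mul, Matrix.det_mul, Matrix.det_diagonal, ← D_eq_det]
  ring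

lemma co_scale (φ : E → ι → K) {s : E → K} (hs : ∀ e, s e ≠ 0) {M : Matrix ι ι K}
    (hM : M.det ≠ 0) {u : ι → E} (hu : D φ u ≠ 0) (e : E) (i : ι) :
    co (fun e => s e • Matrix.vecMul (φ e) M) u e i = s e / s (u i) * co φ u e i := by
  have hp : ∏ k, s (Function.update u i e k) = s e / s (u i) * ∏ k, s (u k) := by
    rw [← Finset.mul_prod_erase _ _ (Finset.mem_univ i),
      ← Finset.mul_prod_erase (Finset.univ) (fun k => s (u k)) (Finset.mem_univ i),
      Function.update_self, Finset.prod_congr rfl (g := fun k => s (u k))]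
    · have := hs (u i)
      field_simp
    · intro k hk
      rw [Function.update_of_ne (Finset.ne_of_mem_erase hk)]
  have h0 : ∏ k, s (u k) ≠ 0 := Finset.prod_ne_zero_iff.mpr fun k _ => hs _
  have := hs (u i)
  rw [co, D_scale, D_scale, hp, co]
  field_simp

lemma Good.scale {φ' : E → ι → K} {X : Set E} (h : Good f φ φ' X) {s : E → K}
    (hs : ∀ e, s e ≠ 0) {M : Matrix ι ι K} (hM : M.det ≠ 0) :
    Good f φ (fun e => s e • Matrix.vecMul (φ' e) M) X := by
  refine ⟨fun t ht => ?_, fun t ht hD i j hij c hc d hd h1 h2 h3 h4 => ?_⟩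
  · rw [h.zero t ht, D_scale]
    have h0 : ∏ k, s (t k) ≠ 0 := Finset.prod_ne_zero_iff.mpr fun k _ => hs _
    simp [h0, hM]
  · have hD' := (h.zero t ht).not.mp hD
    rw [h.blk t ht hD i j hij c hc d hd h1 h2 h3 h4]
    simp only [co_scale φ' hs hM hD']
    have := hs c
    have := hs d
    have := hs (t i)
    have := hs (t j)
    have := (h.zero.co ht hD hc j).not.mp h2
    have := (h.zero.co ht hD hd i).not.mp h3
    field_simp

/-- Two lifts that agree on `Y` have proportional entries in rows connected through `Y`. -/
lemma Good.proportional {φ₁ φ₂ : E → ι → K} {X Y : Set E} (hY : Y ⊆ X)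
    (h₁ : Good f φ φ₁ X) (h₂ : Good f φ φ₂ X) (heq : ∀ e ∈ Y, φ₁ e = φ₂ e) {x : E} (hx : x ∈ X)
    (k : ℕ) : ∀ {t : ι → E}, (∀ i, t i ∈ Y) → D φ t ≠ 0 → ∀ {i j : ι}, co φ t x i ≠ 0 →
      co φ t x j ≠ 0 → Walk φ t Y k i j →
      co φ₁ t x i * co φ₂ t x j = co φ₁ t x j * co φ₂ t x i := by
  have heqD : ∀ t : ι → E, (∀ i, t i ∈ Y) → D φ₁ t = D φ₂ t := fun t ht => by
    simp only [D, heq _ (ht _)]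
  have heqc : ∀ t : ι → E, (∀ i, t i ∈ Y) → ∀ e ∈ Y, ∀ i, co φ₁ t e i = co φ₂ t e i :=
      fun t ht e he i => by
    rw [co, co, heqD t ht, heqD _ fun k => ?_]
    by_cases hk : k = i
    · subst hk; simpa using he
    · simpa [hk] using ht k
  induction k using Nat.strong_induction_on with
  | _ k ih =>
  intro t ht hD i j hi hj hw
  have htX := fun i => hY (ht i)
  have hD₁ := (h₁.zero t htX).not.mp hD
  have hD₂ := (h₂.zero t htX).not.mp hD
  cases k with
  | zero =>
    obtain rfl : i = j := hw
    rfl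
  | succ k =>
    obtain ⟨c, hc, p, hci, hcp, hw⟩ := hw
    by_cases hxp : co φ t x p = 0
    · rcases hw.skip hD hc hci hcp with hpj | ⟨m, hm, hw'⟩ | hw'
      · exact absurd (hpj ▸ hxp) hj
      · exact ih m (by omega) ht hD hi hj hw'
      · have ht' : ∀ l, Function.update t p c l ∈ Y := fun l => by
          by_cases hl : l = p
          · subst hl; simpa using hc
          · simpa [hl] using ht l
        have := ih k (by omega) ht' (D_pivot_ne_zero hD hcp) (i := i) (j := j)
          (by rwa [co_pivot_of_zero_left (ht := hD) hcp hxp])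
          (by rwa [co_pivot_of_zero_left (ht := hD) hcp hxp]) hw'
        rwa [co_pivot_of_zero_left (ht := hD₁) ((h₁.zero.co htX hD (hY hc) p).not.mp hcp)
          ((h₁.zero.co htX hD hx p).mp hxp),
          co_pivot_of_zero_left (ht := hD₁) ((h₁.zero.co htX hD (hY hc) p).not.mp hcp)
          ((h₁.zero.co htX hD hx p).mp hxp),
          co_pivot_of_zero_left (ht := hD₂) ((h₂.zero.co htX hD (hY hc) p).not.mp hcp)
          ((h₂.zero.co htX hD hx p).mp hxp),
          co_pivot_of_zero_left (ht := hD₂) ((h₂.zero.co htX hD (hY hc) p).not.mp hcp)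
          ((h₂.zero.co htX hD hx p).mp hxp)] at this
    · have e1 := ih k (by omega) ht hD hxp hj hw
      have e2 : co φ₁ t x i * co φ₂ t x p = co φ₁ t x p * co φ₂ t x i := by
        by_cases hip : i = p
        · rw [hip]
        have b1 := h₁.blk t htX hD i p hip c (hY hc) x hx hci hcp hi hxp
        have b2 := h₂.blk t htX hD i p hip c (hY hc) x hx hci hcp hi hxp
        rw [b1, ← heqc t ht c hc, ← heqc t ht c hc] at b2
        have c1 := (h₁.zero.co htX hD (hY hc) i).not.mp hci
        have c2 := (h₁.zero.co htX hD (hY hc) p).not.mp hcp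
        have x1 := (h₁.zero.co htX hD hx i).not.mp hi
        have x2 := (h₁.zero.co htX hD hx p).not.mp hxp
        have y1 := (h₂.zero.co htX hD hx i).not.mp hi
        have y2 := (h₂.zero.co htX hD hx p).not.mp hxp
        rw [div_eq_div_iff (mul_ne_zero x1 c2) (mul_ne_zero y1 c2)] at b2
        have : (co φ₁ t c i * co φ₁ t c p) * (co φ₁ t x i * co φ₂ t x p)
            = (co φ₁ t c i * co φ₁ t c p) * (co φ₁ t x p * co φ₂ t x i) := by
          linear_combination -b2
        exact mul_left_cancel₀ (mul_ne_zero c1 c2) this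
      have x2 := (h₁.zero.co htX hD hx p).not.mp hxp
      have y2 := (h₂.zero.co htX hD hx p).not.mp hxp
      have : (co φ₁ t x p * co φ₂ t x p) * (co φ₁ t x i * co φ₂ t x j)
          = (co φ₁ t x p * co φ₂ t x p) * (co φ₁ t x j * co φ₂ t x i) := by
        linear_combination co φ₁ t x p * co φ₂ t x j * e2 + co φ₁ t x p * co φ₂ t x i * e1
      exact mul_left_cancel₀ (mul_ne_zero x2 y2) this

end Scaling

section Unique

variable {F K : Type*} [Field F] [Field K] {ι : Type*} [Fintype ι] [DecidableEq ι] {E : Type*}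
  {f : F → K} {φ : E → ι → F}

lemma exists_matrix {φ : E → ι → K} {t : ι → E} (ht : D φ t ≠ 0) {w : ι → ι → K}
    (hw : (Matrix.of w).det ≠ 0) : ∃ M : Matrix ι ι K, M.det ≠ 0 ∧
      ∀ e, Matrix.vecMul (φ e) M = ∑ i, co φ t e i • w i := by
  set N : Matrix ι ι K := Matrix.of fun i => φ (t i) with hN
  have hu : IsUnit N.det := isUnit_iff_ne_zero.mpr ht
  have hM : N * (N⁻¹ * Matrix.of w) = Matrix.of w := by
    rw [← Matrix.mul_assoc, Matrix.mul_nonsing_inv _ hu, Matrix.one_mul]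
  refine ⟨N⁻¹ * Matrix.of w, fun h => hw ?_, fun e => ?_⟩
  · rw [← hM, Matrix.det_mul, h, mul_zero]
  · conv_lhs => rw [sum_co φ ht e]
    rw [Matrix.sum_vecMul]
    refine Finset.sum_congr rfl fun i _ => ?_
    rw [Matrix.smul_vecMul]
    congr 1
    have := congrFun hM i
    rw [Matrix.mul_apply_eq_vecMul] at this
    exact this

/-- Two lifts agree up to scaling and a change of coordinates. -/
theorem exists_scaling {φ₁ φ₂ : E → ι → K} {X : Set E} (hX : X.Finite)
    (h₁ : Good f φ φ₁ X) (h₂ : Good f φ φ₂ X) {t : ι → E} (htX : ∀ i, t i ∈ X)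
    (ht : D φ t ≠ 0) : ∃ (s : E → K) (M : Matrix ι ι K), (∀ e, s e ≠ 0) ∧ M.det ≠ 0 ∧
      ∀ e ∈ X, φ₁ e = s e • Matrix.vecMul (φ₂ e) M := by
  classical
  have hD₁ := (h₁.zero t htX).not.mp ht
  have key : ∀ Z : Set E, Z.Finite → Z ⊆ X → ∃ (s : E → K) (M : Matrix ι ι K), (∀ e, s e ≠ 0) ∧
      M.det ≠ 0 ∧ ∀ e ∈ range t ∪ Z, φ₁ e = s e • Matrix.vecMul (φ₂ e) M := by
    intro Z hZ
    induction Z, hZ using Set.Finite.induction_on with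
    | empty =>
      intro _
      have hD₂ := (h₂.zero t htX).not.mp ht
      obtain ⟨M, hM, hM'⟩ := exists_matrix hD₂ (w := fun i => φ₁ (t i)) hD₁
      refine ⟨fun _ => 1, M, fun _ => one_ne_zero, hM, ?_⟩
      rintro _ (⟨j, rfl⟩ | h)
      · rw [hM', one_smul]
        simp [co_self φ₂ hD₂, ite_smul, Finset.sum_ite_eq']
      · exact absurd h (notMem_empty _)
    | @insert x Z _ hZ ih =>
      intro hxZ
      have hxX : x ∈ X := hxZ (mem_insert _ _)
      obtain ⟨s, M, hs, hM, heq⟩ := ih ((subset_insert _ _).trans hxZ)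
      set Y := range t ∪ Z with hY
      have hYX : Y ⊆ X := union_subset (by rintro _ ⟨i, rfl⟩; exact htX i)
        ((subset_insert _ _).trans hxZ)
      by_cases hxY : x ∈ Y
      · refine ⟨s, M, hs, hM, fun e he => heq e ?_⟩
        rcases he with he | rfl | he
        exacts [Or.inl he, hxY, Or.inr he]
      have htY : ∀ i, t i ∈ Y := fun i => Or.inl ⟨i, rfl⟩
      set φ₃ : E → ι → K := fun e => s e • Matrix.vecMul (φ₂ e) M with hφ₃
      have h₃ : Good f φ φ₃ X := h₂.scale hs hM
      have hD₃ := (h₃.zero t htX).not.mp ht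
      have heqc : ∀ e ∈ Y, ∀ i, co φ₁ t e i = co φ₃ t e i := fun e he i => by
        have : ∀ u : ι → E, (∀ i, u i ∈ Y) → D φ₁ u = D φ₃ u := fun u hu => by
          simp only [D, heq _ (hu _), hφ₃]
        rw [co, co, this t htY, this _ fun k => ?_]
        by_cases hk : k = i
        · subst hk; simpa using he
        · simpa [hk] using htY k
      set P : ι → ι → Prop := fun i j => co φ t x j ≠ 0 ∧ ∃ k, Walk φ t Y k i j with hP
      have hPeq : ∀ e ∈ Y, ∀ i i', co φ t e i ≠ 0 → co φ t e i' ≠ 0 → P i = P i' := by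
        intro e he i i' hi hi'
        funext j
        refine propext (and_congr_right fun _ => ⟨?_, ?_⟩)
        · rintro ⟨k, hk⟩; exact ⟨_, (Walk.single he hi' hi).trans hk⟩
        · rintro ⟨k, hk⟩; exact ⟨_, (Walk.single he hi hi').trans hk⟩
      set R : (ι → Prop) → K := fun p =>
        if h : ∃ j, p j then co φ₁ t x h.choose / co φ₃ t x h.choose else 1 with hR
      have hR0 : ∀ i, R (P i) ≠ 0 := by
        intro i
        simp only [hR]
        split_ifs with h
        · have h' := h.choose_spec.1
          exact div_ne_zero ((h₁.zero.co htX ht hxX _).not.mp h')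
            ((h₃.zero.co htX ht hxX _).not.mp h')
        · exact one_ne_zero
      have hRx : ∀ i, co φ₁ t x i = R (P i) * co φ₃ t x i := by
        intro i
        by_cases hi : co φ t x i = 0
        · rw [(h₁.zero.co htX ht hxX _).mp hi, (h₃.zero.co htX ht hxX _).mp hi, mul_zero]
        · have h : ∃ j, P i j := ⟨i, hi, 0, rfl⟩
          obtain ⟨hj, k, hk⟩ := h.choose_spec
          simp only [hR, dif_pos h]
          have := Good.proportional hYX h₁ h₃ heq hxX k htY ht hi hj hk
          have := (h₃.zero.co htX ht hxX _).not.mp hj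
          field_simp
          linear_combination ‹co φ₁ t x i * _ = _›
      have hw : (Matrix.of fun i => R (P i) • φ₁ (t i)).det ≠ 0 := by
        have : (Matrix.of fun i => R (P i) • φ₁ (t i))
            = Matrix.diagonal (fun i => R (P i)) * Matrix.of fun i => φ₁ (t i) := by
          ext i j; simp [Matrix.diagonal_mul]
        rw [this, Matrix.det_mul, Matrix.det_diagonal]
        exact mul_ne_zero (Finset.prod_ne_zero_iff.mpr fun i _ => hR0 i) hD₁
      obtain ⟨M', hM', hM''⟩ := exists_matrix hD₃ hw
      set s' : E → K := fun e => if e = x then 1 else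
        if h : ∃ i, co φ t e i ≠ 0 then (R (P h.choose))⁻¹ else 1 with hs'
      have hs'0 : ∀ e, s' e ≠ 0 := by
        intro e
        simp only [hs']
        split_ifs with h1 h2
        exacts [one_ne_zero, inv_ne_zero (hR0 _), one_ne_zero]
      refine ⟨fun e => s' e * s e, M * M', fun e => mul_ne_zero (hs'0 e) (hs e), ?_, ?_⟩
      · rw [Matrix.det_mul]; exact mul_ne_zero hM hM'
      intro e he
      have e1 : (s' e * s e) • Matrix.vecMul (φ₂ e) (M * M') = s' e • Matrix.vecMul (φ₃ e) M' := by
        simp only [hφ₃, Matrix.smul_vecMul, Matrix.vecMul_vecMul, smul_smul]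
      rw [e1, hM'', Finset.smul_sum, sum_co φ₁ hD₁ e]
      refine Finset.sum_congr rfl fun i _ => ?_
      rw [smul_smul, smul_smul]
      congr 1
      by_cases hex : e = x
      · subst hex
        simp only [hs', if_true, one_mul]
        rw [hRx]; ring
      have heY : e ∈ Y := by
        rcases he with he | rfl | he
        exacts [Or.inl he, absurd rfl hex, Or.inr he]
      rw [← heqc e heY]
      by_cases hi : co φ t e i = 0
      · rw [(h₁.zero.co htX ht (hYX heY) _).mp hi]; simp
      have h : ∃ i, co φ t e i ≠ 0 := ⟨i, hi⟩
      have : P h.choose = P i := hPeq e heY _ _ h.choose_spec hi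
      simp only [hs', if_neg hex, dif_pos h]
      rw [this]
      have := hR0 i
      field_simp
  obtain ⟨s, M, hs, hM, h⟩ := key X hX Subset.rfl
  exact ⟨s, M, hs, hM, fun e he => h e (Or.inr he)⟩

end Unique

section Blocks

variable {F K : Type*} [Field F] [Field K] {ι : Type*} [Fintype ι] [DecidableEq ι] {E : Type*}
  {f : F → K} {φ : E → ι → F} {φ' : E → ι → K} {φ₃ : E → ι → ZMod 3} {x y : E}

lemma minor_iff_of_sameZero {X : Set E} (h : SameZero φ φ' X) {t : ι → E} (ht : ∀ i, t i ∈ X)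
    (hD : D φ t ≠ 0) {i j : ι} (hij : i ≠ j) {c d : E} (hc : c ∈ X) (hd : d ∈ X) :
    co φ t c i * co φ t d j = co φ t c j * co φ t d i ↔
      co φ' t c i * co φ' t d j = co φ' t c j * co φ' t d i := by
  have hD' := (h t ht).not.mp hD
  have := h.lineBr (i := i) (j := j) (fun k _ _ => ht k) hc hd
  rwa [VecConfig.lineBr, VecConfig.lineBr, D_update_two φ hD hij, D_update_two φ' hD' hij,
    mul_eq_zero, mul_eq_zero, or_iff_right hD, or_iff_right hD', sub_eq_zero, sub_eq_zero] at this

/-- Lifts of the deletions of `x` and of `y`, given by the same configuration. -/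
structure PreGlue (f : F → K) (φ : E → ι → F) (φ' : E → ι → K) (φ₃ : E → ι → ZMod 3)
    (x y : E) : Prop where
  lift : IsLift f
  tern : SameZero φ φ₃ univ
  ne : x ≠ y
  left : Good f φ φ' {x}ᶜ
  right : Good f φ φ' {y}ᶜ

/-- The basis `t` avoids the elements `x` and `y`. -/
def Avoids (t : ι → E) (x y : E) : Prop := ∀ l, t l ≠ x ∧ t l ≠ y

lemma Avoids.symm {t : ι → E} (ht : Avoids t x y) : Avoids t y x := fun l => (ht l).symm

lemma Avoids.update {t : ι → E} (ht : Avoids t x y) (i : ι) {c : E} (hc : c ≠ x ∧ c ≠ y) :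
    Avoids (Function.update t i c) x y := fun l => by
  by_cases hl : l = i
  · subst hl; simpa using hc
  · simpa [hl] using ht l

namespace PreGlue

lemma symm (h : PreGlue f φ φ' φ₃ x y) : PreGlue f φ φ' φ₃ y x :=
  ⟨h.lift, h.tern, h.ne.symm, h.right, h.left⟩

variable {t : ι → E}

lemma D_ne (h : PreGlue f φ φ' φ₃ x y) (ht : Avoids t x y) (hD : D φ t ≠ 0) : D φ' t ≠ 0 :=
  (h.left.zero t fun i => (ht i).1).not.mp hD

lemma D_ne_tern (h : PreGlue f φ φ' φ₃ x y) (hD : D φ t ≠ 0) : D φ₃ t ≠ 0 :=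
  (h.tern t fun _ => mem_univ _).not.mp hD

lemma co_iff (h : PreGlue f φ φ' φ₃ x y) (ht : Avoids t x y) (hD : D φ t ≠ 0) (e : E) (i : ι) :
    co φ t e i = 0 ↔ co φ' t e i = 0 := by
  by_cases he : e = x
  · exact h.right.zero.co (fun i => (ht i).2) hD (he ▸ h.ne) i
  · exact h.left.zero.co (fun i => (ht i).1) hD he i

lemma co_iff_tern (h : PreGlue f φ φ' φ₃ x y) (hD : D φ t ≠ 0) (e : E) (i : ι) :
    co φ t e i = 0 ↔ co φ₃ t e i = 0 :=
  h.tern.co (fun _ => mem_univ _) hD (mem_univ e) i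

lemma minor_iff_tern (h : PreGlue f φ φ' φ₃ x y) (hD : D φ t ≠ 0) {i j : ι} (hij : i ≠ j)
    (c d : E) : co φ t c i * co φ t d j = co φ t c j * co φ t d i ↔
      co φ₃ t c i * co φ₃ t d j = co φ₃ t c j * co φ₃ t d i :=
  minor_iff_of_sameZero h.tern (fun _ => mem_univ _) hD hij (mem_univ c) (mem_univ d)

/-- A block is lifted correctly if a further column has nonzero entries in both of its rows. -/
lemma blk_of_column (h : PreGlue f φ φ' φ₃ x y) (ht : Avoids t x y) (hD : D φ t ≠ 0)
    {i j : ι} (hij : i ≠ j) {c : E} (hc : c ≠ x ∧ c ≠ y) (hi : co φ t c i ≠ 0)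
    (hj : co φ t c j ≠ 0) : Blk f φ φ' t i j x y := by
  intro h1 h2 h3 h4
  have bx := h.right.blk t (fun l => (ht l).2) hD i j hij c hc.2 x h.ne hi hj h1 h2
  have by' := h.left.blk t (fun l => (ht l).1) hD i j hij c hc.1 y h.ne.symm hi hj h3 h4
  have tern : ∀ a b c a' b' c' : ZMod 3, a ≠ 0 → b ≠ 0 → c ≠ 0 → a' ≠ 0 → b' ≠ 0 → c' ≠ 0 →
      (a * b' = a' * b ∨ a * c' = a' * c ∨ b * c' = b' * c) := by decide
  have n := fun e l => (h.co_iff_tern hD e l).not.mp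
  have n' := fun e l => (h.co_iff ht hD e l).not.mp
  have key := tern _ _ _ _ _ _ (n _ _ hi) (n _ _ h1) (n _ _ h3) (n _ _ hj) (n _ _ h2) (n _ _ h4)
  rw [← h.minor_iff_tern hD hij, ← h.minor_iff_tern hD hij, ← h.minor_iff_tern hD hij] at key
  have hi' := n' _ _ hi
  have hj' := n' _ _ hj
  have h1' := n' _ _ h1
  have h2' := n' _ _ h2
  have h3' := n' _ _ h3
  have h4' := n' _ _ h4
  have e1 : co φ t x i * co φ t y j / (co φ t y i * co φ t x j)
      = (co φ t c i * co φ t y j / (co φ t y i * co φ t c j))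
        * (co φ t c i * co φ t x j / (co φ t x i * co φ t c j))⁻¹ := by
    field_simp
  have e2 : co φ' t x i * co φ' t y j / (co φ' t y i * co φ' t x j)
      = (co φ' t c i * co φ' t y j / (co φ' t y i * co φ' t c j))
        * (co φ' t c i * co φ' t x j / (co φ' t x i * co φ' t c j))⁻¹ := by
    field_simp
  rw [e1, e2, ← bx, ← by']
  have e0 : co φ t c i * co φ t x j / (co φ t x i * co φ t c j) ≠ 0 := by positivity
  rcases key with k | k | k
  · rw [show co φ t c i * co φ t x j / (co φ t x i * co φ t c j) = 1 by
      rw [div_eq_one_iff_eq (by positivity), k, mul_comm], inv_one, h.lift.one, inv_one, mul_one,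
      mul_one]
  · rw [show co φ t c i * co φ t y j / (co φ t y i * co φ t c j) = 1 by
      rw [div_eq_one_iff_eq (by positivity), k, mul_comm], h.lift.one, one_mul, one_mul, h.lift.inv]
  · rw [show co φ t c i * co φ t y j / (co φ t y i * co φ t c j)
        = co φ t c i * co φ t x j / (co φ t x i * co φ t c j) by
      rw [div_eq_div_iff (by positivity) (by positivity)]
      linear_combination co φ t c i * co φ t c j * k, mul_inv_cancel₀ e0,
      mul_inv_cancel₀ (h.lift.eq_zero_iff.not.mpr e0), h.lift.one]

/-- The path of length two, when the middle row meets exactly one of the two columns: either the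
block is lifted correctly, or the entries of `y` and of the first column are proportional. -/
lemma blk_or_parallel (h : PreGlue f φ φ' φ₃ x y) (ht : Avoids t x y) (hD : D φ t ≠ 0)
    {i j p : ι} (hij : i ≠ j) (hip : i ≠ p) {c d : E} (hc : c ≠ x ∧ c ≠ y)
    (hd : d ≠ x ∧ d ≠ y) (hci : co φ t c i ≠ 0) (hcp : co φ t c p ≠ 0) (hcj : co φ t c j = 0)
    (hdi : co φ t d i = 0) (hdp : co φ t d p ≠ 0) (hdj : co φ t d j ≠ 0)
    (hx : co φ t x p = 0) (hy : co φ t y p ≠ 0) :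
    Blk f φ φ' t i j x y ∨ co φ t c i * co φ t y p = co φ t c p * co φ t y i := by
  refine or_iff_not_imp_right.mpr fun hτ h1 h2 h3 h4 => ?_
  have hD₁ := D_pivot_ne_zero hD hcp
  have ht₁ := ht.update p hc
  have n := fun e l => (h.co_iff_tern hD e l).not.mp
  have n' := fun e l => (h.co_iff ht hD e l).not.mp
  have z' := fun e l => (h.co_iff ht hD e l).mp
  have hD' := h.D_ne ht hD
  have hD₃ := h.D_ne_tern hD
  have hci' := n' _ _ hci
  have hcp' := n' _ _ hcp
  have h1' := n' _ _ h1
  have h2' := n' _ _ h2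
  have h3' := n' _ _ h3
  have h4' := n' _ _ h4
  have hy' := n' _ _ hy
  have d1 : co φ (Function.update t p c) d i ≠ 0 := by
    rw [co_pivot_of_ne φ hD hip hcp, hdi, zero_sub, neg_ne_zero]
    positivity
  have d2 : co φ (Function.update t p c) d j ≠ 0 := by
    rwa [co_pivot_of_zero_right (ht := hD) hcp hcj]
  have b1 := h.left.blk t (fun l => (ht l).1) hD i p hip c hc.1 y h.ne.symm hci hcp h3 hy
  have blk := h.blk_of_column ht₁ hD₁ hij hd d1 d2
  have x1 : co φ (Function.update t p c) x i = co φ t x i :=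
    co_pivot_of_zero_left (ht := hD) hcp hx i
  have x2 : co φ (Function.update t p c) x j = co φ t x j :=
    co_pivot_of_zero_left (ht := hD) hcp hx j
  have y1 := co_pivot_of_ne φ hD hip hcp y
  have y2 := co_pivot_of_zero_right (ht := hD) hcp hcj y
  have x1' : co φ' (Function.update t p c) x i = co φ' t x i :=
    co_pivot_of_zero_left (ht := hD') hcp' (z' _ _ hx) i
  have x2' : co φ' (Function.update t p c) x j = co φ' t x j :=
    co_pivot_of_zero_left (ht := hD') hcp' (z' _ _ hx) j
  have y1' := co_pivot_of_ne φ' hD' hip hcp' y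
  have y2' := co_pivot_of_zero_right (ht := hD') hcp' (z' _ _ hcj) y
  have q0 : co φ t y i - co φ t c i * co φ t y p / co φ t c p ≠ 0 := by
    intro h0
    apply hτ
    field_simp at h0
    linear_combination -h0
  have hb := blk (by rwa [x1]) (by rwa [x2]) (by rwa [y1]) (by rwa [y2])
  rw [x1, x2, y1, y2, x1', x2', y1', y2'] at hb
  set τ := co φ t c i * co φ t y p / (co φ t y i * co φ t c p) with hτd
  set τ' := co φ' t c i * co φ' t y p / (co φ' t y i * co φ' t c p) with hτd'
  set Q := co φ t x i * co φ t y j / (co φ t y i * co φ t x j) with hQ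
  set Q' := co φ' t x i * co φ' t y j / (co φ' t y i * co φ' t x j) with hQ'
  have hτ1 : 1 - τ ≠ 0 := by
    rw [sub_ne_zero, ne_comm, hτd, Ne, div_eq_one_iff_eq (by positivity)]
    exact fun h0 => hτ (by rw [h0, mul_comm])
  have hτ1' : 1 - τ' ≠ 0 := by
    rw [← b1, ← h.lift.sub]
    exact h.lift.eq_zero_iff.not.mpr hτ1
  have e1 : co φ t y i - co φ t c i * co φ t y p / co φ t c p = co φ t y i * (1 - τ) := by
    rw [hτd]; field_simp
  have e2 : co φ' t y i - co φ' t c i * co φ' t y p / co φ' t c p = co φ' t y i * (1 - τ') := by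
    rw [hτd']; field_simp
  have e3 : co φ t x i * co φ t y j / (co φ t y i * (1 - τ) * co φ t x j) = Q / (1 - τ) := by
    rw [hQ]; field_simp
  have e4 : co φ' t x i * co φ' t y j / (co φ' t y i * (1 - τ') * co φ' t x j)
      = Q' / (1 - τ') := by
    rw [hQ']; field_simp
  rw [e1, e2, e3, e4] at hb
  by_cases hQ1 : Q = 1
  · rw [hQ1, one_div, h.lift.inv, h.lift.sub, b1] at hb
    rw [hQ1, h.lift.one]
    field_simp at hb
    exact hb
  have m1 := (h.minor_iff_tern hD hij x y).not.mp fun h0 => hQ1 (by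
    rw [hQ, div_eq_one_iff_eq (by positivity), h0, mul_comm])
  have m2 := (h.minor_iff_tern hD hip c y).not.mp hτ
  have m3 := h.minor_iff_tern hD₁ hij x y
  rw [x1, x2, y1, y2, e1] at m3
  have hcp₃ := n _ _ hcp
  have key : co φ₃ (Function.update t p c) x i * co φ₃ (Function.update t p c) y j
      = co φ₃ (Function.update t p c) x j * co φ₃ (Function.update t p c) y i := by
    rw [co_pivot_of_zero_left (ht := hD₃) hcp₃ ((h.co_iff_tern hD _ _).mp hx),
      co_pivot_of_zero_left (ht := hD₃) hcp₃ ((h.co_iff_tern hD _ _).mp hx),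
      co_pivot_of_zero_right (ht := hD₃) hcp₃ ((h.co_iff_tern hD _ _).mp hcj),
      co_pivot_of_ne φ₃ hD₃ hip hcp₃]
    have k1 := zmod_three_eq_neg _ _ (mul_ne_zero (n _ _ h1) (n _ _ h4))
      (mul_ne_zero (n _ _ h2) (n _ _ h3)) m1
    have k2 := zmod_three_eq_neg _ _ (mul_ne_zero (n _ _ hci) (n _ _ hy))
      (mul_ne_zero (n _ _ hcp) (n _ _ h3)) m2
    have k3 : (3 : ZMod 3) = 0 := by decide
    have k4 : co φ₃ t c i * co φ₃ t y p / co φ₃ t c p = - co φ₃ t y i := by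
      rw [div_eq_iff hcp₃]; linear_combination k2
    rw [k4]
    linear_combination k1 - co φ₃ t x j * co φ₃ t y i * k3
  rw [← m3] at key
  have hQτ : Q = 1 - τ := by
    rw [hQ, div_eq_iff (by positivity)]
    linear_combination key
  rw [hQτ, div_self hτ1, h.lift.one] at hb
  rw [hQτ, h.lift.sub, b1]
  field_simp at hb
  exact hb

/-- The path of length two, when the middle row meets exactly one of the two columns. -/
lemma blk_of_path_zero (h : PreGlue f φ φ' φ₃ x y) (hneg : f (-1) = -1)
    (ht : Avoids t x y) (hD : D φ t ≠ 0)
    {i j p : ι} (hij : i ≠ j) (hip : i ≠ p) (hjp : j ≠ p) {c d : E} (hc : c ≠ x ∧ c ≠ y)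
    (hd : d ≠ x ∧ d ≠ y) (hci : co φ t c i ≠ 0) (hcp : co φ t c p ≠ 0) (hcj : co φ t c j = 0)
    (hdi : co φ t d i = 0) (hdp : co φ t d p ≠ 0) (hdj : co φ t d j ≠ 0)
    (hx : co φ t x p = 0) (hy : co φ t y p ≠ 0) : Blk f φ φ' t i j x y := by
  rcases h.blk_or_parallel ht hD hij hip hc hd hci hcp hcj hdi hdp hdj hx hy with hb | k1
  · exact hb
  rcases h.blk_or_parallel ht hD hij.symm hjp hd hc hdj hdp hdi hcj hcp hci hx hy with hb | k2
  · exact hb.swap_rows h.lift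
  intro h1 h2 h3 h4
  have n := fun e l => (h.co_iff_tern hD e l).not.mp
  have n' := fun e l => (h.co_iff ht hD e l).not.mp
  have z' := fun e l => (h.co_iff ht hD e l).mp
  have z := fun e l => (h.co_iff_tern hD e l).mp
  have hD' := h.D_ne ht hD
  have hD₃ := h.D_ne_tern hD
  have k1' := (minor_iff_of_sameZero h.left.zero (fun l => (ht l).1) hD hip hc.1
    h.ne.symm).mp k1
  have k2' := (minor_iff_of_sameZero h.left.zero (fun l => (ht l).1) hD hjp hd.1
    h.ne.symm).mp k2
  have k1₃ := (h.minor_iff_tern hD hip c y).mp k1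
  have k2₃ := (h.minor_iff_tern hD hjp d y).mp k2
  have hci' := n' _ _ hci
  have hcp' := n' _ _ hcp
  have hdj' := n' _ _ hdj
  have hdp' := n' _ _ hdp
  have h1' := n' _ _ h1
  have h2' := n' _ _ h2
  have h3' := n' _ _ h3
  have h4' := n' _ _ h4
  have hy' := n' _ _ hy
  have hxp' := z' _ _ hx
  have hD₁ := D_pivot_ne_zero hD hcp
  have ht₁ := ht.update p hc
  have d1 := co_pivot_of_ne φ hD hip hcp d
  have d2 := co_pivot_of_zero_right (ht := hD) hcp hcj d
  have x1 : co φ (Function.update t p c) x i = co φ t x i :=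
    co_pivot_of_zero_left (ht := hD) hcp hx i
  have x2 : co φ (Function.update t p c) x j = co φ t x j :=
    co_pivot_of_zero_left (ht := hD) hcp hx j
  have d1' := co_pivot_of_ne φ' hD' hip hcp' d
  have d2' := co_pivot_of_zero_right (ht := hD') hcp' (z' _ _ hcj) d
  have x1' : co φ' (Function.update t p c) x i = co φ' t x i :=
    co_pivot_of_zero_left (ht := hD') hcp' hxp' i
  have x2' : co φ' (Function.update t p c) x j = co φ' t x j :=
    co_pivot_of_zero_left (ht := hD') hcp' hxp' j
  rw [hdi, zero_sub] at d1
  rw [z' _ _ hdi, zero_sub] at d1'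
  have d0 : co φ (Function.update t p c) d i ≠ 0 := by
    rw [d1, neg_ne_zero]; positivity
  have hb := h.right.blk _ (fun l => (ht₁ l).2) hD₁ i j hij d hd.2 x h.ne d0 (by rwa [d2])
    (by rwa [x1]) (by rwa [x2])
  rw [x1, x2, d1, d2, x1', x2', d1', d2'] at hb
  set Q := co φ t x i * co φ t y j / (co φ t y i * co φ t x j) with hQ
  set Q' := co φ' t x i * co φ' t y j / (co φ' t y i * co φ' t x j) with hQ'
  have hQ0' : Q' ≠ 0 := by positivity
  have e1 : -(co φ t c i * co φ t d p / co φ t c p) * co φ t x j / (co φ t x i * co φ t d j)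
      = - Q⁻¹ := by
    rw [hQ, inv_div]
    field_simp
    have : co φ t c i * co φ t d p * co φ t y j = co φ t c p * co φ t y i * co φ t d j :=
      mul_right_cancel₀ hy (by
        linear_combination co φ t d p * co φ t y j * k1 - co φ t c p * co φ t y i * k2)
    linear_combination -this
  have e2 : -(co φ' t c i * co φ' t d p / co φ' t c p) * co φ' t x j / (co φ' t x i * co φ' t d j)
      = - Q'⁻¹ := by
    rw [hQ', inv_div]
    field_simp
    have : co φ' t c i * co φ' t d p * co φ' t y j = co φ' t c p * co φ' t y i * co φ' t d j :=
      mul_right_cancel₀ hy' (by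
        linear_combination co φ' t d p * co φ' t y j * k1' - co φ' t c p * co φ' t y i * k2')
    linear_combination -this
  rw [e1, e2] at hb
  by_cases hQ1 : Q = 1
  · rw [hQ1, inv_one, hneg, neg_inj, eq_comm, inv_eq_one] at hb
    rw [hQ1, h.lift.one, hb]
  have m1 := (h.minor_iff_tern hD hij x y).not.mp fun h0 => hQ1 (by
    rw [hQ, div_eq_one_iff_eq (by positivity), h0, mul_comm])
  have hxj := D_pivot_ne_zero hD h2
  have hcp₃ := n _ _ hcp
  have hx₃ := n _ _ h2
  have m3 := h.minor_iff_tern hxj hip c d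
  have r1 : co φ₃ t x i * co φ₃ t y j = - (co φ₃ t x j * co φ₃ t y i) :=
    zmod_three_eq_neg _ _ (mul_ne_zero (n _ _ h1) (n _ _ h4))
      (mul_ne_zero (n _ _ h2) (n _ _ h3)) m1
  have key : co φ₃ (Function.update t j x) c i * co φ₃ (Function.update t j x) d p
      = co φ₃ (Function.update t j x) c p * co φ₃ (Function.update t j x) d i := by
    rw [co_pivot_of_zero_left (ht := hD₃) hx₃ (z _ _ hcj),
      co_pivot_of_zero_left (ht := hD₃) hx₃ (z _ _ hcj),
      co_pivot_of_zero_right (ht := hD₃) hx₃ (z _ _ hx),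
      co_pivot_of_ne φ₃ hD₃ hij hx₃, z _ _ hdi, zero_sub]
    have := n _ _ hy
    have : co φ₃ t c i * co φ₃ t d p * co φ₃ t x j = - (co φ₃ t c p * co φ₃ t x i * co φ₃ t d j) :=
      mul_right_cancel₀ this (by
        linear_combination co φ₃ t d p * co φ₃ t x j * k1₃ + co φ₃ t c p * co φ₃ t d p * r1
          + co φ₃ t c p * co φ₃ t x i * k2₃)
    field_simp
    linear_combination this
  rw [← m3, co_pivot_of_zero_left (ht := hD) h2 hcj, co_pivot_of_zero_left (ht := hD) h2 hcj,
    co_pivot_of_zero_right (ht := hD) h2 hx, co_pivot_of_ne φ hD hij h2, hdi, zero_sub] at key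
  have hQm : Q = -1 := by
    rw [hQ, div_eq_iff (by positivity)]
    field_simp at key
    apply mul_right_cancel₀ (mul_ne_zero hdp hcp)
    linear_combination co φ t y p * key - co φ t c p * co φ t x i * k2 - co φ t d p * co φ t x j * k1
  rw [hQm, inv_neg_one, neg_neg, h.lift.one] at hb
  field_simp at hb
  rw [hQm, hneg, hb]

end PreGlue

end Blocks

section Blocks

variable {F K : Type*} [Field F] [Field K] {ι : Type*} [Fintype ι] [DecidableEq ι] {E : Type*}
  {f : F → K} {φ : E → ι → F} {φ' : E → ι → K} {φ₃ : E → ι → ZMod 3} {x y : E}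

namespace PreGlue

variable {t : ι → E}

lemma blk_of_pivot (h : PreGlue f φ φ' φ₃ x y) (ht : Avoids t x y) (hD : D φ t ≠ 0)
    {p i j : ι} {c : E} (hcp : co φ t c p ≠ 0)
    (h' : Blk f φ φ' (Function.update t p c) i j x y)
    (hxi : co φ t c i = 0 ∨ co φ t x p = 0) (hyi : co φ t c i = 0 ∨ co φ t y p = 0)
    (hxj : co φ t c j = 0 ∨ co φ t x p = 0) (hyj : co φ t c j = 0 ∨ co φ t y p = 0) :
    Blk f φ φ' t i j x y := by
  have hD' := h.D_ne ht hD
  have hcp' := (h.co_iff ht hD _ _).not.mp hcp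
  have key : ∀ e l, (co φ t c l = 0 ∨ co φ t e p = 0) →
      co φ (Function.update t p c) e l = co φ t e l ∧
      co φ' (Function.update t p c) e l = co φ' t e l := by
    rintro e l (h0 | h0)
    · exact ⟨co_pivot_of_zero_right (ht := hD) hcp h0 e,
        co_pivot_of_zero_right (ht := hD') hcp' ((h.co_iff ht hD _ _).mp h0) e⟩
    · exact ⟨co_pivot_of_zero_left (ht := hD) hcp h0 l,
        co_pivot_of_zero_left (ht := hD') hcp' ((h.co_iff ht hD _ _).mp h0) l⟩
  intro h1 h2 h3 h4
  have := h' (by rwa [(key x i hxi).1]) (by rwa [(key x j hxj).1]) (by rwa [(key y i hyi).1])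
    (by rwa [(key y j hyj).1])
  rwa [(key x i hxi).1, (key x j hxj).1, (key y i hyi).1, (key y j hyj).1, (key x i hxi).2,
    (key x j hxj).2, (key y i hyi).2, (key y j hyj).2] at this

/-- The path of length two. -/
lemma blk_of_path (h : PreGlue f φ φ' φ₃ x y) (hneg : f (-1) = -1)
    (ht : Avoids t x y) (hD : D φ t ≠ 0) {i j p : ι} (hij : i ≠ j) {c d : E}
    (hc : c ≠ x ∧ c ≠ y) (hd : d ≠ x ∧ d ≠ y) (hci : co φ t c i ≠ 0) (hcp : co φ t c p ≠ 0)
    (hdp : co φ t d p ≠ 0) (hdj : co φ t d j ≠ 0) : Blk f φ φ' t i j x y := by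
  by_cases hcj : co φ t c j = 0
  swap
  · exact h.blk_of_column ht hD hij hc hci hcj
  by_cases hdi : co φ t d i = 0
  swap
  · exact h.blk_of_column ht hD hij hd hdi hdj
  have hip : i ≠ p := fun h0 => hdp (h0 ▸ hdi)
  have hjp : j ≠ p := fun h0 => hcp (h0 ▸ hcj)
  by_cases hx : co φ t x p = 0
  · by_cases hy : co φ t y p = 0
    · refine h.blk_of_pivot ht hD hcp ?_ (Or.inr hx) (Or.inr hy) (Or.inl hcj) (Or.inl hcj)
      refine h.blk_of_column (ht.update p hc) (D_pivot_ne_zero hD hcp) hij hd ?_ ?_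
      · rw [co_pivot_of_ne φ hD hip hcp, hdi, zero_sub, neg_ne_zero]
        positivity
      · rwa [co_pivot_of_zero_right (ht := hD) hcp hcj]
    · exact h.blk_of_path_zero hneg ht hD hij hip hjp hc hd hci hcp hcj hdi hdp hdj hx hy
  · by_cases hy : co φ t y p = 0
    · exact (h.symm.blk_of_path_zero hneg ht.symm hD hij hip hjp hc.symm hd.symm hci hcp hcj hdi
        hdp hdj hy hx).swap_cols h.lift
    · intro h1 h2 h3 h4
      have b1 := h.blk_of_column ht hD hip hc hci hcp h1 hx h3 hy
      have b2 := h.blk_of_column ht hD hjp.symm hd hdp hdj hx h2 hy h4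
      have tern : ∀ a b c a' b' c' : ZMod 3, a ≠ 0 → b ≠ 0 → c ≠ 0 → a' ≠ 0 → b' ≠ 0 → c' ≠ 0 →
        (a * b' = b * a' ∨ b * c' = c * b' ∨ a * c' = c * a') := by decide
      have n := fun e l => (h.co_iff_tern hD e l).not.mp
      have n' := fun e l => (h.co_iff ht hD e l).not.mp
      have key := tern _ _ _ _ _ _ (n _ _ h1) (n _ _ hx) (n _ _ h2) (n _ _ h3) (n _ _ hy)
        (n _ _ h4)
      rw [← h.minor_iff_tern hD hip, ← h.minor_iff_tern hD hij,
        ← h.minor_iff_tern hD hjp.symm] at key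
      have h1' := n' _ _ h1
      have h2' := n' _ _ h2
      have h3' := n' _ _ h3
      have h4' := n' _ _ h4
      have hx' := n' _ _ hx
      have hy' := n' _ _ hy
      set P := co φ t x i * co φ t y p / (co φ t y i * co φ t x p) with hP
      set R := co φ t x p * co φ t y j / (co φ t y p * co φ t x j) with hR
      have e1 : co φ t x i * co φ t y j / (co φ t y i * co φ t x j) = P * R := by
        rw [hP, hR]; field_simp
      have e2 : co φ' t x i * co φ' t y j / (co φ' t y i * co φ' t x j)
          = (co φ' t x i * co φ' t y p / (co φ' t y i * co φ' t x p)) *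
            (co φ' t x p * co φ' t y j / (co φ' t y p * co φ' t x j)) := by
        field_simp
      rw [e1, e2, ← b1, ← b2]
      have hR0 : R ≠ 0 := by positivity
      rcases key with k | k | k
      · rw [show P = 1 by rw [hP, div_eq_one_iff_eq (by positivity), k, mul_comm], h.lift.one,
          one_mul, one_mul]
      · rw [show R = 1 by rw [hR, div_eq_one_iff_eq (by positivity), k, mul_comm], h.lift.one,
          mul_one, mul_one]
      · rw [show P = R⁻¹ by
          rw [hP, hR, inv_div, div_eq_div_iff (by positivity) (by positivity)]
          linear_combination co φ t y p * co φ t x p * k, h.lift.inv, inv_mul_cancel₀ hR0,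
          inv_mul_cancel₀ (h.lift.eq_zero_iff.not.mpr hR0), h.lift.one]

/-- A block is lifted correctly if its rows are connected by a walk. -/
lemma blk_of_walk (h : PreGlue f φ φ' φ₃ x y) (hneg : f (-1) = -1) (k : ℕ) :
    ∀ {t : ι → E}, Avoids t x y → D φ t ≠ 0 → ∀ {i j : ι}, i ≠ j →
      Walk φ t {e | e ≠ x ∧ e ≠ y} k i j → Blk f φ φ' t i j x y := by
  induction k using Nat.strong_induction_on with
  | _ k ih =>
  intro t ht hD i j hij hw
  match k, hw with
  | 0, hw => exact absurd hw hij
  | 1, ⟨c, hc, l, h1, h2, h3⟩ =>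
    obtain rfl : l = j := h3
    exact h.blk_of_column ht hD hij hc h1 h2
  | 2, ⟨c, hc, l, h1, h2, d, hd, m, h3, h4, h5⟩ =>
    obtain rfl : m = j := h5
    exact h.blk_of_path hneg ht hD hij hc hd h1 h2 h3 h4
  | n + 3, ⟨c, hc, l, h1, h2, d, hd, m, h3, h4, h5⟩ =>
    by_cases hdi : co φ t d i = 0
    swap
    · exact ih (n + 2) (by omega) ht hD hij ⟨d, hd, m, hdi, h4, h5⟩
    by_cases hdj : co φ t d j = 0
    swap
    · exact h.blk_of_path hneg ht hD hij hc hd h1 h2 h3 hdj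
    by_cases hcm : co φ t c m = 0
    swap
    · exact ih (n + 2) (by omega) ht hD hij ⟨c, hc, m, h1, hcm, h5⟩
    rcases h5.skip hD hd h3 h4 with h6 | ⟨m', hm', h6⟩ | h6
    · exact absurd hdj (h6 ▸ h4)
    · exact ih (m' + 1) (by omega) ht hD hij ⟨c, hc, l, h1, h2, h6⟩
    · refine h.blk_of_pivot ht hD h4 ?_ (Or.inl hdi) (Or.inl hdi) (Or.inl hdj) (Or.inl hdj)
      refine ih (n + 2) (by omega) (ht.update m hd) (D_pivot_ne_zero hD h4) hij
        ⟨c, hc, l, ?_, ?_, h6⟩ <;> rwa [co_pivot_of_zero_left (ht := hD) h4 hcm]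

end PreGlue

end Blocks

section Transfer

variable {F K : Type*} [Field F] [Field K] {ι : Type*} [Fintype ι] [DecidableEq ι] {E : Type*}
  {f : F → K} {φ : E → ι → F} {φ' : E → ι → K} {X : Set E}

lemma update_mem {t : ι → E} (ht : ∀ i, t i ∈ X) (i : ι) {e : E} (he : e ∈ X) (l : ι) :
    Function.update t i e l ∈ X := by
  by_cases hl : l = i
  · subst hl; simpa using he
  · simpa [hl] using ht l

lemma D_congr {φ₁ φ₂ : E → ι → F} (h : ∀ e ∈ X, φ₁ e = φ₂ e) {t : ι → E} (ht : ∀ i, t i ∈ X) :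
    D φ₁ t = D φ₂ t := by
  simp only [D, h _ (ht _)]

lemma co_congr {φ₁ φ₂ : E → ι → F} (h : ∀ e ∈ X, φ₁ e = φ₂ e) {t : ι → E} (ht : ∀ i, t i ∈ X)
    {e : E} (he : e ∈ X) (i : ι) : co φ₁ t e i = co φ₂ t e i := by
  rw [co, co, D_congr h ht, D_congr h (update_mem ht i he)]

lemma Good.congr {φ'' : E → ι → K} (h : Good f φ φ' X) (heq : ∀ e ∈ X, φ' e = φ'' e) :
    Good f φ φ'' X := by
  refine ⟨fun t ht => by rw [h.zero t ht, D_congr heq ht],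
    fun t ht hD i j hij c hc d hd h1 h2 h3 h4 => ?_⟩
  rw [h.blk t ht hD i j hij c hc d hd h1 h2 h3 h4]
  simp only [co_congr heq ht hc, co_congr heq ht hd]

lemma D_comp {E' : Type*} (σ : E' → E) (t : ι → E') :
    D (fun e => φ (σ e)) t = D φ (fun i => σ (t i)) := rfl

lemma co_comp {E' : Type*} (σ : E' → E) (t : ι → E') (e : E') (i : ι) :
    co (fun e => φ (σ e)) t e i = co φ (fun i => σ (t i)) (σ e) i := by
  rw [co, co, D_comp, D_comp]
  congr 2
  funext l
  by_cases hl : l = i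
  · subst hl; simp
  · simp [hl]

/-- Lifts can be pulled back along a map of the ground sets. -/
lemma Good.comp {E' : Type*} {Y : Set E'} (h : Good f φ φ' X) {σ : E' → E}
    (hσ : ∀ e ∈ Y, σ e ∈ X) : Good f (fun e => φ (σ e)) (fun e => φ' (σ e)) Y := by
  refine ⟨fun t ht => h.zero _ fun i => hσ _ (ht i),
    fun t ht hD i j hij c hc d hd => ?_⟩
  have := h.blk _ (fun i => hσ _ (ht i)) hD i j hij _ (hσ c hc) _ (hσ d hd)
  unfold Blk at this ⊢
  simpa only [co_comp] using this

/-- A lift of the restriction to a set is a lift on that set. -/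
lemma Good.of_subtype {ψ : X → ι → K} (h : Good f (fun e : X => φ e) ψ univ) :
    ∃ φ' : E → ι → K, Good f φ φ' X := by
  classical
  by_cases hX : X.Nonempty
  · obtain ⟨a, ha⟩ := hX
    set σ : E → X := fun e => if h : e ∈ X then ⟨e, h⟩ else ⟨a, ha⟩ with hσ
    have hσX : ∀ e ∈ X, (σ e : E) = e := fun e he => by simp [hσ, he]
    have := h.comp (Y := X) (σ := σ) fun _ _ => mem_univ _
    refine ⟨fun e => ψ (σ e), fun t ht => ?_, fun t ht hD i j hij c hc d hd => ?_⟩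
    · rw [← this.zero t ht]
      exact iff_of_eq (congrArg (· = 0) (D_congr (X := X) (fun e he => by rw [hσX e he]) ht))
    · have heq : ∀ e ∈ X, φ (σ e) = φ e := fun e he => by rw [hσX e he]
      have h1 := this.blk t ht (by rwa [D_congr heq ht]) i j hij c hc d hd
      unfold Blk at h1 ⊢
      simpa only [co_congr heq ht hc, co_congr heq ht hd] using h1
  · rw [not_nonempty_iff_eq_empty] at hX
    subst hX
    refine ⟨fun _ _ => 0, fun t ht => ?_, fun t ht hD i j hij c hc => absurd hc (notMem_empty _)⟩
    rcases isEmpty_or_nonempty ι with hι | ⟨⟨i⟩⟩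
    · simp [D_eq_det]
    · exact absurd (ht i) (notMem_empty _)

/-- The lift property does not change when the vectors are scaled. -/
lemma Good.of_scale {s : E → F} (hs : ∀ e, s e ≠ 0) (h : Good f (fun e => s e • φ e) φ' X) :
    Good f φ φ' X := by
  have key : (fun e => s e • φ e) = fun e => s e • Matrix.vecMul (φ e) (1 : Matrix ι ι F) := by
    simp
  have h1 : (1 : Matrix ι ι F).det ≠ 0 := by simp
  have hD : ∀ t, D (fun e => s e • φ e) t = 0 ↔ D φ t = 0 := fun t => by
    rw [key, D_scale]
    have h0 : ∏ k, s (t k) ≠ 0 := Finset.prod_ne_zero_iff.mpr fun k _ => hs _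
    simp [h0]
  have hc : ∀ t, D φ t ≠ 0 → ∀ e i, co (fun e => s e • φ e) t e i
      = s e / s (t i) * co φ t e i := fun t ht e i => by
    rw [key, co_scale φ hs h1 ht]
  refine ⟨fun t ht => by rw [← h.zero t ht, hD],
    fun t ht hDt i j hij c hc' d hd h1 h2 h3 h4 => ?_⟩
  have hsc := hs c
  have hsd := hs d
  have hsi := hs (t i)
  have hsj := hs (t j)
  have := h.blk t ht (by rwa [Ne, hD]) i j hij c hc' d hd
    (by rw [hc t hDt]; positivity) (by rw [hc t hDt]; positivity)
    (by rw [hc t hDt]; positivity) (by rw [hc t hDt]; positivity)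
  rw [← this]
  simp only [hc t hDt]
  congr 1
  field_simp

/-- A lift extends to an element that is parallel to another one. -/
lemma Good.extend_parallel {x e : E} (hex : e ≠ x) {c : F} (hc : c ≠ 0) (hx : φ x = c • φ e)
    (h : Good f φ φ' {x}ᶜ) : ∃ φ'' : E → ι → K, Good f φ φ'' univ := by
  classical
  set σ : E → E := fun z => if z = x then e else z with hσ
  have h' := h.comp (Y := univ) (σ := σ) fun z _ => by
    by_cases hz : z = x
    · simpa [hσ, hz] using hex
    · simp [hσ, hz]
  refine ⟨fun z => φ' (σ z), Good.of_scale (s := fun z => if z = x then c⁻¹ else 1)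
    (fun z => ?_) ?_⟩
  · split_ifs
    exacts [inv_ne_zero hc, one_ne_zero]
  · convert h' using 2 with z
    by_cases hz : z = x
    · simp [hσ, hz, hx, smul_smul, inv_mul_cancel₀ hc]
    · simp [hσ, hz]

/-- A lift extends to an element that is a loop. -/
lemma Good.extend_zero {x : E} (hx : φ x = 0) (h : Good f φ φ' {x}ᶜ) :
    ∃ φ'' : E → ι → K, Good f φ φ'' univ := by
  classical
  set φ'' : E → ι → K := fun z => if z = x then 0 else φ' z with hφ
  have h'' : Good f φ φ'' {x}ᶜ := h.congr fun z hz => by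
    simp only [hφ, if_neg (mem_compl_singleton_iff.mp hz)]
  have hx' : φ'' x = 0 := by simp [hφ]
  have hD : ∀ t : ι → E, D φ t ≠ 0 → ∀ i, t i ≠ x := fun t ht i hi => by
    apply ht
    rw [← Function.update_eq_self i t, D_update, hi, hx]
    exact AlternatingMap.map_update_zero _ _ _
  have hD' : ∀ t : ι → E, D φ'' t ≠ 0 → ∀ i, t i ≠ x := fun t ht i hi => by
    apply ht
    rw [← Function.update_eq_self i t, D_update, hi, hx']
    exact AlternatingMap.map_update_zero _ _ _
  have hco : ∀ t i, co φ t x i = 0 := fun t i => by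
    rw [co, D_update, hx, AlternatingMap.map_update_zero, zero_div]
  refine ⟨φ'', fun t _ => ?_, fun t _ hDt i j hij c _ d _ h1 h2 h3 h4 => ?_⟩
  · by_cases ht : ∀ i, t i ≠ x
    · exact h''.zero t ht
    · have e1 : D φ t = 0 := by
        by_contra hc; exact ht (hD t hc)
      have e2 : D φ'' t = 0 := by
        by_contra hc; exact ht (hD' t hc)
      rw [e1, e2]
      simp
  · refine h''.blk t (hD t hDt) hDt i j hij c ?_ d ?_ h1 h2 h3 h4
    · rintro rfl; exact h1 (hco _ _)
    · rintro rfl; exact h3 (hco _ _)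

end Transfer

section Glue

variable {F K : Type*} [Field F] [Field K] {ι : Type*} [Fintype ι] [DecidableEq ι] {E : Type*}
  {f : F → K} {φ : E → ι → F} {φ₃ : E → ι → ZMod 3} {x y : E} {X : Set E}

/-- Gluing of lifts of the deletions of `x` and of `y`. -/
theorem glue [Finite E] (hf : IsLift f) (hneg : f (-1) = -1) (hφ : SameZero φ φ₃ univ)
    (hxy : x ≠ y) {t₀ : ι → E} (ht₀ : Avoids t₀ x y) (hD₀ : D φ t₀ ≠ 0)
    (h₁ : ∃ φ' : E → ι → K, Good f φ φ' {x}ᶜ) (h₂ : ∃ φ' : E → ι → K, Good f φ φ' {y}ᶜ)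
    (hw : ∀ t : ι → E, Avoids t x y → D φ t ≠ 0 → ∀ i j, co φ t x i ≠ 0 → co φ t x j ≠ 0 →
      co φ t y i ≠ 0 → co φ t y j ≠ 0 → ∃ k, Walk φ t {e | e ≠ x ∧ e ≠ y} k i j) :
    ∃ φ' : E → ι → K, Good f φ φ' univ := by
  classical
  obtain ⟨φ₁, h₁⟩ := h₁
  obtain ⟨φ₂, h₂⟩ := h₂
  obtain ⟨s, M, hs, hM, heq⟩ := exists_scaling (X := {e | e ≠ x ∧ e ≠ y}) (toFinite _)
    (h₁.mono fun e he => he.1) (h₂.mono fun e he => he.2) ht₀ hD₀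
  have h₂' := h₂.scale hs hM
  set φ' : E → ι → K := fun e => if e = x then s e • Matrix.vecMul (φ₂ e) M else φ₁ e with hφ'
  have pre : PreGlue f φ φ' φ₃ x y := by
    refine ⟨hf, hφ, hxy, h₁.congr fun e he => ?_, h₂'.congr fun e he => ?_⟩
    · simp only [hφ', if_neg (mem_compl_singleton_iff.mp he)]
    · by_cases hex : e = x
      · simp only [hφ', if_pos hex]
      · simp only [hφ', if_neg hex]
        exact (heq e ⟨hex, he⟩).symm
  refine ⟨φ', GlueData.good (x := x) (y := y) (t₀ := t₀) (φ₃ := φ₃)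
    ⟨hf, hφ, hxy, pre.left, pre.right, hD₀, ht₀, fun t ht hD i j hij h1 h2 h3 h4 => ?_⟩⟩
  obtain ⟨k, hk⟩ := hw t ht hD i j h1 h2 h3 h4
  exact pre.blk_of_walk hneg k ht hD hij hk h1 h2 h3 h4

lemma exists_vecMul {t : ι → E} (ht : D φ t ≠ 0) (w : ι → ι → F) :
    ∃ M : Matrix ι ι F, ∀ e, Matrix.vecMul (φ e) M = ∑ i, co φ t e i • w i := by
  set N : Matrix ι ι F := Matrix.of fun i => φ (t i) with hN
  have hu : IsUnit N.det := isUnit_iff_ne_zero.mpr ht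
  have hM : N * (N⁻¹ * Matrix.of w) = Matrix.of w := by
    rw [← Matrix.mul_assoc, Matrix.mul_nonsing_inv _ hu, Matrix.one_mul]
  refine ⟨N⁻¹ * Matrix.of w, fun e => ?_⟩
  conv_lhs => rw [sum_co φ ht e]
  rw [Matrix.sum_vecMul]
  refine Finset.sum_congr rfl fun i _ => ?_
  rw [Matrix.smul_vecMul]
  congr 1
  have := congrFun hM i
  rw [Matrix.mul_apply_eq_vecMul] at this
  exact this

/-- A linear map with eigenvectors `φ e` has equal eigenvalues on the support of a column. -/
lemma eigenvalue_eq {M : Matrix ι ι F} {ε : E → F}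
    (hM : ∀ e ∈ X, Matrix.vecMul (φ e) M = ε e • φ e) {t : ι → E} (ht : ∀ i, t i ∈ X)
    (hD : D φ t ≠ 0) {e : E} (he : e ∈ X) {i : ι} (hi : co φ t e i ≠ 0) : ε (t i) = ε e := by
  have h1 : ∑ l, (co φ t e l * (ε (t l) - ε e)) • φ (t l) = 0 := by
    have := hM e he
    have h2 : Matrix.vecMul (φ e) M = ∑ l, (co φ t e l * ε (t l)) • φ (t l) := by
      conv_lhs => rw [sum_co φ hD e]
      rw [Matrix.sum_vecMul]
      refine Finset.sum_congr rfl fun l _ => ?_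
      rw [Matrix.smul_vecMul, hM _ (ht l), smul_smul]
    have h3 : ε e • φ e = ∑ l, (co φ t e l * ε e) • φ (t l) := by
      conv_lhs => rw [sum_co φ hD e]
      rw [Finset.smul_sum]
      refine Finset.sum_congr rfl fun l _ => ?_
      rw [smul_smul, mul_comm]
    rw [h2, h3, ← sub_eq_zero, ← Finset.sum_sub_distrib] at this
    rw [← this]
    refine Finset.sum_congr rfl fun l _ => ?_
    rw [← sub_smul, mul_sub]
  have hl := linearIndependent_of_D_ne_zero hD
  have := Fintype.linearIndependent_iff.mp hl _ h1 i
  exact sub_eq_zero.mp ((mul_eq_zero.mp this).resolve_left hi)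

/-- A set of rows that no column in `X` crosses yields a linear map with eigenvectors `φ e`. -/
lemma exists_eigen {t : ι → E} (ht : ∀ i, t i ∈ X) (hD : D φ t ≠ 0) {Z : Set ι}
    (hZ : ∀ e ∈ X, ∀ i j, co φ t e i ≠ 0 → co φ t e j ≠ 0 → (i ∈ Z ↔ j ∈ Z)) :
    ∃ (M : Matrix ι ι F) (ε : E → F), (∀ e ∈ X, Matrix.vecMul (φ e) M = ε e • φ e) ∧
      ∀ i, (i ∈ Z → ε (t i) = 1) ∧ (i ∉ Z → ε (t i) = 0) := by
  classical
  obtain ⟨M, hM⟩ := exists_vecMul hD fun i => (if i ∈ Z then (1 : F) else 0) • φ (t i)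
  set ε : E → F := fun e => if ∃ i ∈ Z, co φ t e i ≠ 0 then 1 else 0 with hε
  refine ⟨M, ε, fun e he => ?_, fun i => ⟨fun hi => ?_, fun hi => ?_⟩⟩
  · rw [hM, sum_co φ hD e, Finset.smul_sum]
    refine Finset.sum_congr rfl fun i _ => ?_
    rw [smul_smul, smul_smul]
    congr 1
    by_cases hi : co φ t e i = 0
    · simp [hi]
    · have : (∃ j ∈ Z, co φ t e j ≠ 0) ↔ i ∈ Z :=
        ⟨fun ⟨j, hj, hj'⟩ => (hZ e he j i hj' hi).mp hj, fun h => ⟨i, h, hi⟩⟩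
      simp only [hε, this]
      split_ifs <;> ring
  · exact if_pos ⟨i, hi, by rw [co_self φ hD]; simp⟩
  · refine if_neg ?_
    rintro ⟨j, hj, h⟩
    rw [co_self φ hD] at h
    have : j = i := by
      by_contra hne; simp [hne] at h
    exact hi (this ▸ hj)

/-- Connectedness does not depend on the basis. -/
lemma connected_of_connected {t₀ t : ι → E} (ht₀ : ∀ i, t₀ i ∈ X) (hD₀ : D φ t₀ ≠ 0)
    (h : ∀ i j, ∃ k, Walk φ t₀ X k i j) (ht : ∀ i, t i ∈ X) (hD : D φ t ≠ 0) (i j : ι) :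
    ∃ k, Walk φ t X k i j := by
  by_contra hcon
  obtain ⟨M, ε, hM, hε⟩ := exists_eigen (Z := {l | ∃ k, Walk φ t X k i l}) ht hD
    fun e he l m hl hm => ⟨fun ⟨k, hk⟩ => ⟨_, hk.trans (Walk.single he hl hm)⟩,
      fun ⟨k, hk⟩ => ⟨_, hk.trans (Walk.single he hm hl)⟩⟩
  have h0 : ∀ k l m, Walk φ t₀ X k l m → ε (t₀ l) = ε (t₀ m) := by
    intro k
    induction k with
    | zero => rintro l m rfl; rfl
    | succ k ih =>
      rintro l m ⟨c, hc, p, h1, h2, h3⟩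
      rw [eigenvalue_eq hM ht₀ hD₀ hc h1, ← eigenvalue_eq hM ht₀ hD₀ hc h2, ih p m h3]
  have h1 : ∀ l, ∃ m, co φ t₀ (t l) m ≠ 0 := by
    intro l
    by_contra hl
    push Not at hl
    have hz : φ (t l) = 0 := by rw [sum_co φ hD₀ (t l)]; simp [hl]
    apply hD
    rw [← Function.update_eq_self l t, D_update, hz]
    exact AlternatingMap.map_update_zero _ _ _
  obtain ⟨m, hm⟩ := h1 i
  obtain ⟨n, hn⟩ := h1 j
  obtain ⟨k, hk⟩ := h m n
  have e1 := (hε i).1 ⟨0, rfl⟩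
  have e2 := (hε j).2 hcon
  rw [← eigenvalue_eq hM ht₀ hD₀ (ht i) hm, h0 k m n hk, eigenvalue_eq hM ht₀ hD₀ (ht j) hn,
    e2] at e1
  exact zero_ne_one e1

/-- Gluing when the remaining elements are connected. -/
lemma glue_of_connected [Finite E] (hf : IsLift f) (hneg : f (-1) = -1)
    (hφ : SameZero φ φ₃ univ) (hxy : x ≠ y) {t₀ : ι → E} (ht₀ : Avoids t₀ x y)
    (hD₀ : D φ t₀ ≠ 0) (h₁ : ∃ φ' : E → ι → K, Good f φ φ' {x}ᶜ)
    (h₂ : ∃ φ' : E → ι → K, Good f φ φ' {y}ᶜ)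
    (h : ∀ i j, ∃ k, Walk φ t₀ {e | e ≠ x ∧ e ≠ y} k i j) :
    ∃ φ' : E → ι → K, Good f φ φ' univ :=
  glue hf hneg hφ hxy ht₀ hD₀ h₁ h₂ fun _ ht hD i j _ _ _ _ =>
    connected_of_connected (X := {e | e ≠ x ∧ e ≠ y}) (fun l => ht₀ l) hD₀ h
      (fun l => ht l) hD i j

/-- Gluing when a set of rows separates `x` and `y`. -/
lemma glue_of_separated [Finite E] (hf : IsLift f) (hneg : f (-1) = -1)
    (hφ : SameZero φ φ₃ univ) {t₀ : ι → E} (ht₀ : Avoids t₀ x y)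
    (hD₀ : D φ t₀ ≠ 0) (h₁ : ∃ φ' : E → ι → K, Good f φ φ' {x}ᶜ)
    (h₂ : ∃ φ' : E → ι → K, Good f φ φ' {y}ᶜ) {Z : Set ι}
    (hZ : ∀ e i j, co φ t₀ e i ≠ 0 → co φ t₀ e j ≠ 0 → (i ∈ Z ↔ j ∈ Z)) {i j : ι} (hi : i ∈ Z)
    (hj : j ∉ Z) (hxi : co φ t₀ x i ≠ 0) (hyj : co φ t₀ y j ≠ 0) :
    ∃ φ' : E → ι → K, Good f φ φ' univ := by
  have hxy : x ≠ y := by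
    rintro rfl; exact hj ((hZ x i j hxi hyj).mp hi)
  obtain ⟨M, ε, hM, hε⟩ := exists_eigen (X := univ) (fun _ => mem_univ _) hD₀ fun e _ => hZ e
  have e1 := eigenvalue_eq hM (fun _ => mem_univ _) hD₀ (mem_univ x) hxi
  have e2 := eigenvalue_eq hM (fun _ => mem_univ _) hD₀ (mem_univ y) hyj
  rw [(hε i).1 hi] at e1
  rw [(hε j).2 hj] at e2
  refine glue hf hneg hφ hxy ht₀ hD₀ h₁ h₂ fun t _ hD l m hl _ hl' _ => ?_
  have e3 := eigenvalue_eq hM (fun _ => mem_univ _) hD (mem_univ x) hl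
  have e4 := eigenvalue_eq hM (fun _ => mem_univ _) hD (mem_univ y) hl'
  rw [e3, ← e1, ← e2] at e4
  exact absurd e4 one_ne_zero

end Glue

section Dual

variable {F K : Type*} [Field F] [Field K] {ι κ : Type*} [Fintype ι] [DecidableEq ι] [Fintype κ]
  [DecidableEq κ] {E : Type*} [Fintype E] {f : F → K} {φ : E → ι → F} {ψ : E → κ → F}
  {t : ι → E} {s : κ → E}

/-- The elements listed by `t` and `s` partition the ground set. -/
def Compl (t : ι → E) (s : κ → E) : Prop := Function.Bijective (Sum.elim t s)

lemma Compl.symm (h : Compl t s) : Compl s t := by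
  have : Sum.elim s t = Sum.elim t s ∘ Sum.swap := by
    funext x; cases x <;> rfl
  rw [Compl, this]
  exact h.comp (Equiv.sumComm κ ι).bijective

lemma Compl.sum_eq {M : Type*} [AddCommMonoid M] (h : Compl t s) (g : E → M) :
    ∑ e, g e = ∑ i, g (t i) + ∑ k, g (s k) := by
  rw [← (Equiv.ofBijective _ h).sum_comp g, Fintype.sum_sum_type]
  rfl

lemma Compl.ne (h : Compl t s) (i : ι) (k : κ) : t i ≠ s k := fun heq => by
  have := h.1 (a₁ := Sum.inl i) (a₂ := Sum.inr k) heq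
  simp at this

lemma Compl.cases (h : Compl t s) (e : E) : (∃ i, e = t i) ∨ ∃ k, e = s k := by
  obtain ⟨i | k, rfl⟩ := h.2 e
  exacts [Or.inl ⟨i, rfl⟩, Or.inr ⟨k, rfl⟩]

lemma Compl.exists_of_injective (h : Compl t s) {t' : ι → E} (ht' : Function.Injective t') :
    ∃ s' : κ → E, Compl t' s' := by
  classical
  have h1 : Fintype.card E = Fintype.card ι + Fintype.card κ := by
    rw [← Fintype.card_sum]
    exact (Fintype.card_of_bijective h).symm
  have h2 : Fintype.card {e // e ∉ range t'} = Fintype.card κ := by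
    have := Fintype.card_subtype_compl (fun e => e ∈ range t')
    have h3 : Fintype.card {e // e ∈ range t'} = Fintype.card ι :=
      (Fintype.card_congr (Equiv.ofInjective t' ht')).symm
    omega
  set g := Fintype.equivOfCardEq h2.symm
  refine ⟨fun k => g k, ?_, fun e => ?_⟩
  · rintro (i | k) (j | l) hij
    · exact congrArg _ (ht' hij)
    · exact absurd ⟨i, hij⟩ (g l).2
    · exact absurd ⟨j, hij.symm⟩ (g k).2
    · exact congrArg _ (g.injective (Subtype.ext hij))
  · by_cases he : e ∈ range t'
    · obtain ⟨i, rfl⟩ := he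
      exact ⟨Sum.inl i, rfl⟩
    · exact ⟨Sum.inr (g.symm ⟨e, he⟩), by simp⟩

/-- The configurations `φ` and `ψ` are dual to each other. -/
structure IsDual (φ : E → ι → F) (ψ : E → κ → F) : Prop where
  orth : ∀ i k, ∑ e, φ e i * ψ e k = 0
  left : ∃ t, D φ t ≠ 0
  right : ∃ s, D ψ s ≠ 0

lemma IsDual.symm (h : IsDual φ ψ) : IsDual ψ φ :=
  ⟨fun k i => by simpa only [mul_comm] using h.orth i k, h.right, h.left⟩

lemma IsDual.eq_sum (h : IsDual φ ψ) (hts : Compl t s) (ht : D φ t ≠ 0) (i : ι) :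
    ψ (t i) = ∑ k, (- co φ t (s k) i) • ψ (s k) := by
  obtain ⟨M, hM⟩ := exists_vecMul ht fun j => Pi.single j (1 : F)
  have hco : ∀ e, co φ t e i = ∑ j, φ e j * M j i := fun e => by
    have := congrFun (hM e) i
    rw [Finset.sum_apply] at this
    simp only [Pi.smul_apply, Pi.single_apply, smul_eq_mul, mul_ite, mul_one, mul_zero,
      Finset.sum_ite_eq, Finset.mem_univ, if_true] at this
    rw [← this]
    rfl
  funext k
  have h0 : ∑ e, co φ t e i * ψ e k = 0 := by
    simp only [hco, Finset.sum_mul]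
    rw [Finset.sum_comm]
    refine Finset.sum_eq_zero fun j _ => ?_
    have := congrArg (· * M j i) (h.orth j k)
    simp only [zero_mul, Finset.sum_mul] at this
    rw [← this]
    exact Finset.sum_congr rfl fun e _ => by ring
  rw [hts.sum_eq] at h0
  simp only [co_self φ ht, ite_mul, one_mul, zero_mul, Finset.sum_ite_eq, Finset.mem_univ,
    if_true] at h0
  rw [Finset.sum_apply]
  simp only [Pi.smul_apply, smul_eq_mul, neg_mul, Finset.sum_neg_distrib]
  exact eq_neg_of_add_eq_zero_left h0

lemma IsDual.D_ne_zero (h : IsDual φ ψ) (hts : Compl t s) (ht : D φ t ≠ 0) : D ψ s ≠ 0 := by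
  obtain ⟨s₀, hs₀⟩ := h.right
  intro hs
  have key : ∀ e, ∃ c : κ → F, ψ e = ∑ k, c k • ψ (s k) := fun e => by
    rcases hts.cases e with ⟨i, rfl⟩ | ⟨k, rfl⟩
    · exact ⟨_, h.eq_sum hts ht i⟩
    · exact ⟨Pi.single k 1, by simp [Pi.single_apply, ite_smul]⟩
  choose c hc using key
  have : (Matrix.of fun k => ψ (s₀ k))
      = (Matrix.of fun k => c (s₀ k)) * Matrix.of fun k => ψ (s k) := by
    ext k l
    simp only [Matrix.mul_apply, Matrix.of_apply]
    rw [hc (s₀ k), Finset.sum_apply]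
    rfl
  apply hs₀
  rw [D_eq_det, this, Matrix.det_mul, ← D_eq_det ψ s, hs, mul_zero]

lemma IsDual.D_eq_zero_iff (h : IsDual φ ψ) (hts : Compl t s) : D φ t = 0 ↔ D ψ s = 0 :=
  not_iff_not.mp ⟨h.D_ne_zero hts, h.symm.D_ne_zero hts.symm⟩

lemma IsDual.co_eq (h : IsDual φ ψ) (hts : Compl t s) (ht : D φ t ≠ 0) (i : ι) (k : κ) :
    co ψ s (t i) k = - co φ t (s k) i :=
  (congrFun (co_unique ψ (h.D_ne_zero hts ht) _ _ (h.eq_sum hts ht i)) k).symm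

lemma exists_isDual (hts : Compl t s) (ht : D φ t ≠ 0) : ∃ ψ : E → κ → F, IsDual φ ψ := by
  classical
  set ψ : E → κ → F := fun e k =>
    (if e = s k then 1 else 0) - ∑ i, if e = t i then co φ t (s k) i else 0 with hψ
  have h1 : ∀ k l, ψ (s k) l = if k = l then 1 else 0 := fun k l => by
    have h2 : s k = s l ↔ k = l :=
      ⟨fun h => Sum.inr_injective (hts.1 (a₁ := Sum.inr k) (a₂ := Sum.inr l) h), congrArg s⟩
    have h3 : ∀ i, s k ≠ t i := fun i => (hts.ne i k).symm
    simp only [hψ, h2, h3, if_false, Finset.sum_const_zero, sub_zero]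
  have h4 : ∀ i l, ψ (t i) l = - co φ t (s l) i := fun i l => by
    have h2 : ∀ j, t i = t j ↔ i = j := fun j =>
      ⟨fun h => injective_of_D_ne_zero ht h, congrArg t⟩
    simp [hψ, h2, hts.ne i l]
  refine ⟨ψ, fun j k => ?_, ⟨t, ht⟩, ⟨s, ?_⟩⟩
  · rw [hts.sum_eq]
    have := congrFun (sum_co φ ht (s k)) j
    rw [Finset.sum_apply] at this
    simp only [h1, h4, mul_ite, mul_one, mul_zero, Finset.sum_ite_eq', Finset.mem_univ, if_true,
      mul_neg, Finset.sum_neg_distrib, this, Pi.smul_apply, smul_eq_mul]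
    simp only [mul_comm, neg_add_cancel]
  · have : (Matrix.of fun k => ψ (s k)) = 1 := by
      ext k l
      simp [h1, Matrix.one_apply]
    rw [D_eq_det, this, Matrix.det_one]
    exact one_ne_zero

lemma SameZero.dual {φ' : E → ι → K} {ψ' : E → κ → K} (h : SameZero φ φ' univ)
    (hφ : IsDual φ ψ) (hφ' : IsDual φ' ψ') (hts : Compl t s) : SameZero ψ ψ' univ := by
  intro s' _
  by_cases hs : Function.Injective s'
  · obtain ⟨t', ht'⟩ := hts.symm.exists_of_injective hs
    rw [← hφ.D_eq_zero_iff ht'.symm, ← hφ'.D_eq_zero_iff ht'.symm]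
    exact h t' fun _ => mem_univ _
  · have e1 : D ψ s' = 0 := by
      by_contra hc; exact hs (injective_of_D_ne_zero hc)
    have e2 : D ψ' s' = 0 := by
      by_contra hc; exact hs (injective_of_D_ne_zero hc)
    rw [e1, e2]
    simp

lemma Good.dual (hf : IsLift f) {φ' : E → ι → K} {ψ' : E → κ → K} (h : Good f φ φ' univ)
    (hφ : IsDual φ ψ) (hφ' : IsDual φ' ψ') (hts : Compl t s) : Good f ψ ψ' univ := by
  refine ⟨h.zero.dual hφ hφ' hts, fun s' _ hs k l hkl c _ d _ h1 h2 h3 h4 => ?_⟩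
  obtain ⟨t', ht'⟩ := hts.symm.exists_of_injective (injective_of_D_ne_zero hs)
  replace ht' := ht'.symm
  have hD : D φ t' ≠ 0 := hφ.symm.D_ne_zero ht'.symm hs
  have hD' : D φ' t' ≠ 0 := fun h' => hD ((h.zero t' fun _ => mem_univ _).mpr h')
  have key : ∀ e, co ψ s' e k ≠ 0 → co ψ s' e l ≠ 0 → ∃ i, e = t' i := fun e he he' => by
    rcases ht'.cases e with h | ⟨m, rfl⟩
    · exact h
    · rw [co_self ψ hs] at he he'
      have hk : k = m := by
        by_contra hne; simp [hne] at he
      have hl : l = m := by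
        by_contra hne; simp [hne] at he'
      exact absurd (hk.trans hl.symm) hkl
  obtain ⟨i, rfl⟩ := key c h1 h2
  obtain ⟨j, rfl⟩ := key d h3 h4
  simp only [hφ.co_eq ht' hD, hφ'.co_eq ht' hD', neg_mul_neg, neg_ne_zero] at h1 h2 h3 h4 ⊢
  by_cases hij : i = j
  · subst hij
    have hz : ∀ m, co φ t' (s' m) i ≠ 0 → co φ' t' (s' m) i ≠ 0 := fun m hm hc =>
      hm ((h.zero.co (fun _ => mem_univ _) hD (mem_univ _) i).mpr hc)
    have := hz _ h1
    have := hz _ h2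
    rw [div_self (by positivity), div_self (by positivity), hf.one]
  · have := h.blk t' (fun _ => mem_univ _) hD i j hij (s' k) (mem_univ _) (s' l) (mem_univ _)
      h1 h3 h2 h4
    rw [mul_comm (co φ t' (s' k) j), mul_comm (co φ' t' (s' k) j), this]

/-- A configuration has a lift if a dual of it has one. -/
lemma exists_good_of_dual (hf : IsLift f) (hφ : IsDual φ ψ) (hts : Compl t s) (ht : D φ t ≠ 0)
    (h : ∃ ψ' : E → κ → K, Good f ψ ψ' univ) : ∃ φ' : E → ι → K, Good f φ φ' univ := by
  obtain ⟨ψ', h⟩ := h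
  have hs := hφ.D_ne_zero hts ht
  have hs' : D ψ' s ≠ 0 := fun h' => hs ((h.zero s fun _ => mem_univ _).mpr h')
  obtain ⟨φ', hφ'⟩ := exists_isDual hts.symm hs'
  exact ⟨φ', h.dual hf hφ.symm hφ' hts.symm⟩

end Dual

section Two

variable {F K : Type*} [Field F] [Field K] {ι : Type*} [Fintype ι] [DecidableEq ι] {E : Type*}
  {f : F → K} {φ : E → ι → F} {φ₃ : E → ι → ZMod 3} {x y : E}

lemma co_perm (φ : E → ι → F) (t : ι → E) (σ : Equiv.Perm ι) (e : E) (i : ι) :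
    co φ (t ∘ σ) e i = co φ t e (σ i) := by
  have : Function.update (t ∘ σ) i e = Function.update t (σ i) e ∘ σ := by
    rw [Function.update_comp_equiv, Equiv.symm_apply_apply]
  rw [co, co, this, D_perm, D_perm]
  rcases Int.units_eq_one_or (Equiv.Perm.sign σ) with h | h <;> simp [h, neg_div_neg_eq]

/-- Gluing for four elements of rank two. -/
lemma glue_of_two (hf : IsLift f) (hφ : SameZero φ φ₃ univ) (hxy : x ≠ y) {t : ι → E}
    (ht : Avoids t x y) (hD : D φ t ≠ 0) (h₁ : ∃ φ' : E → ι → K, Good f φ φ' {x}ᶜ)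
    (h₂ : ∃ φ' : E → ι → K, Good f φ φ' {y}ᶜ) {i j : ι} (hij : i ≠ j)
    (hι : ∀ l, l = i ∨ l = j) (hE : ∀ e, e = x ∨ e = y ∨ e ∈ range t)
    (hx : ∀ l, co φ t x l ≠ 0) (hy : ∀ l, co φ t y l ≠ 0) :
    ∃ φ' : E → ι → K, Good f φ φ' univ := by
  classical
  obtain ⟨φ₁, h₁⟩ := h₁
  obtain ⟨φ₂, h₂⟩ := h₂
  have htx : ∀ l, t l ∈ ({x}ᶜ : Set E) := fun l => (ht l).1
  have hty : ∀ l, t l ∈ ({y}ᶜ : Set E) := fun l => (ht l).2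
  have hD₁ : D φ₁ t ≠ 0 := fun h => hD ((h₁.zero t htx).mpr h)
  have hD₂ : D φ₂ t ≠ 0 := fun h => hD ((h₂.zero t hty).mpr h)
  have hx₂ : ∀ l, co φ₂ t x l ≠ 0 := fun l h => hx l ((h₂.zero.co hty hD hxy l).mpr h)
  have hy₁ : ∀ l, co φ₁ t y l ≠ 0 := fun l h => hy l ((h₁.zero.co htx hD hxy.symm l).mpr h)
  set r := f (co φ t x i * co φ t y j / (co φ t y i * co φ t x j)) with hr
  have hr0 : r ≠ 0 := fun h => by
    have := hf.eq_zero _ h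
    have h1 := hx i
    have h2 := hx j
    have h3 := hy i
    have h4 := hy j
    revert this
    positivity
  set b : ι → K := fun l => if l = i then r * co φ₁ t y i / co φ₁ t y j else 1 with hb
  have hb0 : ∀ l, b l ≠ 0 := fun l => by
    have h1 := hy₁ i
    have h2 := hy₁ j
    simp only [hb]
    split_ifs
    · positivity
    · exact one_ne_zero
  set a : ι → K := fun l => b l / co φ₂ t x l with ha
  have ha0 : ∀ l, a l ≠ 0 := fun l => div_ne_zero (hb0 l) (hx₂ l)
  obtain ⟨M, hM⟩ := exists_vecMul hD₂ fun l => a l • φ₁ (t l)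
  have hMt : ∀ l, Matrix.vecMul (φ₂ (t l)) M = a l • φ₁ (t l) := fun l => by
    rw [hM]
    simp [co_self φ₂ hD₂]
  have hMx : Matrix.vecMul (φ₂ x) M = ∑ l, b l • φ₁ (t l) := by
    rw [hM]
    refine Finset.sum_congr rfl fun l _ => ?_
    rw [smul_smul, ha, mul_div_cancel₀ _ (hx₂ l)]
  have hinj := injective_of_D_ne_zero hD
  set s : E → K := fun e => if h : ∃ l, e = t l then (a h.choose)⁻¹ else 1 with hs
  have hst : ∀ l, s (t l) = (a l)⁻¹ := fun l => by
    have h : ∃ m, t l = t m := ⟨l, rfl⟩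
    simp only [hs, dif_pos h]
    rw [← hinj h.choose_spec]
  have hsx : s x = 1 := by
    have : ¬ ∃ l, x = t l := fun ⟨l, hl⟩ => (ht l).1 hl.symm
    simp only [hs, dif_neg this]
  have hs0 : ∀ e, s e ≠ 0 := fun e => by
    simp only [hs]
    split_ifs with h
    exacts [inv_ne_zero (ha0 _), one_ne_zero]
  have hsM : ∀ l, s (t l) • Matrix.vecMul (φ₂ (t l)) M = φ₁ (t l) := fun l => by
    rw [hMt, hst, smul_smul, inv_mul_cancel₀ (ha0 l), one_smul]
  have hdet : M.det ≠ 0 := fun h => by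
    apply hD₁
    have := D_scale φ₂ s M t
    rw [h, mul_zero, zero_mul] at this
    rw [← this]
    exact congrArg Matrix.detRowAlternating (funext fun l => (hsM l).symm)
  set φ' : E → ι → K := fun e => if e = x then ∑ l, b l • φ₁ (t l) else φ₁ e with hφ'
  have left : Good f φ φ' {x}ᶜ := h₁.congr fun e he => by
    simp only [hφ', if_neg (mem_compl_singleton_iff.mp he)]
  have right : Good f φ φ' {y}ᶜ := (h₂.scale hs0 hdet).congr fun e he => by
    rcases hE e with rfl | rfl | ⟨l, rfl⟩
    · simp only [hφ', if_true, hsx, one_smul, hMx]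
    · exact absurd rfl he
    · simp only [hφ', if_neg (ht l).1, hsM]
  have hD' : D φ' t ≠ 0 := fun h => hD ((left.zero t htx).mpr h)
  have hcx : ∀ l, co φ' t x l = b l := fun l => by
    refine (congrFun (co_unique φ' hD' x b ?_) l).symm
    simp only [hφ', if_true]
    exact Finset.sum_congr rfl fun m _ => by rw [if_neg (ht m).1]
  have hcy : ∀ l, co φ' t y l = co φ₁ t y l := fun l => by
    refine co_congr (X := {x}ᶜ) (fun e he => ?_) htx hxy.symm l
    simp only [hφ', if_neg (mem_compl_singleton_iff.mp he)]
  have blk : Blk f φ φ' t i j x y := fun _ _ _ _ => by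
    have h1 := hy₁ i
    have h2 := hy₁ j
    rw [← hr, hcx, hcx, hcy, hcy]
    simp only [hb, if_true, if_neg hij.symm]
    field_simp
  have blk' : ∀ k l, k ≠ l → Blk f φ φ' t k l x y := fun k l hkl => by
    rcases hι k with rfl | rfl <;> rcases hι l with rfl | rfl
    exacts [absurd rfl hkl, blk, blk.swap_rows hf, absurd rfl hkl]
  refine ⟨φ', GlueData.good (x := x) (y := y) (t₀ := t) (φ₃ := φ₃)
    ⟨hf, hφ, hxy, left, right, hD, ht, fun t' ht' hDt' k l hkl => ?_⟩⟩
  have hσ : ∀ m, ∃ n, t n = t' m := fun m => by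
    rcases hE (t' m) with h | h | ⟨n, hn⟩
    exacts [absurd h (ht' m).1, absurd h (ht' m).2, ⟨n, hn⟩]
  choose g hg using hσ
  have hgi : Function.Injective g := fun m n hmn =>
    injective_of_D_ne_zero hDt' (by rw [← hg, ← hg, hmn])
  set σ : Equiv.Perm ι := Equiv.ofBijective g (Finite.injective_iff_bijective.mp hgi)
  obtain rfl : t' = t ∘ σ := funext fun m => (hg m).symm
  have := blk' (σ k) (σ l) (σ.injective.ne hkl)
  unfold Blk at this ⊢
  simpa only [co_perm] using this

end Two

section Leaves

/-- Removing two leaves of a breadth-first search tree does not disconnect a graph. -/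
lemma exists_leaves {V : Type*} [Finite V] {G : SimpleGraph V} (hG : G.Connected) {v : V}
    {n : Fin 3 → V} (hn : Function.Injective n) (hv : ∀ i, G.Adj v (n i)) :
    ∃ l : Fin 3 → V, Function.Injective l ∧ ∀ i j, ∀ S : Set V,
      (∀ u ∈ S, ∀ w, G.Adj u w → w ≠ l i → w ≠ l j → w ∈ S) →
      (∃ u ∈ S, u ≠ l i ∧ u ≠ l j) → ∀ u, u ≠ l i → u ≠ l j → u ∈ S := by
  classical
  have hp : ∀ u, ∃ p, u ≠ v → G.Adj p u ∧ G.dist v u = G.dist v p + 1 := by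
    intro u
    by_cases hu : u = v
    · exact ⟨v, fun h => absurd hu h⟩
    obtain ⟨p, hp⟩ := hG.exists_walk_length_eq_dist u v
    cases p with
    | nil => exact absurd rfl hu
    | @cons _ w _ h q =>
      refine ⟨w, fun _ => ⟨h.symm, ?_⟩⟩
      rw [SimpleGraph.Walk.length_cons] at hp
      have h1 := G.dist_le q
      have h2 := hG.dist_triangle (u := u) (v := w) (w := v)
      have h3 : G.dist u w = 1 := SimpleGraph.dist_eq_one_iff_adj.mpr h
      rw [G.dist_comm (u := v) (v := u), G.dist_comm (u := v) (v := w)]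
      omega
  choose p hp using hp
  set anc : V → V := fun u => p^[G.dist v u - 1] u with hanc
  have anc_p : ∀ u, 2 ≤ G.dist v u → anc (p u) = anc u := fun u hu => by
    have huv : u ≠ v := by rintro rfl; simp at hu
    have h1 := (hp u huv).2
    simp only [hanc]
    obtain ⟨k, hk⟩ : ∃ k, G.dist v u = k + 2 := ⟨_, (Nat.sub_add_cancel hu).symm⟩
    have h2 : G.dist v (p u) = k + 1 := by omega
    rw [hk, h2]
    simp [Function.iterate_succ_apply]
  have hdn : ∀ i, G.dist v (n i) = 1 := fun i => SimpleGraph.dist_eq_one_iff_adj.mpr (hv i)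
  have anc_n : ∀ i, anc (n i) = n i := fun i => by simp [hanc, hdn]
  have hl : ∀ i, ∃ l, (anc l = n i ∧ 1 ≤ G.dist v l) ∧
      ∀ w, anc w = n i ∧ 1 ≤ G.dist v w → G.dist v w ≤ G.dist v l := fun i => by
    obtain ⟨l, hl, hl'⟩ := Set.exists_max_image {w | anc w = n i ∧ 1 ≤ G.dist v w} (G.dist v)
      (toFinite _) ⟨n i, anc_n i, (hdn i).ge⟩
    exact ⟨l, hl, hl'⟩
  choose l hl hl' using hl
  have leaf : ∀ i w, w ≠ v → p w ≠ l i := fun i w hw h => by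
    have h1 := (hp w hw).2
    have h2 := (hl i).2
    rw [h] at h1
    have h3 := anc_p w (by omega)
    rw [h, (hl i).1] at h3
    have := hl' i w ⟨h3.symm, by omega⟩
    omega
  refine ⟨l, fun i j hij => hn ?_, fun i j S hS hne => ?_⟩
  · rw [← (hl i).1, ← (hl j).1, hij]
  · have hvl : ∀ i, v ≠ l i := fun i h => by
      have := (hl i).2
      rw [← h, SimpleGraph.dist_self] at this
      omega
    have key : ∀ S : Set V, v ∈ S → (∀ u ∈ S, ∀ w, G.Adj u w → w ≠ l i → w ≠ l j → w ∈ S) →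
        ∀ k u, G.dist v u = k → u ≠ l i → u ≠ l j → u ∈ S := by
      intro S hvS hS k
      induction k with
      | zero =>
        intro u hu _ _
        rw [hG.dist_eq_zero_iff] at hu
        rwa [← hu]
      | succ k ih =>
        intro u hu h1 h2
        have huv : u ≠ v := by rintro rfl; simp at hu
        obtain ⟨h3, h4⟩ := hp u huv
        exact hS _ (ih (p u) (by omega) (leaf i u huv) (leaf j u huv)) u h3 h1 h2
    by_cases hvS : v ∈ S
    · exact fun u => key S hvS hS _ u rfl
    · obtain ⟨u, hu, hui, huj⟩ := hne
      refine absurd hu (key {w | w ∉ S ∧ w ≠ l i ∧ w ≠ l j} ⟨hvS, hvl i, hvl j⟩ ?_ _ u rfl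
        hui huj).1
      exact fun a ha b hab hbi hbj => ⟨fun hb => ha.1 (hS b hb a hab.symm ha.2.1 ha.2.2), hbi, hbj⟩

end Leaves

section Minimal

variable {F K : Type*} [Field F] [Field K] {ι κ : Type*} [Fintype ι] [DecidableEq ι] [Fintype κ]
  [DecidableEq κ] {E : Type*} [Fintype E] {f : F → K} {φ : E → ι → F} {ψ : E → κ → F}
  {φ₃ : E → ι → ZMod 3} {ψ₃ : E → κ → ZMod 3} {t : ι → E} {s : κ → E}

/-- The deletions of a configuration and of a dual of it have lifts. -/
structure Minimal (f : F → K) (φ : E → ι → F) (ψ : E → κ → F) (φ₃ : E → ι → ZMod 3)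
    (ψ₃ : E → κ → ZMod 3) : Prop where
  lift : IsLift f
  neg : f (-1) = -1
  dual : IsDual φ ψ
  left_tern : SameZero φ φ₃ univ
  right_tern : SameZero ψ ψ₃ univ
  left : ∀ x, (∃ t, D φ t ≠ 0 ∧ ∀ i, t i ≠ x) → ∃ φ' : E → ι → K, Good f φ φ' {x}ᶜ
  right : ∀ x, (∃ s, D ψ s ≠ 0 ∧ ∀ k, s k ≠ x) → ∃ ψ' : E → κ → K, Good f ψ ψ' {x}ᶜ

lemma Minimal.symm (h : Minimal f φ ψ φ₃ ψ₃) : Minimal f ψ φ ψ₃ φ₃ :=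
  ⟨h.lift, h.neg, h.dual.symm, h.right_tern, h.left_tern, h.right, h.left⟩

lemma Minimal.of_dual (h : Minimal f φ ψ φ₃ ψ₃) (hts : Compl t s) (ht : D φ t ≠ 0)
    (h' : ∃ ψ' : E → κ → K, Good f ψ ψ' univ) : ∃ φ' : E → ι → K, Good f φ φ' univ :=
  exists_good_of_dual h.lift h.dual hts ht h'

lemma Minimal.of_col (h : Minimal f φ ψ φ₃ ψ₃) (hts : Compl t s) (ht : D φ t ≠ 0) (k : κ)
    (hk : ∀ i j, co φ t (s k) i ≠ 0 → co φ t (s k) j ≠ 0 → i = j) :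
    ∃ φ' : E → ι → K, Good f φ φ' univ := by
  obtain ⟨φ', hφ'⟩ := h.left (s k) ⟨t, ht, fun i => hts.ne i k⟩
  by_cases h0 : ∃ i, co φ t (s k) i ≠ 0
  · obtain ⟨i, hi⟩ := h0
    refine hφ'.extend_parallel (hts.ne i k) hi ?_
    rw [sum_co φ ht (s k)]
    refine Finset.sum_eq_single i (fun j _ hj => ?_) fun h => absurd (Finset.mem_univ i) h
    have : co φ t (s k) j = 0 := by
      by_contra hc; exact hj (hk _ _ hc hi)
    rw [this, zero_smul]
  · push Not at h0
    refine hφ'.extend_zero (x := s k) ?_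
    rw [sum_co φ ht (s k)]
    simp [h0]

lemma Minimal.of_row (h : Minimal f φ ψ φ₃ ψ₃) (hts : Compl t s) (ht : D φ t ≠ 0) (i : ι)
    (hi : ∀ k l, co φ t (s k) i ≠ 0 → co φ t (s l) i ≠ 0 → k = l) :
    ∃ φ' : E → ι → K, Good f φ φ' univ := by
  refine h.of_dual hts ht (h.symm.of_col hts.symm (h.dual.D_ne_zero hts ht) i ?_)
  simpa only [h.dual.co_eq hts ht, neg_ne_zero] using hi

lemma Minimal.of_separated (h : Minimal f φ ψ φ₃ ψ₃) (hts : Compl t s) (ht : D φ t ≠ 0)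
    {Z : Set ι} (hZ : ∀ k i j, co φ t (s k) i ≠ 0 → co φ t (s k) j ≠ 0 → i ∈ Z → j ∈ Z) {i j : ι}
    (hi : i ∈ Z) (hj : j ∉ Z) : ∃ φ' : E → ι → K, Good f φ φ' univ := by
  by_cases hi0 : ∃ k, co φ t (s k) i ≠ 0
  swap
  · push Not at hi0
    exact h.of_row hts ht i fun k _ hk => absurd (hi0 k) hk
  by_cases hj0 : ∃ k, co φ t (s k) j ≠ 0
  swap
  · push Not at hj0
    exact h.of_row hts ht j fun k _ hk => absurd (hj0 k) hk
  obtain ⟨k, hk⟩ := hi0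
  obtain ⟨l, hl⟩ := hj0
  refine glue_of_separated h.lift h.neg h.left_tern (x := s k) (y := s l)
    (fun m => ⟨hts.ne m k, hts.ne m l⟩) ht (h.left _ ⟨t, ht, fun m => hts.ne m k⟩)
    (h.left _ ⟨t, ht, fun m => hts.ne m l⟩) (fun e a b ha hb => ?_) hi hj hk hl
  rcases hts.cases e with ⟨m, rfl⟩ | ⟨m, rfl⟩
  · rw [co_self φ ht] at ha hb
    have e1 : a = m := by
      by_contra hne; simp [hne] at ha
    have e2 : b = m := by
      by_contra hne; simp [hne] at hb
    rw [e1, e2]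
  · exact ⟨hZ m a b ha hb, hZ m b a hb ha⟩

/-- The rows of the coordinate matrix stay connected after the removal of two columns. -/
def RowConnected (φ : E → ι → F) (t : ι → E) (s : κ → E) (k l : κ) : Prop :=
  ∀ Z : Set ι, (∀ c, c ≠ k → c ≠ l → ∀ i j, co φ t (s c) i ≠ 0 → co φ t (s c) j ≠ 0 →
    i ∈ Z → j ∈ Z) → Z.Nonempty → ∀ i, i ∈ Z

lemma Minimal.of_rowConnected (h : Minimal f φ ψ φ₃ ψ₃) (hts : Compl t s) (ht : D φ t ≠ 0)
    {k l : κ} (hkl : k ≠ l) (hc : RowConnected φ t s k l) :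
    ∃ φ' : E → ι → K, Good f φ φ' univ := by
  have hinj : ∀ {c d : κ}, c ≠ d → s c ≠ s d := fun hcd h' =>
    hcd (Sum.inr_injective (hts.1 (a₁ := Sum.inr _) (a₂ := Sum.inr _) h'))
  refine glue_of_connected h.lift h.neg h.left_tern (x := s k) (y := s l) (hinj hkl)
    (fun m => ⟨hts.ne m k, hts.ne m l⟩) ht (h.left _ ⟨t, ht, fun m => hts.ne m k⟩)
    (h.left _ ⟨t, ht, fun m => hts.ne m l⟩) fun i j => ?_
  have key := hc {j | ∃ n, Walk φ t {e | e ≠ s k ∧ e ≠ s l} n i j}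
  refine key ?_ ⟨i, 0, rfl⟩ j
  rintro c hck hcl a b ha hb ⟨n, hn⟩
  have hmem : s c ∈ {e | e ≠ s k ∧ e ≠ s l} := ⟨hinj hck, hinj hcl⟩
  exact ⟨_, hn.trans (Walk.single hmem ha hb)⟩

/-- The bipartite graph of the nonzero entries of the coordinate matrix. -/
def bipGraph (φ : E → ι → F) (t : ι → E) (s : κ → E) : SimpleGraph (ι ⊕ κ) where
  Adj
    | Sum.inl i, Sum.inr k => co φ t (s k) i ≠ 0
    | Sum.inr k, Sum.inl i => co φ t (s k) i ≠ 0
    | _, _ => False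
  symm := ⟨by rintro (i | k) (j | l) h <;> exact h⟩
  loopless := ⟨by rintro (i | k) h <;> exact h⟩

lemma Minimal.of_three (h : Minimal f φ ψ φ₃ ψ₃) (hts : Compl t s) (ht : D φ t ≠ 0) {i : ι}
    {n : Fin 3 → κ} (hn : Function.Injective n) (hi : ∀ a, co φ t (s (n a)) i ≠ 0) :
    ∃ φ' : E → ι → K, Good f φ φ' univ := by
  set G := bipGraph φ t s with hG
  by_cases hr : ∀ j, G.Reachable (Sum.inl i) (Sum.inl j)
  swap
  · push Not at hr
    obtain ⟨j, hj⟩ := hr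
    refine h.of_separated hts ht (Z := {j | G.Reachable (Sum.inl i) (Sum.inl j)})
      (fun k a b ha hb hZ => ?_) (SimpleGraph.Reachable.refl _) hj
    have h1 : G.Adj (Sum.inl a) (Sum.inr k) := ha
    have h2 : G.Adj (Sum.inr k) (Sum.inl b) := hb
    exact (hZ.trans h1.reachable).trans h2.reachable
  by_cases hcol : ∀ k, ∃ j, co φ t (s k) j ≠ 0
  swap
  · push Not at hcol
    obtain ⟨k, hk⟩ := hcol
    exact h.of_col hts ht k fun a _ ha => absurd (hk a) ha
  have hconn : G.Connected := by
    have : ∀ u, G.Reachable (Sum.inl i) u := by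
      rintro (j | k)
      · exact hr j
      · obtain ⟨j, hj⟩ := hcol k
        have h1 : G.Adj (Sum.inl j) (Sum.inr k) := hj
        exact (hr j).trans h1.reachable
    exact { preconnected := fun u w => (this u).symm.trans (this w), nonempty := ⟨Sum.inl i⟩ }
  obtain ⟨l, hl, hl'⟩ := exists_leaves hconn (v := Sum.inl i) (n := fun a => Sum.inr (n a))
    (fun a b hab => hn (Sum.inr_injective hab)) hi
  obtain ⟨a, b, hab, heq⟩ := Fintype.exists_ne_map_eq_of_card_lt (fun a => (l a).isLeft) (by simp)
  have hab' := hl.ne hab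
  have := hl' a b
  rcases ha : l a with r | k <;> rcases hb : l b with r' | k' <;> rw [ha, hb] at hab' heq this
  · refine h.of_dual hts ht (h.symm.of_rowConnected hts.symm (h.dual.D_ne_zero hts ht) (k := r)
      (l := r') (fun h => hab' (congrArg _ h)) fun Z hZ ⟨k₀, hk₀⟩ k => ?_)
    simp only [h.dual.co_eq hts ht, neg_ne_zero] at hZ
    have := this {u | Sum.elim (fun c => c ≠ r ∧ c ≠ r' ∧ ∃ m ∈ Z, co φ t (s m) c ≠ 0)
      (fun m => m ∈ Z) u} ?_ ⟨Sum.inr k₀, hk₀, by simp, by simp⟩ (Sum.inr k) (by simp) (by simp)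
    · exact this
    · rintro (c | m) hu (d | m') huw h1 h2
      · exact huw.elim
      · obtain ⟨hc1, hc2, m, hm, hm'⟩ := hu
        exact hZ c hc1 hc2 m m' hm' huw hm
      · exact ⟨fun h => h1 (congrArg _ h), fun h => h2 (congrArg _ h), m, hu, huw⟩
      · exact huw.elim
  · simp at heq
  · simp at heq
  · refine h.of_rowConnected hts ht (k := k) (l := k') (fun h => hab' (congrArg _ h))
      fun Z hZ ⟨i₀, hi₀⟩ i => ?_
    have := this {u | Sum.elim (fun m => m ∈ Z)
      (fun c => c ≠ k ∧ c ≠ k' ∧ ∃ m ∈ Z, co φ t (s c) m ≠ 0) u} ?_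
      ⟨Sum.inl i₀, hi₀, by simp, by simp⟩ (Sum.inl i) (by simp) (by simp)
    · exact this
    · rintro (m | c) hu (m' | d) huw h1 h2
      · exact huw.elim
      · exact ⟨fun h => h1 (congrArg _ h), fun h => h2 (congrArg _ h), m, hu, huw⟩
      · obtain ⟨hc1, hc2, m, hm, hm'⟩ := hu
        exact hZ c hc1 hc2 m m' hm' huw hm
      · exact huw.elim

lemma injective_fin_three {α : Type*} {a b c : α} (hab : a ≠ b) (hac : a ≠ c) (hbc : b ≠ c) :
    Function.Injective ![a, b, c] := by
  intro x y hxy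
  fin_cases x <;> fin_cases y <;> simp_all [eq_comm]

theorem Minimal.exists_good (h : Minimal f φ ψ φ₃ ψ₃) (hts : Compl t s) (ht : D φ t ≠ 0) :
    ∃ φ' : E → ι → K, Good f φ φ' univ := by
  classical
  by_cases hrow : ∃ (i : ι) (n : Fin 3 → κ), Function.Injective n ∧ ∀ a, co φ t (s (n a)) i ≠ 0
  · obtain ⟨i, n, hn, hi⟩ := hrow
    exact h.of_three hts ht hn hi
  by_cases hcol : ∃ (k : κ) (n : Fin 3 → ι), Function.Injective n ∧ ∀ a, co φ t (s k) (n a) ≠ 0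
  · obtain ⟨k, n, hn, hk⟩ := hcol
    refine h.of_dual hts ht (h.symm.of_three hts.symm (h.dual.D_ne_zero hts ht) (i := k) hn ?_)
    simpa only [h.dual.co_eq hts ht, neg_ne_zero] using hk
  have row3 : ∀ {i k l m}, co φ t (s k) i ≠ 0 → co φ t (s l) i ≠ 0 → k ≠ l →
      co φ t (s m) i ≠ 0 → m = k ∨ m = l := fun {i k l m} hk hl hkl hm => by
    by_contra hne
    push Not at hne
    refine hrow ⟨i, ![k, l, m], injective_fin_three hkl hne.1.symm hne.2.symm, fun a => ?_⟩
    fin_cases a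
    exacts [hk, hl, hm]
  have col3 : ∀ {k i j m}, co φ t (s k) i ≠ 0 → co φ t (s k) j ≠ 0 → i ≠ j →
      co φ t (s k) m ≠ 0 → m = i ∨ m = j := fun {k i j m} hk hl hkl hm => by
    by_contra hne
    push Not at hne
    refine hcol ⟨k, ![i, j, m], injective_fin_three hkl hne.1.symm hne.2.symm, fun a => ?_⟩
    fin_cases a
    exacts [hk, hl, hm]
  have row2 : ∀ i, (∃ φ' : E → ι → K, Good f φ φ' univ) ∨
      ∃ k l, co φ t (s k) i ≠ 0 ∧ co φ t (s l) i ≠ 0 ∧ k ≠ l := fun i => by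
    by_contra! hc
    obtain ⟨φ', h'⟩ := h.of_row hts ht i hc.2
    exact hc.1 φ' h'
  have hsinj : ∀ {c d : κ}, c ≠ d → s c ≠ s d := fun hcd h' =>
    hcd (Sum.inr_injective (hts.1 (a₁ := Sum.inr _) (a₂ := Sum.inr _) h'))
  rcases isEmpty_or_nonempty ι with hι | ⟨⟨i⟩⟩
  · exact ⟨fun _ _ => 0, fun t _ => by simp [D_eq_det], fun _ _ _ i => isEmptyElim i⟩
  obtain h' | ⟨k, l, hki, hli, hkl⟩ := row2 i
  · exact h'
  by_cases hj : ∃ j, co φ t (s k) j ≠ 0 ∧ j ≠ i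
  swap
  · push Not at hj
    exact h.of_col hts ht k fun a b ha hb => by rw [hj a ha, hj b hb]
  obtain ⟨j, hkj, hji⟩ := hj
  by_cases hlj : co φ t (s l) j = 0
  · obtain h' | ⟨m, hmj, hmk⟩ : (∃ φ' : E → ι → K, Good f φ φ' univ) ∨
        ∃ m, co φ t (s m) j ≠ 0 ∧ m ≠ k := by
      obtain h' | ⟨a, b, ha, hb, hab⟩ := row2 j
      · exact Or.inl h'
      · by_cases hak : a = k
        · exact Or.inr ⟨b, hb, fun hbk => hab (hak.trans hbk.symm)⟩
        · exact Or.inr ⟨a, ha, hak⟩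
    · exact h'
    have hml : m ≠ l := by
      rintro rfl; exact hmj hlj
    have hmi : co φ t (s m) i = 0 := by
      by_contra hc
      exact (row3 hki hli hkl hc).elim hmk hml
    have hD : D φ (Function.update t i (s k)) ≠ 0 := D_pivot_ne_zero ht hki
    obtain ⟨s', hs'⟩ := hts.exists_of_injective (injective_of_D_ne_zero hD)
    have hmem : ∀ e, (∀ a, Function.update t i (s k) a ≠ e) → ∃ c, s' c = e := fun e he => by
      rcases hs'.cases e with ⟨a, ha⟩ | ⟨c, hc⟩
      exacts [absurd ha.symm (he a), ⟨c, hc.symm⟩]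
    have htinj := injective_of_D_ne_zero ht
    obtain ⟨a, ha⟩ := hmem (t i) fun b => by
      by_cases hb : b = i
      · subst hb; simpa using (hts.ne b k).symm
      · simpa [hb] using htinj.ne hb
    obtain ⟨b, hb⟩ := hmem (s l) fun b => by
      by_cases hb : b = i
      · subst hb; simpa using hsinj hkl
      · simpa [hb] using hts.ne b l
    obtain ⟨c, hc⟩ := hmem (s m) fun b => by
      by_cases hb : b = i
      · subst hb; simpa using hsinj hmk.symm
      · simpa [hb] using hts.ne b m
    refine h.of_three hs' hD (i := j) (n := ![a, b, c]) (injective_fin_three ?_ ?_ ?_) fun z => ?_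
    · rintro rfl; exact hts.ne i l (ha.symm.trans hb)
    · rintro rfl; exact hts.ne i m (ha.symm.trans hc)
    · rintro rfl; exact hsinj hml (hc.symm.trans hb)
    · fin_cases z
      · simp only [Fin.zero_eta, Matrix.cons_val_zero, ha]
        rw [co_pivot_of_ne φ ht hji hki, co_self φ ht, co_self φ ht, if_neg hji, if_pos rfl]
        simpa using ⟨hkj, hki⟩
      · simp only [Fin.mk_one, Matrix.cons_val_one, Matrix.cons_val_zero, hb]
        rw [co_pivot_of_ne φ ht hji hki, hlj]
        simpa using ⟨⟨hkj, hli⟩, hki⟩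
      · simp only [Fin.reduceFinMk, Matrix.cons_val, hc]
        rw [co_pivot_of_ne φ ht hji hki, hmi]
        simpa using hmj
  · by_cases hιij : ∀ m, m = i ∨ m = j
    · by_cases hκ : ∀ c, c = k ∨ c = l
      · refine glue_of_two h.lift h.left_tern (hsinj hkl) (fun m => ⟨hts.ne m k, hts.ne m l⟩) ht
          (h.left _ ⟨t, ht, fun m => hts.ne m k⟩) (h.left _ ⟨t, ht, fun m => hts.ne m l⟩)
          hji.symm hιij (fun e => ?_) (fun m => ?_) fun m => ?_
        · rcases hts.cases e with ⟨m, rfl⟩ | ⟨m, rfl⟩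
          · exact Or.inr (Or.inr ⟨m, rfl⟩)
          · rcases hκ m with rfl | rfl
            exacts [Or.inl rfl, Or.inr (Or.inl rfl)]
        · rcases hιij m with rfl | rfl <;> assumption
        · rcases hιij m with rfl | rfl <;> assumption
      · push Not at hκ
        obtain ⟨c, hck, hcl⟩ := hκ
        refine h.of_col hts ht c fun a _ ha => ?_
        rcases hιij a with rfl | rfl
        · exact ((row3 hki hli hkl ha).elim hck hcl).elim
        · exact ((row3 hkj hlj hkl ha).elim hck hcl).elim
    · push Not at hιij
      obtain ⟨m, hmi, hmj⟩ := hιij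
      refine h.of_separated hts ht (Z := {i, j}) (fun c a b ha hb haZ => ?_) (Or.inl rfl)
        (j := m) (by simp [hmi, hmj])
      have hc : c = k ∨ c = l := by
        rcases haZ with rfl | rfl
        exacts [row3 hki hli hkl ha, row3 hkj hlj hkl ha]
      rcases hc with rfl | rfl
      exacts [col3 hki hkj hji.symm hb, col3 hli hlj hji.symm hb]

end Minimal

/-- A finite configuration that has a ternary copy has a lift. -/
theorem exists_good {F : Type v} {K : Type w} [Field F] [Field K] {f : F → K} (hf : IsLift f)
    (hneg : f (-1) = -1) {ι : Type u} [Fintype ι] [DecidableEq ι] {E : Type u} [Finite E]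
    {φ : E → ι → F} {φ₃ : E → ι → ZMod 3} (hφ : SameZero φ φ₃ univ) {t : ι → E}
    (ht : D φ t ≠ 0) : ∃ φ' : E → ι → K, Good f φ φ' univ := by
  classical
  obtain ⟨n, hn⟩ : ∃ n, Nat.card E = n := ⟨_, rfl⟩
  induction n using Nat.strong_induction_on generalizing ι E with
  | _ n ih =>
  have := Fintype.ofFinite E
  have del : ∀ {ι : Type u} [Fintype ι] [DecidableEq ι] {φ : E → ι → F} {φ₃ : E → ι → ZMod 3},
      SameZero φ φ₃ univ → ∀ x, (∃ t, D φ t ≠ 0 ∧ ∀ i, t i ≠ x) →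
      ∃ φ' : E → ι → K, Good f φ φ' {x}ᶜ := by
    rintro ι _ _ φ φ₃ hφ x ⟨t, ht, htx⟩
    have hlt : Nat.card ({x}ᶜ : Set E) < n := by
      rw [← hn, ← Nat.card_univ (α := E)]
      exact Set.Finite.card_lt_card (toFinite _) (by simp [ssubset_univ_iff])
    obtain ⟨φ', hφ'⟩ := ih _ hlt (E := ({x}ᶜ : Set E)) (φ := fun e => φ e)
      (φ₃ := fun e => φ₃ e) (fun t _ => hφ _ fun _ => mem_univ _) (t := fun i => ⟨t i, htx i⟩)
      ht rfl
    exact hφ'.of_subtype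
  have hts : Compl t fun k : {e // e ∉ range t} => (k : E) := by
    refine ⟨?_, fun e => ?_⟩
    · rintro (i | k) (j | l) hij
      · exact congrArg _ (injective_of_D_ne_zero ht hij)
      · exact absurd ⟨i, hij⟩ l.2
      · exact absurd ⟨j, hij.symm⟩ k.2
      · exact congrArg _ (Subtype.ext hij)
    · by_cases he : e ∈ range t
      · obtain ⟨i, rfl⟩ := he
        exact ⟨Sum.inl i, rfl⟩
      · exact ⟨Sum.inr ⟨e, he⟩, rfl⟩
  have ht₃ : D φ₃ t ≠ 0 := fun h => ht ((hφ t fun _ => mem_univ _).mpr h)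
  obtain ⟨ψ, hψ⟩ := exists_isDual hts ht
  obtain ⟨ψ₃, hψ₃⟩ := exists_isDual hts ht₃
  have hφ' := hφ.dual hψ hψ₃ hts
  exact Minimal.exists_good ⟨hf, hneg, hψ, hφ, hφ', del hφ, del hφ'⟩ hts ht

section Restriction

variable {F K : Type*} [Field F] [Field K] {α β : Type*} [DecidableEq β]

/-- The vectors of `φ` with only the coordinates in `R` kept. -/
def res (R : Finset β) (φ : α → β → F) : α → R → F := fun e i => φ e i

/-- The vectors listed by `t₀` are the standard basis vectors. -/
def Std (φ : α → β → F) (t₀ : β → α) : Prop := ∀ b, φ (t₀ b) = Pi.single b 1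

/-- Extension of a list of elements by the elements listed by `t₀`. -/
def ext (t₀ : β → α) {R : Finset β} (R' : Finset β) (t : R → α) : R' → α :=
  fun i => if h : (i : β) ∈ R then t ⟨i, h⟩ else t₀ i

variable {φ : α → β → F} {φ' : α → β → K} {t₀ : β → α} {f : F → K} {X : Set α}

lemma ext_mem {R R' : Finset β} {t : R → α} (ht : ∀ i, t i ∈ X) (h₀ : ∀ b ∈ R', t₀ b ∈ X)
    (i : R') : ext t₀ R' t i ∈ X := by
  unfold ext
  split_ifs with h
  · exact ht _
  · exact h₀ _ i.2

lemma ext_update {R R' : Finset β} (hR : R ⊆ R') (t : R → α) (i : R) (e : α) :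
    ext t₀ R' (Function.update t i e) = Function.update (ext t₀ R' t) ⟨i, hR i.2⟩ e := by
  funext l
  by_cases hl : l = ⟨i, hR i.2⟩
  · subst hl; simp [ext]
  · have : (l : β) ≠ i := fun h => hl (Subtype.ext h)
    rw [Function.update_of_ne hl]
    unfold ext
    split_ifs with h
    · rw [Function.update_of_ne]
      exact fun h' => this (congrArg Subtype.val h')
    · rfl

lemma D_res (hφ : Std φ t₀) {R R' : Finset β} (hR : R ⊆ R') (t : R → α) :
    D (res R' φ) (ext t₀ R' t) = D (res R φ) t := by
  classical
  rw [D_eq_det, D_eq_det]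
  rw [Matrix.twoBlockTriangular_det _ (fun i : R' => (i : β) ∈ R)]
  · have h1 : (Matrix.toSquareBlockProp (Matrix.of fun i => res R' φ (ext t₀ R' t i))
        fun i : R' => ¬ (i : β) ∈ R) = 1 := by
      ext i j
      have hi : ((i : R') : β) ∉ R := i.2
      simp only [Matrix.toSquareBlockProp_def, Matrix.of_apply, res, ext, hi, dif_neg,
        not_false_eq_true, hφ _, Matrix.one_apply, Pi.single_apply]
      simp only [Subtype.ext_iff, eq_comm]
    rw [h1, Matrix.det_one, mul_one]
    let σ : {i : R' // (i : β) ∈ R} ≃ R :=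
      ⟨fun i => ⟨i.1, i.2⟩, fun i => ⟨⟨i, hR i.2⟩, i.2⟩, fun _ => rfl, fun _ => rfl⟩
    rw [← Matrix.det_submatrix_equiv_self σ]
    congr 1
    ext i j
    have hi : ((i : R') : β) ∈ R := i.2
    simp [Matrix.toSquareBlockProp_def, res, ext, hi, σ]
  · intro i hi j hj
    simp only [Matrix.of_apply, res, ext, hi, dif_neg, not_false_eq_true, hφ _]
    rw [Pi.single_apply, if_neg]
    rintro h
    exact hi (h ▸ hj)

lemma co_res (hφ : Std φ t₀) {R R' : Finset β} (hR : R ⊆ R') (t : R → α) (e : α) (i : R) :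
    co (res R' φ) (ext t₀ R' t) e ⟨i, hR i.2⟩ = co (res R φ) t e i := by
  rw [co, co, ← ext_update hR, D_res hφ hR, D_res hφ hR]

lemma SameZero.res (hφ : Std φ t₀) (hφ' : Std φ' t₀) {R R' : Finset β} (hR : R ⊆ R')
    (h₀ : ∀ b ∈ R', t₀ b ∈ X) (h : SameZero (res R' φ) (res R' φ') X) :
    SameZero (res R φ) (res R φ') X := by
  intro t ht
  rw [← D_res hφ hR, ← D_res hφ' hR]
  exact h _ (ext_mem ht h₀)

lemma Good.res (hφ : Std φ t₀) (hφ' : Std φ' t₀) {R R' : Finset β} (hR : R ⊆ R')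
    (h₀ : ∀ b ∈ R', t₀ b ∈ X) (h : Good f (res R' φ) (res R' φ') X) :
    Good f (res R φ) (res R φ') X := by
  refine ⟨h.zero.res hφ hφ' hR h₀, fun t ht hD i j hij c hc d hd => ?_⟩
  have := h.blk (ext t₀ R' t) (ext_mem ht h₀) (by rwa [D_res hφ hR]) ⟨i, hR i.2⟩ ⟨j, hR j.2⟩
    (fun h => hij (Subtype.ext (congrArg (fun x : R' => (x : β)) h))) c hc d hd
  unfold Blk at this ⊢
  simpa only [co_res hφ hR, co_res hφ' hR] using this

/-- The standard basis of the coordinates in `R`. -/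
def std (t₀ : β → α) (R : Finset β) : R → α := fun i => t₀ i

lemma D_std (hφ : Std φ t₀) (R : Finset β) : D (res R φ) (std t₀ R) = 1 := by
  rw [D_eq_det]
  rw [show Matrix.of (fun i => res R φ (std t₀ R i)) = (1 : Matrix R R F) from ?_, Matrix.det_one]
  ext i j
  simp only [Matrix.of_apply, res, std, hφ _, Pi.single_apply, Matrix.one_apply, Subtype.ext_iff,
    eq_comm]

lemma co_std (hφ : Std φ t₀) (R : Finset β) (e : α) (i : R) :
    co (res R φ) (std t₀ R) e i = φ e i := by
  have := co_unique (res R φ) (t := std t₀ R) (by rw [D_std hφ]; exact one_ne_zero) e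
    (res R φ e) (by
      funext j
      simp only [Finset.sum_apply, Pi.smul_apply, smul_eq_mul, res, std, hφ _, Pi.single_apply]
      rw [Finset.sum_eq_single j]
      · simp
      · intro k _ hk
        rw [if_neg (fun h => hk (Subtype.ext h.symm)), mul_zero]
      · simp)
  rw [← this]; rfl

lemma Good.of_finite {ι : Type*} [Fintype ι] [DecidableEq ι] {φ : α → ι → F} {φ' : α → ι → K}
    (h : ∀ Z ⊆ X, Z.Finite → Good f φ φ' Z) : Good f φ φ' X := by
  refine ⟨fun t ht => ?_, fun t ht hD i j hij c hc d hd => ?_⟩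
  · exact (h (range t) (range_subset_iff.mpr ht) (finite_range t)).zero t fun i => mem_range_self i
  · have h1 : range t ∪ {c, d} ⊆ X := union_subset (range_subset_iff.mpr ht)
      (insert_subset hc (singleton_subset_iff.mpr hd))
    exact (h _ h1 ((finite_range t).union (by simp))).blk t
      (fun i => Or.inl (mem_range_self i)) hD i j hij c (by simp) d (by simp)

end Restriction

section Infinite

variable {F : Type v} {K : Type w} [Field F] [Field K] {α β : Type u} [DecidableEq β]
  {φ : α → β → F} {φ₃ : α → β → ZMod 3} {φ' : α → β → K} {t₀ : β → α} {f : F → K} {X : Set α}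

/-- The configuration `φ'` lifts `φ` on `X`, for each finite set of coordinates. -/
def Lifts (f : F → K) (φ : α → β → F) (φ' : α → β → K) (X : Set α) : Prop :=
  ∀ R : Finset β, Good f (res R φ) (res R φ') X

lemma exists_good_res (hf : IsLift f) (hneg : f (-1) = -1) (hφ : Std φ t₀)
    (h : ∀ R : Finset β, SameZero (res R φ) (res R φ₃) univ) (R : Finset β) {Z : Set α}
    (hZ : Z.Finite) (hRZ : ∀ b ∈ R, t₀ b ∈ Z) : ∃ ψ : α → R → K, Good f (res R φ) ψ Z := by
  have : Finite Z := hZ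
  obtain ⟨ψ, hψ⟩ := exists_good hf hneg (φ := fun e : Z => res R φ e)
    (φ₃ := fun e : Z => res R φ₃ e) (fun t _ => h R _ fun _ => mem_univ _)
    (t := fun i => ⟨t₀ i, hRZ _ i.2⟩)
    (by have := D_std hφ R; exact ne_of_eq_of_ne this one_ne_zero)
  exact hψ.of_subtype

lemma lifts_of_finite (hφ : Std φ t₀) (hφ' : Std φ' t₀)
    (h : ∀ (R : Finset β) (Z : Set α), Z.Finite → Z ⊆ X → ∃ (R' : Finset β) (Z' : Set α),
      R ⊆ R' ∧ Z ⊆ Z' ∧ (∀ b ∈ R', t₀ b ∈ Z') ∧ Good f (res R' φ) (res R' φ') Z') :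
    Lifts f φ φ' X := by
  intro R
  refine Good.of_finite fun Z hZX hZ => ?_
  obtain ⟨R', Z', hR, hZZ, h1, h2⟩ := h R Z hZ hZX
  exact (h2.res hφ hφ' hR h1).mono hZZ

lemma exists_lifts_base (hf : IsLift f) (hneg : f (-1) = -1) (ht₀ : Function.Injective t₀)
    (hφ : Std φ t₀) (h : ∀ R : Finset β, SameZero (res R φ) (res R φ₃) univ) :
    ∃ φ' : α → β → K, Std φ' t₀ ∧ Lifts f φ φ' (range t₀) := by
  classical
  set φ' : α → β → K := fun e b => if e = t₀ b then 1 else 0 with hφ'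
  have hstd : Std φ' t₀ := by
    intro b
    funext c
    simp only [hφ', Pi.single_apply, ht₀.eq_iff, eq_comm]
  refine ⟨φ', hstd, lifts_of_finite hφ hstd fun R Z hZ hZX => ?_⟩
  set R' := R ∪ (hZ.preimage ht₀.injOn).toFinset with hR'
  have hZ' : Z ⊆ t₀ '' R' := by
    intro e he
    obtain ⟨b, rfl⟩ := hZX he
    exact ⟨b, by simp [hR', he], rfl⟩
  obtain ⟨ψ, hψ⟩ := exists_good_res hf hneg hφ h R' (R'.finite_toSet.image t₀)
    fun b hb => mem_image_of_mem _ hb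
  have hD : D ψ (std t₀ R') ≠ 0 := by
    refine (hψ.zero (std t₀ R') fun i => mem_image_of_mem _ i.2).not.mp ?_
    rw [D_std hφ]; exact one_ne_zero
  obtain ⟨M, hM, hM'⟩ := exists_matrix hD (w := (1 : Matrix R' R' K))
    (by simp [show Matrix.of (1 : Matrix R' R' K) = 1 from rfl])
  refine ⟨R', t₀ '' R', Finset.subset_union_left, hZ', fun b hb => mem_image_of_mem _ hb,
    (hψ.scale (s := fun _ => 1) (fun _ => one_ne_zero) hM).congr ?_⟩
  rintro _ ⟨b, hb, rfl⟩
  rw [one_smul, hM']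
  have h1 : ∀ i, co ψ (std t₀ R') (t₀ b) i = if i = ⟨b, hb⟩ then 1 else 0 :=
    co_self ψ hD ⟨b, hb⟩
  funext c
  simp only [h1, Finset.sum_apply, Pi.smul_apply, smul_eq_mul, ite_mul, one_mul, zero_mul,
    Finset.sum_ite_eq', Finset.sum_ite_eq, Finset.mem_univ, if_true]
  simp only [res, hφ', ht₀.eq_iff, Matrix.one_apply, Subtype.ext_iff]

lemma Lifts.apply_eq_zero_iff (h : Lifts f φ φ' X) (hφ : Std φ t₀) (hφ' : Std φ' t₀)
    (h₀ : range t₀ ⊆ X) {e : α} (he : e ∈ X) (b : β) : φ e b = 0 ↔ φ' e b = 0 := by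
  have hb : b ∈ ({b} : Finset β) := Finset.mem_singleton_self b
  have := (h {b}).zero.co (t := std t₀ {b}) (fun i => h₀ (mem_range_self _))
    (by rw [D_std hφ]; exact one_ne_zero) he ⟨b, hb⟩
  rwa [co_std hφ, co_std hφ'] at this

/-- The possible images of the new vector `x`. -/
def Cand (f : F → K) (φ : α → β → F) (φ' : α → β → K) [DecidableEq α] (x : α) (R : Finset β)
    (Z : Set α) (v : β → K) : Prop :=
  Good f (res R φ) (res R (Function.update φ' x v)) (insert x Z)

variable [DecidableEq α]

lemma Std.update (hφ' : Std φ' t₀) {x : α} (hx : x ∉ range t₀) (v : β → K) :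
    Std (Function.update φ' x v) t₀ := by
  intro b
  rw [Function.update_of_ne, hφ' b]
  rintro rfl
  exact hx (mem_range_self b)

lemma exists_cand (hf : IsLift f) (hneg : f (-1) = -1) (hφ : Std φ t₀)
    (h : ∀ R : Finset β, SameZero (res R φ) (res R φ₃) univ) (hX : Lifts f φ φ' X)
    {x : α} (hx : x ∉ X) (R : Finset β) {Z : Set α} (hZ : Z.Finite) (hZX : Z ⊆ X)
    (hRZ : ∀ b ∈ R, t₀ b ∈ Z) : ∃ v, Cand f φ φ' x R Z v := by
  obtain ⟨ψ, hψ⟩ := exists_good_res hf hneg hφ h R (hZ.insert x)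
    fun b hb => mem_insert_of_mem _ (hRZ b hb)
  obtain ⟨s, M, hs, hM, hsM⟩ := exists_scaling hZ ((hX R).mono hZX) (hψ.mono (subset_insert _ _))
    (t := std t₀ R) (fun i => hRZ _ i.2) (by rw [D_std hφ]; exact one_ne_zero)
  set w := s x • Matrix.vecMul (ψ x) M with hw
  refine ⟨fun b => if hb : b ∈ R then w ⟨b, hb⟩ else 0, (hψ.scale hs hM).congr ?_⟩
  rintro e (rfl | he)
  · funext i
    simp [res, hw]
  · have hex : e ≠ x := fun h => hx (h ▸ hZX he)
    rw [← hsM e he]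
    funext i
    simp [res, hex]

lemma Cand.anti {x : α} (hφ : Std φ t₀) (hφ' : Std φ' t₀) (hx : x ∉ range t₀)
    {R R' : Finset β} {Z Z' : Set α} (hR : R ⊆ R') (hZ : Z ⊆ Z') (h₀ : ∀ b ∈ R', t₀ b ∈ Z')
    {v : β → K} (h : Cand f φ φ' x R' Z' v) : Cand f φ φ' x R Z v :=
  (Good.res hφ (hφ'.update hx v) hR (fun b hb => mem_insert_of_mem _ (h₀ b hb)) h).mono
    (insert_subset_insert hZ)

lemma Cand.apply_eq_zero_iff {x : α} (hφ : Std φ t₀) (hφ' : Std φ' t₀) (hx : x ∉ range t₀)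
    {R : Finset β} {Z : Set α} (h₀ : ∀ b ∈ R, t₀ b ∈ Z)
    {v : β → K} (h : Cand f φ φ' x R Z v) {b : β} (hb : b ∈ R) : φ x b = 0 ↔ v b = 0 := by
  have := h.zero.co (t := std t₀ R) (fun i => mem_insert_of_mem _ (h₀ _ i.2))
    (by rw [D_std hφ]; exact one_ne_zero) (mem_insert x Z) ⟨b, hb⟩
  rw [co_std hφ, co_std (hφ'.update hx v)] at this
  simpa using this

lemma Cand.proportional {x : α} (hφ : Std φ t₀) (hφ' : Std φ' t₀) (hx : x ∉ range t₀)
    {R : Finset β} {Z : Set α} (hxZ : x ∉ Z) (h₀ : ∀ b ∈ R, t₀ b ∈ Z) {v w : β → K}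
    (hv : Cand f φ φ' x R Z v) (hw : Cand f φ φ' x R Z w) {i j : R} (hi : φ x i ≠ 0)
    (hj : φ x j ≠ 0) {k : ℕ} (hk : Walk (res R φ) (std t₀ R) Z k i j) :
    v i * w j = v j * w i := by
  have heq : ∀ e ∈ Z, res R (Function.update φ' x v) e = res R (Function.update φ' x w) e := by
    intro e he
    have : e ≠ x := fun h => hxZ (h ▸ he)
    funext i
    simp [res, this]
  have := Good.proportional (subset_insert x Z) hv hw heq (mem_insert x Z) k (t := std t₀ R) (fun i => h₀ _ i.2)
      (by rw [D_std hφ]; exact one_ne_zero) (i := i) (j := j) (by rwa [co_std hφ])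
      (by rwa [co_std hφ]) hk
  simpa [co_std (hφ'.update hx v), co_std (hφ'.update hx w)] using this

lemma Walk.res (hφ : Std φ t₀) {R R' : Finset β} (hR : R ⊆ R') {Z : Set α} {k : ℕ} {i j : R}
    (h : Walk (res R φ) (std t₀ R) Z k i j) :
    Walk (res R' φ) (std t₀ R') Z k ⟨i, hR i.2⟩ ⟨j, hR j.2⟩ := by
  induction k generalizing i with
  | zero =>
    obtain rfl : i = j := h
    rfl
  | succ k ih =>
    obtain ⟨c, hc, l, h1, h2, h3⟩ := h
    rw [co_std hφ] at h1 h2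
    exact ⟨c, hc, ⟨l, hR l.2⟩, by rwa [co_std hφ], by rwa [co_std hφ], ih h3⟩

lemma Cand.transfer {x : α} (hφ : Std φ t₀) (hφ' : Std φ' t₀) (hX : Lifts f φ φ' X)
    (h₀ : range t₀ ⊆ X) (hx : x ∉ X) {R : Finset β} {Z : Set α} (hZX : Z ⊆ X)
    (hRZ : ∀ b ∈ R, t₀ b ∈ Z) {v w : β → K} (hv : Cand f φ φ' x R Z v)
    (hw : ∀ b, w b = 0 ↔ φ x b = 0)
    (hvw : ∀ (i j : R) (k : ℕ), φ x i ≠ 0 → φ x j ≠ 0 → Walk (res R φ) (std t₀ R) Z k i j →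
      w i * v j = w j * v i) : Cand f φ φ' x R Z w := by
  classical
  have hx' : x ∉ range t₀ := fun h => hx (h₀ h)
  have hv0 : ∀ i : R, φ x i = 0 ↔ v i = 0 := fun i => hv.apply_eq_zero_iff hφ hφ' hx' hRZ i.2
  set C : R → Prop := fun i => ∃ j : R, φ x j ≠ 0 ∧ ∃ k, Walk (res R φ) (std t₀ R) Z k i j
    with hC
  set c : R → K := fun i => if h : C i then w h.choose / v h.choose else 1 with hc
  have hc0 : ∀ i, c i ≠ 0 := by
    intro i
    simp only [hc]
    split_ifs with h
    · exact div_ne_zero ((hw _).not.mpr h.choose_spec.1) ((hv0 _).not.mp h.choose_spec.1)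
    · exact one_ne_zero
  have hcw : ∀ i j : R, ∀ k, φ x j ≠ 0 → Walk (res R φ) (std t₀ R) Z k i j → c i = w j / v j := by
    intro i j k hj hk
    have h : C i := ⟨j, hj, k, hk⟩
    simp only [hc, dif_pos h]
    obtain ⟨h1, k', h2⟩ := h.choose_spec
    have := hvw _ _ _ h1 hj (h2.symm.trans hk)
    rw [div_eq_div_iff ((hv0 _).not.mp h1) ((hv0 _).not.mp hj), this]
  have hcc : ∀ i j : R, ∀ e ∈ Z, φ e i ≠ 0 → φ e j ≠ 0 → c i = c j := by
    intro i j e he hi hj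
    have hij : Walk (res R φ) (std t₀ R) Z 1 i j :=
      Walk.single he (by rwa [co_std hφ]) (by rwa [co_std hφ])
    by_cases h : ∃ l : R, φ x l ≠ 0 ∧ ∃ k, Walk (res R φ) (std t₀ R) Z k i l
    · obtain ⟨l, hl, k, hk⟩ := h
      rw [hcw i l k hl hk, hcw j l _ hl (hij.symm.trans hk)]
    · have h' : ¬ C j := fun ⟨l, hl, k, hk⟩ => h ⟨l, hl, _, hij.trans hk⟩
      simp only [hc]
      rw [dif_neg h, dif_neg h']
  set s : α → K := fun e => if e = x then 1 else
    if h : ∃ i : R, φ e i ≠ 0 then (c h.choose)⁻¹ else 1 with hs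
  have hs0 : ∀ e, s e ≠ 0 := by
    intro e
    simp only [hs]
    split_ifs
    · exact one_ne_zero
    · exact inv_ne_zero (hc0 _)
    · exact one_ne_zero
  refine (Good.scale hv hs0 (M := Matrix.diagonal c) ?_).congr ?_
  · rw [Matrix.det_diagonal]
    exact Finset.prod_ne_zero_iff.mpr fun i _ => hc0 i
  · rintro e (rfl | he)
    · funext i
      simp only [hs, if_true, one_smul, Matrix.vecMul_diagonal, res, Function.update_self]
      by_cases hi : φ e i = 0
      · rw [(hv0 i).mp hi, (hw i).mpr hi, zero_mul]
      · rw [hcw i i 0 hi rfl, mul_div_cancel₀ _ ((hv0 i).not.mp hi)]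
    · have hex : e ≠ x := fun h => hx (h ▸ hZX he)
      funext i
      simp only [hs, if_neg hex, Pi.smul_apply, smul_eq_mul, Matrix.vecMul_diagonal, res,
        Function.update_of_ne hex]
      by_cases hi : φ e i = 0
      · rw [(hX.apply_eq_zero_iff hφ hφ' h₀ (hZX he) _).mp hi]
        ring
      · have h : ∃ i : R, φ e i ≠ 0 := ⟨i, hi⟩
        rw [dif_pos h, hcc i _ e he hi h.choose_spec]
        field_simp [hc0]

/-- A lift can be extended to a further vector. -/
lemma Lifts.exists_update (hf : IsLift f) (hneg : f (-1) = -1) (hφ : Std φ t₀) (hφ' : Std φ' t₀)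
    (h : ∀ R : Finset β, SameZero (VecConfig.res R φ) (VecConfig.res R φ₃) univ)
    (hX : Lifts f φ φ' X) (h₀ : range t₀ ⊆ X) {x : α} (hx : x ∉ X)
    (hfin : (Function.support (φ x)).Finite) :
    ∃ v, Lifts f φ (Function.update φ' x v) (insert x X) := by
  classical
  have hx' : x ∉ range t₀ := fun h => hx (h₀ h)
  set P : Finset β := hfin.toFinset with hP
  have hPx : ∀ b, φ x b ≠ 0 → b ∈ P := fun b hb => by simpa [hP] using hb
  set L : β × β → Finset β → Set α → Prop := fun q R Z =>
    ∃ (h1 : q.1 ∈ R) (h2 : q.2 ∈ R) (k : ℕ), Walk (VecConfig.res R φ) (std t₀ R) Z k ⟨q.1, h1⟩ ⟨q.2, h2⟩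
    with hL
  have hLmono : ∀ q {R R' : Finset β} {Z Z' : Set α}, R ⊆ R' → Z ⊆ Z' → L q R Z → L q R' Z' := by
    rintro q R R' Z Z' hR hZ ⟨h1, h2, k, hk⟩
    exact ⟨hR h1, hR h2, k, (hk.res hφ hR).mono hZ⟩
  have hsel : ∀ q : β × β, ∃ (R : Finset β) (Z : Set α), Z.Finite ∧ Z ⊆ X ∧
      ∀ (R' : Finset β) (Z' : Set α), Z'.Finite → Z' ⊆ X → L q R' Z' → L q R Z := by
    intro q
    by_cases hq : ∃ (R : Finset β) (Z : Set α), Z.Finite ∧ Z ⊆ X ∧ L q R Z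
    · obtain ⟨R, Z, h1, h2, h3⟩ := hq
      exact ⟨R, Z, h1, h2, fun _ _ _ _ _ => h3⟩
    · exact ⟨∅, ∅, finite_empty, empty_subset _, fun R' Z' h1 h2 h3 =>
        absurd ⟨R', Z', h1, h2, h3⟩ hq⟩
  choose Rq Zq hq1 hq2 hq3 using hsel
  set R₀ : Finset β := P ∪ (P ×ˢ P).biUnion Rq with hR₀
  set Z₀ : Set α := (⋃ q ∈ P ×ˢ P, Zq q) ∪ t₀ '' R₀ with hZ₀
  have hPR : P ⊆ R₀ := Finset.subset_union_left
  have hZ₀f : Z₀.Finite :=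
    ((P ×ˢ P).finite_toSet.biUnion fun q _ => hq1 q).union (R₀.finite_toSet.image t₀)
  have him : ∀ R : Finset β, t₀ '' R ⊆ X := fun R => (image_subset_range _ _).trans h₀
  have hZ₀X : Z₀ ⊆ X := union_subset (iUnion₂_subset fun q _ => hq2 q) (him R₀)
  have hRZ₀ : ∀ b ∈ R₀, t₀ b ∈ Z₀ := fun b hb => Or.inr (mem_image_of_mem _ hb)
  have hmax : ∀ q ∈ P ×ˢ P, ∀ (R' : Finset β) (Z' : Set α), Z'.Finite → Z' ⊆ X → L q R' Z' →
      L q R₀ Z₀ := by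
    intro q hq R' Z' h1 h2 h3
    refine hLmono q ?_ ?_ (hq3 q R' Z' h1 h2 h3)
    · exact (Finset.subset_biUnion_of_mem Rq hq).trans Finset.subset_union_right
    · exact (subset_biUnion_of_mem (u := Zq) (s := (P ×ˢ P : Finset _)) hq).trans
        subset_union_left
  obtain ⟨v₁, hv₁⟩ := exists_cand hf hneg hφ h hX hx R₀ hZ₀f hZ₀X hRZ₀
  set v₀ : β → K := fun b => if b ∈ R₀ then v₁ b else 0 with hv₀
  have hv₀c : Cand f φ φ' x R₀ Z₀ v₀ := by
    refine Good.congr hv₁ fun e _ => ?_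
    funext i
    by_cases hex : e = x
    · subst hex; simp [VecConfig.res, hv₀]
    · simp [VecConfig.res, hex]
  have hv₀0 : ∀ b, v₀ b = 0 ↔ φ x b = 0 := by
    intro b
    by_cases hb : b ∈ R₀
    · exact (hv₀c.apply_eq_zero_iff hφ hφ' hx' hRZ₀ hb).symm
    · have h1 : φ x b = 0 := by
        by_contra h
        exact hb (hPR (hPx b h))
      simp [hv₀, hb, h1]
  refine ⟨v₀, lifts_of_finite hφ (hφ'.update hx' _) ?_⟩
  intro R Z hZ hZX
  set R' : Finset β := R₀ ∪ R with hR'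
  set Z' : Set α := (Z₀ ∪ (Z ∩ X)) ∪ t₀ '' R' with hZ'
  have hZ'f : Z'.Finite := (hZ₀f.union (hZ.inter_of_left _)).union (R'.finite_toSet.image t₀)
  have hZ'X : Z' ⊆ X := union_subset (union_subset hZ₀X inter_subset_right) (him R')
  have hRZ' : ∀ b ∈ R', t₀ b ∈ Z' := fun b hb => Or.inr (mem_image_of_mem _ hb)
  have hRR : R₀ ⊆ R' := Finset.subset_union_left
  have hZZ : Z₀ ⊆ Z' := subset_union_left.trans subset_union_left
  refine ⟨R', insert x Z', Finset.subset_union_right, ?_,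
    fun b hb => mem_insert_of_mem _ (hRZ' b hb), ?_⟩
  · intro e he
    rcases hZX he with rfl | h
    · exact mem_insert _ _
    · exact Or.inr (Or.inl (Or.inr ⟨he, h⟩))
  · obtain ⟨v, hv⟩ := exists_cand hf hneg hφ h hX hx R' hZ'f hZ'X hRZ'
    refine hv.transfer hφ hφ' hX h₀ hx hZ'X hRZ' hv₀0 fun i j k hi hj hk => ?_
    obtain ⟨h1, h2, k', hk'⟩ := hmax (i, j) (Finset.mk_mem_product (hPx _ hi) (hPx _ hj)) R' Z'
      hZ'f hZ'X ⟨i.2, j.2, k, hk⟩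
    exact Cand.proportional hφ hφ' hx' (fun h => hx (hZ₀X h)) hRZ₀ hv₀c
      (hv.anti hφ hφ' hx' hRR hZZ hRZ') (i := ⟨i, h1⟩) (j := ⟨j, h2⟩) hi hj hk'

/-- Existence of lifts of configurations of finitely supported vectors. -/
theorem exists_lifts (hf : IsLift f) (hneg : f (-1) = -1) (ht₀ : Function.Injective t₀)
    (hφ : Std φ t₀) (hfin : ∀ e, (Function.support (φ e)).Finite)
    (h : ∀ R : Finset β, SameZero (VecConfig.res R φ) (VecConfig.res R φ₃) univ) :
    ∃ φ' : α → β → K, Std φ' t₀ ∧ Lifts f φ φ' univ := by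
  classical
  set S := {p : Set α × (α → β → K) // range t₀ ⊆ p.1 ∧ Std p.2 t₀ ∧ Lifts f φ p.2 p.1}
  let r : S → S → Prop := fun p q => p.1.1 ⊆ q.1.1 ∧ EqOn p.1.2 q.1.2 p.1.1
  suffices hch : ∀ c, IsChain r c → ∃ ub, ∀ a ∈ c, r a ub by
    obtain ⟨m, hm⟩ := exists_maximal_of_chains_bounded hch fun {a b c} hab hbc =>
      ⟨hab.1.trans hbc.1, fun e he => (hab.2 he).trans (hbc.2 (hab.1 he))⟩
    obtain ⟨⟨X, φ'⟩, h₀, hφ', hX⟩ := m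
    refine ⟨φ', hφ', ?_⟩
    suffices hu : X = univ by exact hu ▸ hX
    by_contra hu
    obtain ⟨x, hx⟩ := (ne_univ_iff_exists_notMem X).mp hu
    obtain ⟨v, hv⟩ := hX.exists_update hf hneg hφ hφ' h h₀ hx (hfin x)
    have := (hm ⟨⟨insert x X, Function.update φ' x v⟩, h₀.trans (subset_insert _ _),
      hφ'.update (fun h => hx (h₀ h)) v, hv⟩ ⟨subset_insert _ _, fun e he => ?_⟩).1
    · exact hx (this (mem_insert _ _))
    · exact (Function.update_of_ne (fun h : e = x => hx (h ▸ he)) _ _).symm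
  intro c hc
  rcases c.eq_empty_or_nonempty with rfl | ⟨m, hm⟩
  · obtain ⟨φ', h1, h2⟩ := exists_lifts_base (K := K) hf hneg ht₀ hφ h
    exact ⟨⟨⟨range t₀, φ'⟩, le_rfl, h1, h2⟩, fun a ha => absurd ha (notMem_empty _)⟩
  · set Y : Set α := ⋃ p ∈ c, p.1.1 with hY
    set ψ : α → β → K := fun e =>
      if he : ∃ p ∈ c, e ∈ p.1.1 then he.choose.1.2 e else m.1.2 e with hψ
    have hψp : ∀ p ∈ c, EqOn p.1.2 ψ p.1.1 := by
      intro p hp e he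
      have h : ∃ p ∈ c, e ∈ p.1.1 := ⟨p, hp, he⟩
      simp only [hψ]
      rw [dif_pos h]
      obtain ⟨h1, h2⟩ := h.choose_spec
      by_cases hpq : p = h.choose
      · rw [← hpq]
      · rcases hc hp h1 hpq with h | h
        · exact h.2 he
        · exact (h.2 h2).symm
    have hmY : m.1.1 ⊆ Y := subset_biUnion_of_mem (u := fun p : S => p.1.1) hm
    have hψstd : Std ψ t₀ := fun b => by
      rw [← hψp m hm (m.2.1 (mem_range_self b)), m.2.2.1 b]
    have hfinc : ∀ Z : Set α, Z.Finite → Z ⊆ Y → ∃ p ∈ c, Z ⊆ p.1.1 := by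
      intro Z hZ
      induction Z, hZ using Set.Finite.induction_on with
      | empty => exact fun _ => ⟨m, hm, empty_subset _⟩
      | @insert a Z _ _ ih =>
        intro haZ
        obtain ⟨p, hp, hpZ⟩ := ih ((subset_insert _ _).trans haZ)
        obtain ⟨q, hq, haq⟩ := mem_iUnion₂.mp (haZ (mem_insert a Z))
        by_cases hpq : p = q
        · subst hpq
          exact ⟨p, hp, insert_subset haq hpZ⟩
        · rcases hc hp hq hpq with h | h
          · exact ⟨q, hq, insert_subset haq (hpZ.trans h.1)⟩
          · exact ⟨p, hp, insert_subset (h.1 haq) hpZ⟩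
    refine ⟨⟨⟨Y, ψ⟩, m.2.1.trans hmY, hψstd, fun R => Good.of_finite fun Z hZY hZ => ?_⟩,
      fun p hp => ⟨subset_biUnion_of_mem (u := fun p : S => p.1.1) hp, hψp p hp⟩⟩
    obtain ⟨p, hp, hpZ⟩ := hfinc Z hZ hZY
    refine ((p.2.2.2 R).mono hpZ).congr fun e he => ?_
    funext i
    exact congrFun (hψp p hp (hpZ he)) i

end Infinite

section Independence

variable {F K : Type*} [Field F] [Field K] {α β : Type*} [DecidableEq β]
  {φ : α → β → F} {φ' : α → β → K} {t₀ : β → α}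

lemma linearIndepOn_res {R : Finset β} {I : Set α}
    (h : ∀ e ∈ I, Function.support (φ e) ⊆ R) :
    LinearIndepOn F (res R φ) I ↔ LinearIndepOn F φ I := by
  refine LinearMap.linearIndepOn_iff_of_injOn (v := φ) (s := I)
    (LinearMap.funLeft F F (Subtype.val : R → β)) fun x hx y hy hxy => ?_
  have key : ∀ x ∈ Submodule.span F (φ '' I), ∀ b ∉ R, x b = 0 := by
    intro x hx b hb
    induction hx using Submodule.span_induction with
    | mem x hx =>
      obtain ⟨e, he, rfl⟩ := hx
      exact Function.notMem_support.mp fun hs => hb (h e he hs)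
    | zero => rfl
    | add x y _ _ hx hy => simp [hx, hy]
    | smul c x _ hx => simp [hx]
  funext b
  by_cases hb : b ∈ R
  · exact congrFun hxy ⟨b, hb⟩
  · rw [key x hx b hb, key y hy b hb]

lemma Std.support_subset (hφ : Std φ t₀) {R : Finset β} {b : β} (hb : b ∈ R) :
    Function.support (φ (t₀ b)) ⊆ R := by
  rw [hφ]
  exact Pi.support_single_subset.trans (by simpa using hb)

lemma linearIndepOn_of_sameZero (hφ : Std φ t₀)
    (hfin : ∀ e, (Function.support (φ e)).Finite)
    (h : ∀ R : Finset β, SameZero (res R φ) (res R φ') univ) {I : Set α}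
    (hI : LinearIndepOn F φ I) : LinearIndepOn K φ' I := by
  classical
  refine linearIndepOn_of_finite I fun I₀ hI₀ hf => ?_
  replace hI := hI.mono hI₀
  set R : Finset β := hf.toFinset.biUnion fun e => (hfin e).toFinset with hR
  have hsupp : ∀ e ∈ I₀, Function.support (φ e) ⊆ R := by
    intro e he b hb
    simp only [hR, Finset.coe_biUnion, mem_iUnion]
    exact ⟨e, by simpa using he, by simpa using hb⟩
  rw [← linearIndepOn_res hsupp] at hI
  obtain ⟨J, -, hIJ, hJspan, hJ⟩ := exists_linearIndepOn_extension hI (subset_univ I₀)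
  have htop : ⊤ ≤ Submodule.span F (range fun e : J => res R φ e) := by
    rw [← (Pi.basisFun F R).span_eq, Submodule.span_le]
    rintro _ ⟨i, rfl⟩
    have h1 : (Pi.basisFun F R) i = res R φ (t₀ i) := by
      funext j
      rw [Pi.basisFun_apply, Pi.single_apply, res, hφ, Pi.single_apply]
      simp only [Subtype.ext_iff]
    rw [h1, ← image_eq_range]
    exact hJspan (mem_image_of_mem _ (mem_univ _))
  let σ : R ≃ J := (Pi.basisFun F R).indexEquiv (Module.Basis.mk hJ htop)
  have hD : D (res R φ) (fun i => (σ i : α)) ≠ 0 :=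
    D_ne_zero_iff.mpr (LinearIndependent.comp hJ σ σ.injective)
  have hD' := D_ne_zero_iff.mp ((h R _ fun _ => mem_univ _).not.mp hD)
  have hJ' : LinearIndepOn K (res R φ') J := by
    have := LinearIndependent.comp hD' σ.symm σ.symm.injective
    simp only [Function.comp_def, Equiv.apply_symm_apply] at this
    exact this
  exact LinearIndependent.of_comp (LinearMap.funLeft K K (Subtype.val : R → β)) (hJ'.mono hIJ)

lemma linearIndependent_comp_iff {ι V : Type*} [AddCommGroup V] [Module F V] {v : α → V}
    (t : ι → α) :
    LinearIndependent F (fun i => v (t i)) ↔ Function.Injective t ∧ LinearIndepOn F v (range t) := by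
  constructor
  · intro h
    have : Function.Injective t := fun i j hij => h.injective (congrArg v hij)
    exact ⟨this, (linearIndepOn_range_iff this v).mpr h⟩
  · rintro ⟨h, h'⟩
    exact (linearIndepOn_range_iff h v).mp h'

lemma sameZero_of_linearIndepOn_iff (hφ : Std φ t₀) (hφ' : Std φ' t₀)
    (hfin : ∀ e, (Function.support (φ e)).Finite)
    (hfin' : ∀ e, (Function.support (φ' e)).Finite)
    (h : ∀ I, LinearIndepOn F φ I ↔ LinearIndepOn K φ' I) (R : Finset β) :
    SameZero (res R φ) (res R φ') univ := by
  classical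
  intro t _
  set R' : Finset β := R ∪ Finset.univ.biUnion
    fun i => (hfin (t i)).toFinset ∪ (hfin' (t i)).toFinset with hR'
  have hR : R ⊆ R' := Finset.subset_union_left
  have hs : ∀ i, Function.support (φ (t i)) ⊆ R' := by
    intro i b hb
    simp only [hR', Finset.mem_coe, Finset.mem_union, Finset.mem_biUnion]
    exact Or.inr ⟨i, Finset.mem_univ _, Or.inl (by simpa using hb)⟩
  have hs' : ∀ i, Function.support (φ' (t i)) ⊆ R' := by
    intro i b hb
    simp only [hR', Finset.mem_coe, Finset.mem_union, Finset.mem_biUnion]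
    exact Or.inr ⟨i, Finset.mem_univ _, Or.inr (by simpa using hb)⟩
  have key : ∀ e ∈ range (ext t₀ R' t),
      Function.support (φ e) ⊆ R' ∧ Function.support (φ' e) ⊆ R' := by
    rintro _ ⟨i, rfl⟩
    unfold ext
    split_ifs with h
    · exact ⟨hs _, hs' _⟩
    · exact ⟨hφ.support_subset i.2, hφ'.support_subset i.2⟩
  rw [← D_res hφ hR, ← D_res hφ' hR, ← not_iff_not]
  change D _ _ ≠ 0 ↔ D _ _ ≠ 0
  rw [D_ne_zero_iff, D_ne_zero_iff, linearIndependent_comp_iff, linearIndependent_comp_iff,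
    linearIndepOn_res fun e he => (key e he).1, linearIndepOn_res fun e he => (key e he).2, h]

end Independence

section Matroid

variable {α : Type*} {M : Matroid α} {F : Type*} [Field F] {V : Type*} [AddCommGroup V] [Module F V]

/-- The vectors `φ` represent the matroid `M`. -/
def Represents (M : Matroid α) (F : Type*) [Field F] {V : Type*} [AddCommGroup V] [Module F V]
    (φ : M.E → V) : Prop :=
  ∀ I : Set M.E, M.Indep (Subtype.val '' I) ↔ LinearIndepOn F φ I

lemma Represents.mem_span {φ : M.E → V} (h : Represents M F φ) {B : Set α} (hB : M.IsBase B)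
    (e : M.E) : φ e ∈ Submodule.span F (range fun b : B => φ ⟨b, hB.subset_ground b.2⟩) := by
  set B' : Set M.E := Subtype.val ⁻¹' B with hB'
  have hBB : Subtype.val '' B' = B := by
    simpa [hB'] using hB.subset_ground
  have h1 : φ '' B' ⊆ range fun b : B => φ ⟨b, hB.subset_ground b.2⟩ := by
    rintro _ ⟨b, hb, rfl⟩
    exact ⟨⟨b, hb⟩, rfl⟩
  by_cases he : e ∈ B'
  · exact Submodule.subset_span (h1 (mem_image_of_mem _ he))
  · by_contra hspan
    have h2 := (h B').mp (by rw [hBB]; exact hB.indep)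
    have h3 := (linearIndepOn_insert he).mpr ⟨h2, fun h => hspan (Submodule.span_mono h1 h)⟩
    have h4 := (h _).mpr h3
    rw [image_insert_eq, hBB] at h4
    exact he (by
      have := hB.eq_of_subset_indep h4 (subset_insert _ _)
      rw [hB', mem_preimage, this]
      exact mem_insert _ _)

/-- Coordinates of a representation in a base of the matroid. -/
lemma Represents.exists_std {φ : M.E → V} (h : Represents M F φ) {B : Set α} (hB : M.IsBase B)
    [DecidableEq B] :
    ∃ φ' : M.E → B → F, Represents M F φ' ∧ (∀ e, (Function.support (φ' e)).Finite) ∧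
      Std φ' fun b => ⟨b, hB.subset_ground b.2⟩ := by
  set t₀ : B → M.E := fun b => ⟨b, hB.subset_ground b.2⟩ with ht₀
  have hinj : Function.Injective t₀ := fun b c h => Subtype.ext (congrArg (fun e : M.E => (e : α)) h)
  have hli : LinearIndependent F fun b => φ (t₀ b) := by
    refine (linearIndependent_comp_iff t₀).mpr ⟨hinj, (h _).mp ?_⟩
    rw [← range_comp]
    convert hB.indep
    exact Subtype.range_coe
  set b := Module.Basis.span hli with hb
  set ψ : M.E → Submodule.span F (range fun b => φ (t₀ b)) := fun e => ⟨φ e, h.mem_span hB e⟩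
    with hψ
  set L : Submodule.span F (range fun b => φ (t₀ b)) →ₗ[F] B → F :=
    (Finsupp.lcoeFun).comp b.repr.toLinearMap with hL
  refine ⟨fun e => L (ψ e), fun I => ?_, fun e => ?_, fun c => ?_⟩
  · rw [h I]
    have h1 : LinearIndepOn F (fun e => L (ψ e)) I ↔ LinearIndepOn F ψ I :=
      LinearMap.linearIndepOn_iff_of_injOn (v := ψ) (s := I) L
        (Function.Injective.injOn (DFunLike.coe_injective.comp b.repr.injective))
    have h2 : LinearIndepOn F φ I ↔ LinearIndepOn F ψ I :=
      LinearMap.linearIndepOn_iff_of_injOn (v := ψ) (s := I) (Submodule.subtype _)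
        (Function.Injective.injOn Subtype.val_injective)
    rw [h1, h2]
  · exact (b.repr (ψ e)).hasFiniteSupport
  · have h1 : ψ (t₀ c) = b c := Subtype.ext (by simp [hψ, hb, Module.Basis.span_apply])
    funext d
    simp [h1, hL, Finsupp.single_apply, Pi.single_apply, eq_comm]

end Matroid

section Transfer

/-- A matroid represented over `F` and over the field with three elements is representable over
each field `K` with a lifting map from `F`. -/
theorem exists_represents {F : Type v} {K : Type w} [Field F] [Field K] {f : F → K}
    (hf : IsLift f) (hneg : f (-1) = -1) {α : Type u} {M : Matroid α}
    {V V₃ : Type*} [AddCommGroup V] [Module F V] [AddCommGroup V₃] [Module (ZMod 3) V₃]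
    {φ : M.E → V} (hφ : Represents M F φ) {φ₃ : M.E → V₃} (hφ₃ : Represents M (ZMod 3) φ₃) :
    ∃ (β : Type u) (φ' : M.E → β → K), Represents M K φ' := by
  classical
  obtain ⟨B, hB⟩ := M.exists_isBase
  obtain ⟨A, hA, hAf, hA₀⟩ := hφ.exists_std hB
  obtain ⟨A₃, hA₃, hA₃f, hA₃₀⟩ := hφ₃.exists_std hB
  have hz := sameZero_of_linearIndepOn_iff hA₀ hA₃₀ hAf hA₃f fun I => by rw [← hA, ← hA₃]
  have hinj : Function.Injective fun b : B => (⟨b, hB.subset_ground b.2⟩ : M.E) :=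
    fun b c h => Subtype.ext (congrArg (fun e : M.E => (e : α)) h)
  obtain ⟨A', hA'₀, hA'⟩ := exists_lifts (K := K) hf hneg hinj hA₀ hAf hz
  refine ⟨B, A', fun I => (hA I).trans ⟨?_, ?_⟩⟩
  · exact linearIndepOn_of_sameZero hA₀ hAf fun R => (hA' R).zero
  · refine linearIndepOn_of_sameZero hA'₀ (fun e => (hAf e).subset fun b hb => ?_)
      fun R t ht => ((hA' R).zero t ht).symm
    exact fun h => hb ((hA'.apply_eq_zero_iff hA₀ hA'₀ (subset_univ _) (mem_univ e) b).mp h)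

end Transfer

section Lift

variable {F K : Type*} [Field F] [Field K]

lemma exists_isLift [Finite F] (h2 : (2 : F) ≠ 0) (hroot : ∀ x : F, x ^ 2 - x + 1 ≠ 0)
    (hK : (2 : K) ≠ 0) : ∃ f : F → K, IsLift f ∧ f (-1) = -1 := by
  classical
  obtain ⟨e₀, he₀⟩ : ∃ e : F → ℕ, Function.Injective e :=
    ⟨fun x => Finite.equivFin F x, Fin.val_injective.comp (Finite.equivFin F).injective⟩
  set e : F → ℕ := fun x => if x = -1 then 0 else e₀ x + 1 with he
  have hinj : ∀ x y, e x = e y → x = y := by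
    intro x y hxy
    simp only [he] at hxy
    split_ifs at hxy with h1 h2
    · rw [h1, h2]
    · exact he₀ (by omega)
  have hm1 : e (-1) = 0 := by simp [he]
  set m : F → ℕ := fun x => min (e x) (e x⁻¹) with hm
  have m_inv : ∀ x, m x⁻¹ = m x := fun x => by simp only [hm, inv_inv, min_comm]
  have m_eq : ∀ x y, m x = m y → x = y ∨ x = y⁻¹ := by
    intro x y hxy
    simp only [hm] at hxy
    rcases min_choice (e x) (e x⁻¹) with h | h <;> rcases min_choice (e y) (e y⁻¹) with h' | h' <;>
      rw [h, h'] at hxy <;> have := hinj _ _ hxy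
    · exact Or.inl this
    · exact Or.inr this
    · exact Or.inr (by rw [← this, inv_inv])
    · exact Or.inl (inv_injective this)
  have m_neg : m (-1) = 0 := by simp [hm, hm1]
  have uniq : ∀ x : F, x ≠ 0 → x ≠ 1 →
      (m x < m (1 - x) ∧ m x < m (x / (x - 1))) ∨
      (m (1 - x) < m x ∧ m (1 - x) < m (x / (x - 1))) ∨
      (m (x / (x - 1)) < m x ∧ m (x / (x - 1)) < m (1 - x)) := by
    intro x h0 h1
    have h1' : x - 1 ≠ 0 := sub_ne_zero.mpr h1
    have h1'' : 1 - x ≠ 0 := sub_ne_zero.mpr h1.symm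
    have e12 : m x = m (1 - x) → m (x / (x - 1)) = 0 := by
      intro h
      rcases m_eq _ _ h with h | h
      · rw [show x / (x - 1) = -1 by rw [div_eq_iff h1']; linear_combination h, m_neg]
      · refine absurd ?_ (hroot x)
        field_simp at h
        linear_combination -h
    have e13 : m x = m (x / (x - 1)) → m (1 - x) = 0 := by
      intro h
      rcases m_eq _ _ h with h | h
      · field_simp at h
        rw [show 1 - x = -1 by linear_combination -h, m_neg]
      · refine absurd ?_ (hroot x)
        field_simp at h
        linear_combination h
    have e23 : m (1 - x) = m (x / (x - 1)) → m x = 0 := by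
      intro h
      rcases m_eq _ _ h with h | h
      · refine absurd ?_ (hroot x)
        field_simp at h
        linear_combination -h
      · have h' : (x - 1) * (x + 1) = 0 := by
          field_simp at h
          linear_combination -h
        have := (mul_eq_zero.mp h').resolve_left h1'
        rw [show x = -1 by linear_combination this, m_neg]
    have z12 : ¬ (m x = 0 ∧ m (1 - x) = 0) := by
      rintro ⟨h, h'⟩
      have h3 : x = -1 := by
        rcases m_eq _ _ (h.trans m_neg.symm) with h | h
        · exact h
        · rw [h]; norm_num
      have h4 : 1 - x = -1 := by
        rcases m_eq _ _ (h'.trans m_neg.symm) with h | h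
        · exact h
        · rw [h]; norm_num
      exact hroot x (by rw [h3] at h4 ⊢; linear_combination h4)
    have z13 : ¬ (m x = 0 ∧ m (x / (x - 1)) = 0) := by
      rintro ⟨h, h'⟩
      have h3 : x = -1 := by
        rcases m_eq _ _ (h.trans m_neg.symm) with h | h
        · exact h
        · rw [h]; norm_num
      have h4 : x / (x - 1) = -1 := by
        rcases m_eq _ _ (h'.trans m_neg.symm) with h | h
        · exact h
        · rw [h]; norm_num
      rw [div_eq_iff h1'] at h4
      exact hroot x (by rw [h3] at h4 ⊢; linear_combination -h4)
    have z23 : ¬ (m (1 - x) = 0 ∧ m (x / (x - 1)) = 0) := by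
      rintro ⟨h, h'⟩
      have h3 : 1 - x = -1 := by
        rcases m_eq _ _ (h.trans m_neg.symm) with h | h
        · exact h
        · rw [h]; norm_num
      have h4 : x / (x - 1) = -1 := by
        rcases m_eq _ _ (h'.trans m_neg.symm) with h | h
        · exact h
        · rw [h]; norm_num
      rw [div_eq_iff h1'] at h4
      have h5 : x = 2 := by linear_combination -h3
      exact hroot x (by rw [h5] at h4 ⊢; linear_combination h4)
    omega
  set f : F → K := fun x => if x = 0 then 0 else if x = 1 then 1 else
    if m x < m (1 - x) ∧ m x < m (x / (x - 1)) then -1 else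
      if m (1 - x) < m (x / (x - 1)) then 2 else 2⁻¹ with hf
  have f0 : f 0 = 0 := by simp [hf]
  have f1 : f 1 = 1 := by simp [hf]
  have fx : ∀ x, x ≠ 0 → x ≠ 1 → f x = if m x < m (1 - x) ∧ m x < m (x / (x - 1)) then -1 else
      if m (1 - x) < m (x / (x - 1)) then 2 else 2⁻¹ := by
    intro x h0 h1
    simp only [hf, if_neg h0, if_neg h1]
  refine ⟨f, ⟨f0, f1, fun x => ?_, fun x => ?_, fun x hx => ?_⟩, ?_⟩
  · by_cases h0 : x = 0
    · simp [h0, f0]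
    by_cases h1 : x = 1
    · simp [h1, f1]
    have h1' : x - 1 ≠ 0 := sub_ne_zero.mpr h1
    have h1'' : 1 - x ≠ 0 := sub_ne_zero.mpr (Ne.symm h1)
    have a2 : m (1 - x⁻¹) = m (x / (x - 1)) := by
      rw [← m_inv]; congr 1; field_simp
    have a3 : m (x⁻¹ / (x⁻¹ - 1)) = m (1 - x) := by
      rw [← m_inv]; congr 1; field_simp
    have := uniq x h0 h1
    rw [fx _ (inv_ne_zero h0) (by simpa using h1), fx x h0 h1, a2, a3, m_inv]
    split_ifs <;> first | omega | norm_num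
  · by_cases h0 : x = 0
    · simp [h0, f0, f1]
    by_cases h1 : x = 1
    · simp [h1, f1, f0]
    have h1' : x - 1 ≠ 0 := sub_ne_zero.mpr h1
    have a2 : m (1 - (1 - x)) = m x := by rw [sub_sub_cancel]
    have a3 : m ((1 - x) / (1 - x - 1)) = m (x / (x - 1)) := by
      rw [← m_inv]; congr 1
      rw [inv_div, show 1 - x - 1 = -x by ring, show 1 - x = -(x - 1) by ring, neg_div_neg_eq]
    have := uniq x h0 h1
    rw [fx _ (sub_ne_zero.mpr (Ne.symm h1)) (by simpa using h0), fx x h0 h1, a2, a3]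
    split_ifs <;> first | omega | (field_simp; norm_num)
  · by_contra h0
    by_cases h1 : x = 1
    · rw [h1, f1] at hx
      exact one_ne_zero hx
    rw [fx x h0 h1] at hx
    split_ifs at hx
    · exact one_ne_zero (neg_eq_zero.mp hx)
    · exact hK hx
    · exact inv_ne_zero hK hx
  · have h1 : (-1 : F) ≠ 1 := fun h => h2 (by linear_combination -h)
    have := uniq (-1) (by simp) h1
    rw [fx _ (by simp) h1, if_pos]
    omega

lemma no_root [Finite F] (hF : Nat.card F % 3 = 2) (x : F) : x ^ 2 - x + 1 ≠ 0 := by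
  intro h
  have := Fintype.ofFinite F
  rw [Nat.card_eq_fintype_card] at hF
  have hx : -x ≠ 0 := by
    intro h0
    rw [neg_eq_zero.mp h0] at h
    simp at h
  have h3 : (-x) ^ 3 = 1 := by linear_combination -(x + 1) * h
  have hq := FiniteField.pow_card_sub_one_eq_one (-x) hx
  have h1 : -x = 1 := by
    have : Fintype.card F - 1 = 3 * (Fintype.card F / 3) + 1 := by omega
    rwa [this, pow_succ, pow_mul, h3, one_pow, one_mul] at hq
  have h3' : ((3 : ℕ) : F) = 0 := by
    push_cast
    linear_combination h + (x - 2) * h1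
  have hdvd : ringChar F = 3 := by
    have h4 := ringChar.dvd h3'
    rcases (Nat.dvd_prime Nat.prime_three).mp h4 with h5 | h5
    · exact absurd h5 (CharP.ringChar_ne_one)
    · exact h5
  have : CharP F 3 := hdvd ▸ ringChar.charP F
  have h6 : ((Fintype.card F : ℕ) : F) = 0 := by simp
  have := (CharP.cast_eq_zero_iff F 3 _).mp h6
  omega

end Lift

section Representable

lemma Represents.representable {α : Type u} {M : Matroid α} {K : Type v} [Field K] {β : Type u}
    {φ : M.E → β → K} (h : Represents M K φ) : ∃ ψ : α → β → K, ∀ I ⊆ M.E, (M.Indep I ↔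
      LinearIndependent K fun x : I => ψ x) := by
  classical
  refine ⟨fun e => if he : e ∈ M.E then φ ⟨e, he⟩ else 0, fun I hI => ?_⟩
  have h1 := h (Subtype.val ⁻¹' I)
  rw [Subtype.image_preimage_coe, inter_eq_right.mpr hI] at h1
  rw [h1]
  let σ : (Subtype.val ⁻¹' I : Set M.E) ≃ I :=
    ⟨fun e => ⟨e.1, e.2⟩, fun e => ⟨⟨e, hI e.2⟩, e.2⟩, fun _ => rfl, fun _ => rfl⟩
  refine linearIndependent_equiv' σ ?_
  funext e
  simp [σ]

lemma represents_of_forall {α : Type*} {M : Matroid α} {F V : Type*} [Field F] [AddCommGroup V]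
    [Module F V] {φ : α → V}
    (h : ∀ I ⊆ M.E, (M.Indep I ↔ LinearIndependent F fun x : I => φ x)) :
    Represents M F fun e : M.E => φ e := by
  intro I
  rw [h _ (by rintro _ ⟨e, -, rfl⟩; exact e.2)]
  exact (linearIndependent_equiv' (Equiv.Set.image _ I Subtype.val_injective) rfl).symm

lemma Represents.of_ringEquiv {α : Type u} {M : Matroid α} {F K V : Type*} [Field F] [Field K]
    [AddCommGroup V] [Module K V] (σ : F ≃+* K) {φ : M.E → V} (h : Represents M K φ) :
    ∃ (β : Type u) (ψ : M.E → β → F), Represents M F ψ := by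
  classical
  obtain ⟨B, hB⟩ := M.exists_isBase
  obtain ⟨ψ, hψ, -, -⟩ := h.exists_std hB
  refine ⟨B, fun e b => σ.symm (ψ e b), fun I => (hψ I).trans ⟨fun h => ?_, fun h => ?_⟩⟩
  · exact LinearIndependent.map_of_surjective_injectiveₛ h σ.symm
      (AddMonoidHom.compLeft σ.symm.toAddMonoidHom B) σ.symm.surjective
      (σ.symm.injective.comp_left) fun r m => by funext b; simp
  · have := LinearIndependent.map_of_surjective_injectiveₛ h σ
      (AddMonoidHom.compLeft σ.toAddMonoidHom B) σ.surjective
      (σ.injective.comp_left) fun r m => by funext b; simp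
    have heq : (AddMonoidHom.compLeft σ.toAddMonoidHom B) ∘ (fun e : I => fun b => σ.symm (ψ e b)) =
        fun e : I => ψ e := by
      funext e b
      simp
    rw [LinearIndepOn, ← heq]
    exact this

end Representable

end VecConfig

lemma ULift.representable {α : Type u} {M : Matroid α} {F : Type} [Field F]
    (h : Paper.Representable M (ULift.{v} F)) : Paper.Representable M F := by
  obtain ⟨V, _, _, φ, hφ⟩ := h
  obtain ⟨β, ψ, hψ⟩ := (VecConfig.represents_of_forall hφ).of_ringEquiv
    (ULift.ringEquiv (R := F)).symm
  obtain ⟨ψ', h⟩ := hψ.representable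
  exact ⟨β → F, inferInstance, inferInstance, ψ', h⟩

/-- Let `q = p ^ n` be an odd prime power with `q ≡ 2 (mod 3)`. A matroid
`M` is representable over both `𝔽₃` and `𝔽_q` if and only if `M` is representable over
every field of characteristic different from `2`. -/
theorem representable_F3_and_Fq_iff_representable_over_char_ne_two_fields
    (p n : ℕ) [Fact p.Prime] (hp : p ≠ 2) (hn : n ≠ 0) (hq : p ^ n % 3 = 2)
    {α : Type u} (M : Matroid α) :
    (Paper.Representable M (ZMod 3) ∧ Paper.Representable M (GaloisField p n)) ↔
      ∀ (K : Type v) [Field K], ringChar K ≠ 2 → Paper.Representable M K := by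
  constructor
  · rintro ⟨⟨V₃, _, _, φ₃, h₃⟩, ⟨V, _, _, φ, h⟩⟩ K _ hK
    have hchar : ringChar (GaloisField p n) = p := ringChar.eq _ p
    have h2 : (2 : GaloisField p n) ≠ 0 := Ring.two_ne_zero (by rwa [hchar])
    obtain ⟨f, hf, hneg⟩ := VecConfig.exists_isLift h2
      (VecConfig.no_root (by rwa [GaloisField.card p n hn])) (Ring.two_ne_zero hK)
    obtain ⟨β, φ', hφ'⟩ := VecConfig.exists_represents hf hneg
      (VecConfig.represents_of_forall h) (VecConfig.represents_of_forall h₃)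
    obtain ⟨ψ, hψ⟩ := hφ'.representable
    exact ⟨β → K, inferInstance, inferInstance, ψ, hψ⟩
  · intro h
    have key : ∀ (F : Type) [Field F] (q : ℕ) [CharP F q], q ≠ 2 → Paper.Representable M F := by
      intro F _ q _ hq
      refine ULift.representable.{u, v} (h _ ?_)
      rwa [ringChar.eq (ULift.{v} F) q]
    exact ⟨key _ 3 (by norm_num), key _ p hp⟩
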